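/- For every integer n ≥ 0: C(1,8;4n+2) = C(3,8;4n+2) = N(0,8;4n+2) = N(2,8;4n+2). -/

import Mathlib

/-- The rank of a partition: its largest part minus its number of parts. -/
def partitionRank {n : ℕ} (π : n.Partition) : ℤ :=
  (π.parts.sup : ℤ) - π.parts.card

/-- The crank of a partition: the largest part if there are no parts equal to 1,
otherwise the number of parts larger than the number of ones minus the number of ones. -/
def partitionCrank {n : ℕ} (π : n.Partition) : ℤ :=
  if π.parts.count 1 = 0 then (π.parts.sup : ℤ)
  else ((π.parts.filter (fun x => π.parts.count 1 < x)).card : ℤ) - π.parts.count 1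

/-- `N(a,M;n)`: the number of partitions of `n` whose rank is congruent to `a` modulo `M`. -/
def rankCount (a : ℤ) (M : ℕ) (n : ℕ) : ℕ :=
  (Finset.univ.filter (fun π : n.Partition => partitionRank π % M = a % M)).card

/-- `C(a,M;n)`: the number of partitions of `n` whose crank is congruent to `a` modulo `M`. -/
def crankCount (a : ℤ) (M : ℕ) (n : ℕ) : ℕ :=
  (Finset.univ.filter (fun π : n.Partition => partitionCrank π % M = a % M)).card

set_option linter.all false
open PowerSeries


abbrev PS := PowerSeries ℂ

def LF {ι : Type*} (f : ι → PS) : Prop := ∀ d, (Function.support fun i => coeff d (f i)).Finite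

noncomputable def fs {ι : Type*} (f : ι → PS) : PS := PowerSeries.mk fun d => ∑ᶠ i, coeff d (f i)

theorem coeff_fs {ι : Type*} (f : ι → PS) (d : ℕ) : coeff d (fs f) = ∑ᶠ i, coeff d (f i) := by
  simp [fs]

theorem LF.of_dvd {ι : Type*} {f : ι → PS} (e : ι → ℕ) (h : ∀ i, X ^ (e i) ∣ f i)
    (he : ∀ d, {i | e i ≤ d}.Finite) : LF f := by
  intro d
  refine (he d).subset ?_
  intro i hi
  by_contra hcon
  simp only [Set.mem_setOf_eq, not_le] at hcon
  exact hi (X_pow_dvd_iff.1 (h i) d hcon)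

theorem LF.mul_left {ι : Type*} {f : ι → PS} (hf : LF f) (g : ι → PS) : LF (fun i => g i * f i) := by
  intro d
  refine (Set.Finite.biUnion (Finset.range (d+1)).finite_toSet (fun e _ => hf e)).subset ?_
  intro i hi
  simp only [Function.mem_support, coeff_mul] at hi
  obtain ⟨p, hp, hne⟩ := Finset.exists_ne_zero_of_sum_ne_zero hi
  simp only [Set.mem_iUnion]
  refine ⟨p.2, ?_, right_ne_zero_of_mul hne⟩
  have := Finset.HasAntidiagonal.mem_antidiagonal.1 hp
  simp; omega

theorem LF.mul_right {ι : Type*} {f : ι → PS} (hf : LF f) (g : ι → PS) : LF (fun i => f i * g i) := by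
  simpa [mul_comm] using hf.mul_left g

theorem LF.add {ι : Type*} {f g : ι → PS} (hf : LF f) (hg : LF g) : LF (fun i => f i + g i) := by
  intro d
  refine ((hf d).union (hg d)).subset ?_
  intro i hi
  by_contra h
  simp only [Set.mem_union, Function.mem_support, not_or, not_not] at h
  exact hi (by simp [h.1, h.2])

theorem LF.neg {ι : Type*} {f : ι → PS} (hf : LF f) : LF (fun i => - f i) := by
  simpa using hf.mul_left (fun _ => -1)

theorem LF.sub {ι : Type*} {f g : ι → PS} (hf : LF f) (hg : LF g) : LF (fun i => f i - g i) := by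
  simpa [sub_eq_add_neg] using hf.add hg.neg

theorem LF.comp {ι κ : Type*} {f : ι → PS} (hf : LF f) {g : κ → ι} (hg : Function.Injective g) :
    LF (fun k => f (g k)) := by
  intro d
  exact (hf d).preimage (hg.injOn)

theorem LF.of_finite {ι : Type*} {f : ι → PS} (s : Set ι) (hs : s.Finite) (h : ∀ i, i ∉ s → f i = 0) :
    LF f := by
  intro d
  refine hs.subset ?_
  intro i hi
  by_contra hcon
  exact hi (by simp [h i hcon])

theorem fs_congr {ι : Type*} {f g : ι → PS} (h : ∀ i, f i = g i) : fs f = fs g := by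
  rw [funext h]

theorem fs_add {ι : Type*} {f g : ι → PS} (hf : LF f) (hg : LF g) :
    fs (fun i => f i + g i) = fs f + fs g := by
  ext d
  simp only [coeff_fs, map_add]
  exact finsum_add_distrib (hf d) (hg d)

theorem fs_mul_left {ι : Type*} {f : ι → PS} (hf : LF f) (a : PS) :
    fs (fun i => a * f i) = a * fs f := by
  ext d
  simp only [coeff_fs, coeff_mul]
  rw [finsum_sum_comm]
  · refine Finset.sum_congr rfl fun p _ => ?_
    rw [← mul_finsum' _ _ ]
    exact hf p.2
  · intro p _
    refine (hf p.2).subset ?_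
    intro i hi
    exact right_ne_zero_of_mul hi

theorem fs_mul_right {ι : Type*} {f : ι → PS} (hf : LF f) (a : PS) :
    fs (fun i => f i * a) = fs f * a := by
  rw [mul_comm, ← fs_mul_left hf]; simp only [mul_comm]

theorem fs_neg {ι : Type*} {f : ι → PS} : fs (fun i => - f i) = - fs f := by
  ext d
  simp only [coeff_fs, map_neg]
  exact finsum_neg_distrib _

theorem fs_sub {ι : Type*} {f g : ι → PS} (hf : LF f) (hg : LF g) :
    fs (fun i => f i - g i) = fs f - fs g := by
  simp only [sub_eq_add_neg]
  rw [fs_add hf hg.neg, fs_neg]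

theorem fs_equiv {ι κ : Type*} (e : ι ≃ κ) (f : κ → PS) : fs (fun i => f (e i)) = fs f := by
  ext d
  simp only [coeff_fs]
  exact finsum_comp_equiv e (f := fun k => coeff d (f k))

theorem LF.fst {ι κ : Type*} {f : ι × κ → PS} (hf : LF f) : LF (fun i => fs fun j => f (i, j)) := by
  intro d
  refine ((hf d).image Prod.fst).subset ?_
  intro i hi
  simp only [Function.mem_support, coeff_fs] at hi
  obtain ⟨j, hj⟩ : ∃ j, coeff d (f (i, j)) ≠ 0 := by
    by_contra hcon
    push Not at hcon
    exact hi (finsum_eq_zero_of_forall_eq_zero hcon)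
  exact ⟨(i, j), hj, rfl⟩

theorem LF.sec {ι κ : Type*} {f : ι × κ → PS} (hf : LF f) (i : ι) : LF (fun j => f (i, j)) :=
  hf.comp (Prod.mk_right_injective i)

theorem fs_prod {ι κ : Type*} {f : ι × κ → PS} (hf : LF f) :
    fs f = fs (fun i => fs fun j => f (i, j)) := by
  ext d
  simp only [coeff_fs]
  exact finsum_curry _ (hf d)

theorem LF.swap {ι κ : Type*} {f : ι × κ → PS} (hf : LF f) : LF (fun p : κ × ι => f (p.2, p.1)) :=
  hf.comp (g := Prod.swap) Prod.swap_injective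

theorem fs_comm {ι κ : Type*} {f : ι → κ → PS} (hf : LF (fun p : ι × κ => f p.1 p.2)) :
    fs (fun i => fs fun j => f i j) = fs (fun j => fs fun i => f i j) := by
  rw [← fs_prod hf, ← fs_prod hf.swap]
  exact (fs_equiv (Equiv.prodComm κ ι) (fun p : ι × κ => f p.1 p.2)).symm

theorem LF.mul {ι κ : Type*} {f : ι → PS} {g : κ → PS} (hf : LF f) (hg : LF g) :
    LF (fun p : ι × κ => f p.1 * g p.2) := by
  intro d
  refine (Set.Finite.biUnion (Finset.HasAntidiagonal.antidiagonal d).finite_toSet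
    (fun e _ => (hf e.1).prod (hg e.2))).subset ?_
  intro i hi
  simp only [Function.mem_support, coeff_mul] at hi
  obtain ⟨p, hp, hne⟩ := Finset.exists_ne_zero_of_sum_ne_zero hi
  simp only [Set.mem_iUnion]
  exact ⟨p, hp, left_ne_zero_of_mul hne, right_ne_zero_of_mul hne⟩

theorem fs_mul {ι κ : Type*} {f : ι → PS} {g : κ → PS} (hf : LF f) (hg : LF g) :
    fs f * fs g = fs (fun p : ι × κ => f p.1 * g p.2) := by
  rw [fs_prod (hf.mul hg), ← fs_mul_right hf]
  exact fs_congr fun i => (fs_mul_left hg _).symm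

theorem fs_option {f : Option ℕ → PS} (hf : LF f) : fs f = f none + fs (fun n => f (some n)) := by
  ext d
  simp only [coeff_fs, map_add]
  have hfin := hf d
  have h2 : (∑ᶠ (i : Option ℕ) (_ : i ∈ ({none} ∪ Set.range some : Set (Option ℕ))), coeff d (f i)) =
      (∑ᶠ (i : Option ℕ) (_ : i ∈ ({none} : Set (Option ℕ))), coeff d (f i)) +
      ∑ᶠ (i : Option ℕ) (_ : i ∈ (Set.range some : Set (Option ℕ))), coeff d (f i) := by
    apply finsum_mem_union'
    · rw [Set.disjoint_left]; rintro x hx ⟨y, rfl⟩; simp at hx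
    · exact hfin.subset Set.inter_subset_right
    · exact hfin.subset Set.inter_subset_right
  rw [finsum_mem_singleton, finsum_mem_range (Option.some_injective ℕ)] at h2
  rw [← h2, show ({none} ∪ Set.range some : Set (Option ℕ)) = Set.univ by
    ext x; cases x <;> simp, finsum_mem_univ]

theorem fs_sum {ι κ : Type*} {f : ι ⊕ κ → PS} (hf : LF f) :
    fs f = fs (fun n => f (Sum.inl n)) + fs (fun n => f (Sum.inr n)) := by
  ext d
  simp only [coeff_fs, map_add]
  have hfin := hf d
  have h2 : (∑ᶠ (i : ι ⊕ κ) (_ : i ∈ (Set.range Sum.inl ∪ Set.range Sum.inr : Set (ι ⊕ κ))), coeff d (f i)) =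
      (∑ᶠ (i : ι ⊕ κ) (_ : i ∈ (Set.range Sum.inl : Set (ι ⊕ κ))), coeff d (f i)) +
      ∑ᶠ (i : ι ⊕ κ) (_ : i ∈ (Set.range Sum.inr : Set (ι ⊕ κ))), coeff d (f i) := by
    apply finsum_mem_union'
    · rw [Set.disjoint_left]; rintro x ⟨z, rfl⟩ ⟨y, hy⟩; simp at hy
    · exact hfin.subset Set.inter_subset_right
    · exact hfin.subset Set.inter_subset_right
  rw [finsum_mem_range Sum.inl_injective, finsum_mem_range Sum.inr_injective,
    Set.range_inl_union_range_inr, finsum_mem_univ] at h2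
  exact h2

theorem fs_nat {f : ℕ → PS} (hf : LF f) : fs f = f 0 + fs (fun n => f (n + 1)) := by
  let e' : Option ℕ ≃ ℕ :=
    { toFun := fun o => o.elim 0 (· + 1)
      invFun := fun n => Nat.casesOn n none some
      left_inv := by intro o; cases o <;> rfl
      right_inv := by intro n; cases n <;> rfl }
  rw [← fs_equiv e' f, fs_option (f := fun o => f (e' o)) (hf.comp e'.injective)]
  rfl

theorem fs_int {f : ℤ → PS} (hf : LF f) :
    fs f = f 0 + fs (fun n : ℕ => f (n + 1) + f (-(n + 1))) := by
  have hinj1 : Function.Injective (fun n : ℕ => ((n : ℤ) + 1)) := by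
    intro a b h; simpa using h
  have hinj2 : Function.Injective (fun n : ℕ => (-((n : ℤ) + 1))) := by
    intro a b h; simpa using h
  have hinj0 : Function.Injective (fun n : ℕ => ((n : ℤ))) := by
    intro a b h; simpa using h
  rw [← fs_equiv (Equiv.intEquivNatSumNat.symm) f,
    fs_sum (f := fun o => f (Equiv.intEquivNatSumNat.symm o)) (hf.comp Equiv.intEquivNatSumNat.symm.injective)]
  rw [fs_add (hf.comp hinj1) (hf.comp hinj2), ← add_assoc]
  congr 1
  · have := fs_nat (hf.comp hinj0)
    simp only [Nat.cast_zero, Nat.cast_add, Nat.cast_one] at this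
    exact this

/-- a power series divisible by all powers of `X` vanishes. -/
theorem eq_of_dvd {a b : PS} (h : ∀ N, X ^ N ∣ a - b) : a = b := by
  ext d
  have := X_pow_dvd_iff.1 (h (d+1)) d (by omega)
  rw [map_sub, sub_eq_zero] at this
  exact this

theorem dvd_fs {ι : Type*} {f : ι → PS} {N : ℕ} (h : ∀ i, X ^ N ∣ f i) : X ^ N ∣ fs f := by
  rw [X_pow_dvd_iff]
  intro m hm
  rw [coeff_fs]
  exact finsum_eq_zero_of_forall_eq_zero fun i => X_pow_dvd_iff.1 (h i) m hm


/-! ### infinite products -/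

def Adm (f : ℕ → PS) : Prop := ∀ i, X ^ i ∣ f i - 1

noncomputable def ip (f : ℕ → PS) : PS :=
  PowerSeries.mk fun d => coeff d (∏ i ∈ Finset.range (d + 1), f i)

theorem Adm.step {f : ℕ → PS} (hf : Adm f) {N M : ℕ} (h : N ≤ M) :
    X ^ N ∣ (∏ i ∈ Finset.range M, f i) - ∏ i ∈ Finset.range N, f i := by
  induction M, h using Nat.le_induction with
  | base => simp
  | succ M hM ih =>
    rw [Finset.prod_range_succ]
    have : (∏ i ∈ Finset.range M, f i) * f M - ∏ i ∈ Finset.range N, f i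
      = (∏ i ∈ Finset.range M, f i) * (f M - 1) + ((∏ i ∈ Finset.range M, f i) - ∏ i ∈ Finset.range N, f i) := by ring
    rw [this]
    exact dvd_add (Dvd.dvd.mul_left ((pow_dvd_pow _ hM).trans (hf M)) _) ih

theorem ip_dvd {f : ℕ → PS} (hf : Adm f) {N M : ℕ} (h : N ≤ M) :
    X ^ N ∣ ip f - ∏ i ∈ Finset.range M, f i := by
  rw [X_pow_dvd_iff]
  intro d hd
  have := X_pow_dvd_iff.1 (hf.step (show d + 1 ≤ M by omega)) d (by omega)
  rw [map_sub, sub_eq_zero] at this ⊢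
  rw [this]; simp [ip]

theorem dvd_mul_sub {a b c d : PS} {n : PS} (h1 : n ∣ a - b) (h2 : n ∣ c - d) : n ∣ a * c - b * d := by
  have : a * c - b * d = (a - b) * c + b * (c - d) := by ring
  rw [this]
  exact dvd_add (h1.mul_right _) (h2.mul_left _)

theorem Adm.mul {f g : ℕ → PS} (hf : Adm f) (hg : Adm g) : Adm (fun i => f i * g i) := by
  intro i
  simpa using dvd_mul_sub (hf i) (hg i)

theorem Adm.shift {f : ℕ → PS} (hf : Adm f) : Adm (fun i => f (i + 1)) := fun i =>
  (pow_dvd_pow _ (Nat.le_succ i)).trans (hf (i+1))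

theorem ip_unique {f : ℕ → PS} (hf : Adm f) {a : PS}
    (h : ∀ N, ∃ M, N ≤ M ∧ X ^ N ∣ a - ∏ i ∈ Finset.range M, f i) : a = ip f := by
  refine eq_of_dvd fun N => ?_
  obtain ⟨M, hM, h⟩ := h N
  have := dvd_sub h (ip_dvd hf hM)
  simpa using this

theorem ip_mul {f g : ℕ → PS} (hf : Adm f) (hg : Adm g) : ip (fun i => f i * g i) = ip f * ip g := by
  symm
  refine ip_unique (hf.mul hg) fun N => ⟨N, le_rfl, ?_⟩
  rw [Finset.prod_mul_distrib]
  exact dvd_mul_sub (ip_dvd hf le_rfl) (ip_dvd hg le_rfl)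

theorem ip_shift {f : ℕ → PS} (hf : Adm f) : ip f = f 0 * ip (fun i => f (i + 1)) := by
  symm
  refine ip_unique hf fun N => ⟨N+1, by omega, ?_⟩
  rw [Finset.prod_range_succ']
  have := ip_dvd hf.shift (le_refl N)
  rw [mul_comm, ← sub_mul]
  exact this.mul_right _

theorem ip_even_odd {f : ℕ → PS} (hf : Adm f) :
    ip f = ip (fun i => f (2 * i)) * ip (fun i => f (2 * i + 1)) := by
  symm
  refine ip_unique hf fun N => ⟨2 * N, by omega, ?_⟩
  have h0 : Adm (fun i => f (2 * i)) := fun i => (pow_dvd_pow _ (by omega)).trans (hf (2*i))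
  have h1 : Adm (fun i => f (2 * i + 1)) := fun i => (pow_dvd_pow _ (by omega)).trans (hf (2*i+1))
  have : ∀ N, ∏ i ∈ Finset.range (2 * N), f i =
      (∏ i ∈ Finset.range N, f (2 * i)) * ∏ i ∈ Finset.range N, f (2 * i + 1) := by
    intro N
    induction N with
    | zero => simp
    | succ N ih =>
      rw [show 2 * (N + 1) = 2 * N + 1 + 1 by ring, Finset.prod_range_succ, Finset.prod_range_succ, ih,
        Finset.prod_range_succ, Finset.prod_range_succ]
      ring
  rw [this]
  exact dvd_mul_sub (ip_dvd h0 le_rfl) (ip_dvd h1 le_rfl)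

theorem cc_eq_of_dvd {a b : PS} (h : X ∣ a - b) : constantCoeff a = constantCoeff b := by
  rw [X_dvd_iff, map_sub, sub_eq_zero] at h; exact h

theorem ip_cc {f : ℕ → PS} (hf : Adm f) : constantCoeff (ip f) = constantCoeff (f 0) := by
  have := ip_dvd hf (le_refl 1)
  simp only [pow_one, Finset.prod_range_one] at this
  exact cc_eq_of_dvd this

theorem adm_pow {p : PS} (hp : X ∣ p) (c : PS) : Adm (fun i => 1 + c * p ^ i) := by
  intro i
  simp only [add_sub_cancel_left]
  exact (pow_dvd_pow_of_dvd hp i).mul_left _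

theorem adm_quad {p : PS} (hp : X ∣ p) (t : PS) : Adm (fun i => 1 - t * p ^ (i+1) + p ^ (2 * (i+1))) := by
  intro i
  have h1 : X ^ i ∣ p ^ (i+1) := (pow_dvd_pow _ (by omega)).trans (pow_dvd_pow_of_dvd hp (i+1))
  have : (1 - t * p ^ (i+1) + p ^ (2 * (i+1))) - 1 = p ^ (i+1) * (p ^ (i+1) - t) := by ring
  simp only [this]
  exact h1.mul_right _

theorem adm_one_sub {p : PS} (hp : X ∣ p) : Adm (fun i => 1 - p ^ (i+1)) := by
  have := (adm_pow hp (-1)).shift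
  simpa [sub_eq_add_neg] using this

/-! ### q-Pochhammer -/

noncomputable def qp (p : PS) (k : ℕ) : PS := ∏ i ∈ Finset.range k, (1 - p ^ (i + 1))
noncomputable def Ei (p : PS) : PS := ip (fun i => 1 - p ^ (i + 1))
noncomputable def iq (p : PS) (k : ℤ) : PS := if k < 0 then 0 else (qp p k.toNat)⁻¹
/-- p to integer exponent, truncated -/
noncomputable def pw (p : PS) (k : ℤ) : PS := p ^ k.toNat

theorem cc_of_X {p : PS} (hp : X ∣ p) : constantCoeff p = 0 := X_dvd_iff.1 hp

theorem qp_cc {p : PS} (hp : X ∣ p) (k : ℕ) : constantCoeff (qp p k) = 1 := by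
  simp [qp, cc_of_X hp]

theorem Ei_cc {p : PS} (hp : X ∣ p) : constantCoeff (Ei p) = 1 := by
  rw [Ei, ip_cc (adm_one_sub hp)]; simp [cc_of_X hp]

theorem Ei_mul_inv {p : PS} (hp : X ∣ p) : Ei p * (Ei p)⁻¹ = 1 :=
  PowerSeries.mul_inv_cancel _ (by rw [Ei_cc hp]; simp)

theorem ne_zero_of_cc {a : PS} (h : constantCoeff a ≠ 0) : a ≠ 0 := by
  rintro rfl; simp at h

theorem eq_inv_of_mul {a b : PS} (ha : constantCoeff a ≠ 0) (h : a * b = 1) : b = a⁻¹ := by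
  have h1 := PowerSeries.mul_inv_cancel a ha
  apply mul_left_cancel₀ (ne_zero_of_cc ha)
  rw [h, h1]

theorem inv_dvd {a b : PS} (ha : constantCoeff a ≠ 0) (hb : constantCoeff b ≠ 0) {N : ℕ}
    (h : X ^ N ∣ a - b) : X ^ N ∣ a⁻¹ - b⁻¹ := by
  have h1 := PowerSeries.mul_inv_cancel a ha
  have h2 := PowerSeries.mul_inv_cancel b hb
  have : a⁻¹ - b⁻¹ = (a - b) * (- (a⁻¹ * b⁻¹)) := by
    linear_combination (b⁻¹ * h1 - a⁻¹ * h2)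
  rw [this]
  exact h.mul_right _

theorem iq_dvd {p : PS} (hp : X ∣ p) {N : ℕ} {k : ℤ} (h : (N:ℤ) ≤ k) : X ^ N ∣ iq p k - (Ei p)⁻¹ := by
  rw [iq, if_neg (by omega)]
  refine inv_dvd (by rw [qp_cc hp]; simp) (by rw [Ei_cc hp]; simp) ?_
  have := ip_dvd (adm_one_sub hp) (show N ≤ k.toNat by omega)
  rw [← dvd_neg]
  simpa [Ei, qp] using this

theorem iq_neg {p : PS} {k : ℤ} (h : k < 0) : iq p k = 0 := by simp [iq, h]

theorem iq_zero {p : PS} : iq p 0 = 1 := by simp [iq, qp]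

theorem iq_pred {p : PS} (hp : X ∣ p) (k : ℤ) : iq p (k - 1) = (1 - pw p k) * iq p k := by
  rcases lt_trichotomy k 0 with h | h | h
  · rw [iq_neg h, iq_neg (by omega)]; simp
  · subst h; rw [iq_neg (by omega)]; simp [pw]
  · obtain ⟨m, rfl⟩ : ∃ m : ℕ, k = m + 1 := ⟨(k-1).toNat, by omega⟩
    rw [iq, if_neg (by omega), iq, if_neg (by omega)]
    have e1 : ((m:ℤ) + 1 - 1).toNat = m := by omega
    have e2 : ((m:ℤ) + 1).toNat = m + 1 := by omega
    rw [pw, e1, e2]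
    have h1 := PowerSeries.mul_inv_cancel (qp p (m+1)) (by rw [qp_cc hp]; simp)
    symm
    apply eq_inv_of_mul (by rw [qp_cc hp]; simp)
    have h3 : qp p (m+1) = qp p m * (1 - p ^ (m+1)) := by
      rw [qp, qp, Finset.prod_range_succ]
    rw [← mul_assoc, ← h3, h1]

theorem iq_nat {p : PS} (hp : X ∣ p) (k : ℕ) : qp p k * iq p k = 1 := by
  rw [iq, if_neg (by omega)]
  exact PowerSeries.mul_inv_cancel _ (by rw [qp_cc hp]; simp)

theorem pw_succ {p : PS} {k : ℤ} (h : 1 ≤ k) : pw p k = p * pw p (k - 1) := by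
  rw [pw, pw, ← pow_succ']
  congr 1; omega

theorem pw_add {p : PS} {k l : ℤ} (hk : 0 ≤ k) (hl : 0 ≤ l) : pw p (k + l) = pw p k * pw p l := by
  rw [pw, pw, pw, ← pow_add]
  congr 1; omega

/-- Bailey kernel -/
noncomputable def bk (p : PS) (n : ℕ) (r : ℤ) : PS := iq p (n - r) * iq p (n + r)

theorem bk_zero_of {p : PS} {n : ℕ} {r : ℤ} (h : n < r ∨ r < -n) : bk p n r = 0 := by
  rw [bk]
  rcases h with h | h
  · rw [iq_neg (by omega)]; simp
  · rw [iq_neg (k := n + r) (by omega)]; simp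

theorem bk_neg {p : PS} {n : ℕ} {r : ℤ} : bk p n (-r) = bk p n r := by
  rw [bk, bk, mul_comm]; congr 2; ring

theorem bk_finite (n : ℕ) : (Set.Icc (-n:ℤ) n).Finite := Set.finite_Icc _ _

theorem bk_LF {p : PS} (n : ℕ) (c : ℤ → PS) : LF (fun r => c r * bk p n r) := by
  refine LF.of_finite _ (bk_finite n) fun r hr => ?_
  rw [bk_zero_of, mul_zero]
  simp only [Set.mem_Icc, not_and_or, not_le] at hr
  omega

/-! ### triangular numbers -/
def tri (r : ℤ) : ℕ := (r * (r + 1) / 2).toNat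

theorem tri_spec (r : ℤ) : 2 * (tri r : ℤ) = r * (r + 1) := by
  have h1 : 2 ∣ r * (r + 1) := (Int.even_mul_succ_self r).two_dvd
  have h2 : 0 ≤ r * (r + 1) := by
    rcases le_or_gt 0 r with h | h
    · positivity
    · nlinarith
  rw [tri, Int.toNat_of_nonneg (by omega)]
  omega

theorem tri_pos_ge (r : ℤ) : (|r| : ℤ) ≤ tri r + 1 := by
  have := tri_spec r
  rcases abs_cases r with h | h <;> nlinarith
theorem tri_ge (r : ℤ) : r ≤ tri r := by
  have := tri_spec r
  nlinarith [sq_nonneg (r-1), sq_nonneg r]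


theorem fs_shift (a : ℤ) (f : ℤ → PS) : fs (fun r => f (r + a)) = fs f :=
  fs_equiv (Equiv.addRight a) f

theorem fs_refl (a : ℤ) (f : ℤ → PS) : fs (fun r => f (a - r)) = fs f :=
  fs_equiv (Equiv.subLeft a) f

theorem fs_zero {ι : Type*} : fs (fun _ : ι => (0:PS)) = 0 := by ext d; simp [coeff_fs]

theorem LF.shift {f : ℤ → PS} (hf : LF f) (a : ℤ) : LF (fun r => f (r + a)) :=
  hf.comp (Equiv.addRight a).injective

theorem LF.refl {f : ℤ → PS} (hf : LF f) (a : ℤ) : LF (fun r => f (a - r)) :=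
  hf.comp (Equiv.subLeft a).injective

noncomputable def jc (u v : PS) (r : ℤ) : PS := u ^ tri r * v ^ tri (r - 1)

theorem jc_dvd {u v p : PS} (hp : X ∣ p) (h : u * v = p) (r : ℤ) : X ^ (|r| - 1).toNat ∣ jc u v r := by
  have h1 := tri_spec r
  have h2 := tri_spec (r - 1)
  rcases le_or_gt 0 r with hr | hr
  · have e : tri r = tri (r - 1) + r.toNat := by zify; rw [Int.toNat_of_nonneg hr]; linarith
    have : jc u v r = p ^ tri (r-1) * u ^ r.toNat := by
      rw [jc, e, ← h, pow_add, mul_pow]; ring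
    rw [this]
    have e2 : (|r| - 1).toNat ≤ tri (r-1) := by
      have := tri_ge (r-1); rw [abs_of_nonneg hr]; omega
    exact (((pow_dvd_pow _ e2).trans (pow_dvd_pow_of_dvd hp _))).mul_right _
  · have e : tri (r-1) = tri r + (-r).toNat := by zify; rw [Int.toNat_of_nonneg (by omega)]; linarith
    have : jc u v r = p ^ tri r * v ^ (-r).toNat := by
      rw [jc, e, ← h, pow_add, mul_pow]; ring
    rw [this]
    have e2 : (|r| - 1).toNat ≤ tri r := by
      have := tri_pos_ge r; omega
    exact (((pow_dvd_pow _ e2).trans (pow_dvd_pow_of_dvd hp _))).mul_right _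

theorem finite_abs (d : ℕ) : {i : ℤ | (|i| - 1).toNat ≤ d}.Finite := by
  refine (Set.finite_Icc (-(d:ℤ) - 1) (d + 1)).subset ?_
  intro i hi
  simp only [Set.mem_setOf_eq] at hi
  rcases abs_cases i with h | h <;> simp only [Set.mem_Icc] <;> omega

theorem jc_LF {u v p : PS} (hp : X ∣ p) (h : u * v = p) : LF (jc u v) :=
  LF.of_dvd _ (jc_dvd hp h) finite_abs

theorem jc_up {u v p : PS} (h : u * v = p) (N : ℕ) (r : ℤ) :
    jc u v r * (u ^ (N+1) * v ^ N) * bk p N r = jc u v (r+1) * (pw p (N - r) * bk p N r) := by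
  by_cases hr : (N:ℤ) < r
  · rw [bk_zero_of (Or.inl hr)]; simp
  · have h1 := tri_spec r
    have h2 := tri_spec (r - 1)
    have h3 := tri_spec (r + 1)
    rw [← mul_assoc (jc u v (r+1))]
    congr 1
    rw [jc, jc, pw, ← h, mul_pow]
    have e1 : tri r + (N + 1) = tri (r+1) + ((N:ℤ) - r).toNat := by
      zify; rw [Int.toNat_of_nonneg (by omega)]; linarith
    have e2 : tri (r-1) + N = tri (r+1-1) + ((N:ℤ) - r).toNat := by
      rw [add_sub_cancel_right]
      zify; rw [Int.toNat_of_nonneg (by omega)]; linarith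
    calc _ = u ^ (tri r + (N+1)) * v ^ (tri (r-1) + N) := by ring
      _ = _ := by rw [e1, e2]; ring

theorem jc_down {u v p : PS} (h : u * v = p) (N : ℕ) (r : ℤ) :
    jc u v r * (u ^ N * v ^ (N+1)) * bk p N r = jc u v (r-1) * (pw p (N + r) * bk p N r) := by
  by_cases hr : r < -(N:ℤ)
  · rw [bk_zero_of (Or.inr hr)]; simp
  · have h1 := tri_spec r
    have h2 := tri_spec (r - 1)
    have h3 := tri_spec (r - 1 - 1)
    rw [← mul_assoc (jc u v (r-1))]
    congr 1
    rw [jc, jc, pw, ← h, mul_pow]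
    have e1 : tri r + N = tri (r-1) + ((N:ℤ) + r).toNat := by
      zify; rw [Int.toNat_of_nonneg (by omega)]; linarith
    have e2 : tri (r-1) + (N + 1) = tri (r-1-1) + ((N:ℤ) + r).toNat := by
      zify; rw [Int.toNat_of_nonneg (by omega)]; linarith
    calc _ = u ^ (tri r + N) * v ^ (tri (r-1) + (N+1)) := by ring
      _ = _ := by rw [e1, e2]; ring

theorem bk_rec {p : PS} (hp : X ∣ p) (N : ℕ) (r : ℤ) :
    (1 + p ^ (2 * N + 1)) * bk p N r + pw p (N - (r - 1)) * bk p N (r - 1) + pw p (N + (r + 1)) * bk p N (r + 1)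
      = (1 - p ^ (2 * N + 1)) * (1 - p ^ (2 * N + 2)) * bk p (N + 1) r := by
  have ha : iq p ((N:ℤ) - r) = (1 - pw p (N + 1 - r)) * iq p (N + 1 - r) := by
    rw [← iq_pred hp]; congr 1; ring
  have hb : iq p ((N:ℤ) + r) = (1 - pw p (N + 1 + r)) * iq p (N + 1 + r) := by
    rw [← iq_pred hp]; congr 1; ring
  have ha' : iq p ((N:ℤ) - (r+1)) = (1 - pw p (N - r)) * ((1 - pw p (N + 1 - r)) * iq p (N + 1 - r)) := by
    rw [← ha, ← iq_pred hp]; congr 1; ring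
  have hb' : iq p ((N:ℤ) + (r-1)) = (1 - pw p (N + r)) * ((1 - pw p (N + 1 + r)) * iq p (N + 1 + r)) := by
    rw [← hb, ← iq_pred hp]; congr 1; ring
  have e1 : (N:ℤ) - (r - 1) = N + 1 - r := by ring
  have e2 : (N:ℤ) + (r + 1) = N + 1 + r := by ring
  simp only [bk]
  rw [ha, hb, ha', hb', e1, e2]
  push_cast
  by_cases hr1 : (N:ℤ) + 1 < r
  · rw [iq_neg (show (N:ℤ) + 1 - r < 0 by omega)]; simp
  by_cases hr2 : r < -((N:ℤ) + 1)
  · rw [iq_neg (show (N:ℤ) + 1 + r < 0 by omega)]; simp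
  have key : (1 + p ^ (2 * N + 1)) * ((1 - pw p (N + 1 - r)) * (1 - pw p (N+1+r)))
     + pw p (N + 1 - r) * ((1 - pw p (N + r)) * (1 - pw p (N + 1 + r)))
     + pw p (N + 1 + r) * ((1 - pw p (N - r)) * (1 - pw p (N + 1 - r)))
     = (1 - p ^ (2 * N + 1)) * (1 - p ^ (2 * N + 2)) := by
    have hab : p ^ (2 * N + 2) = pw p (N + 1 - r) * pw p (N + 1 + r) := by
      rw [← pw_add (by omega) (by omega), pw]; congr 1; omega
    rcases eq_or_ne (r : ℤ) (N + 1) with h | h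
    · have hc : p ^ (2 * N + 1) = pw p (N + r) := by rw [pw]; congr 1; omega
      have hd : pw p (N + 1 - r) = 1 := by rw [h]; simp [pw]
      rw [hab, hc, hd]; ring
    rcases eq_or_ne (r : ℤ) (- (N + 1)) with h' | h'
    · have hc : p ^ (2 * N + 1) = pw p (N - r) := by rw [pw]; congr 1; omega
      have hd : pw p (N + 1 + r) = 1 := by rw [h']; simp [pw]
      rw [hab, hc, hd]; ring
    have h1 : pw p (N + 1 - r) = p * pw p (N - r) := by
      rw [pw_succ (by omega)]; congr 2; ring
    have h2 : pw p (N + 1 + r) = p * pw p (N + r) := by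
      rw [pw_succ (by omega)]; congr 2; ring
    have h3 : p ^ (2 * N + 1) = p * (pw p (N - r) * pw p (N + r)) := by
      rw [← pw_add (by omega) (by omega), pw, ← pow_succ']; congr 1; omega
    rw [hab, h3, h1, h2]; ring
  linear_combination (iq p (N + 1 - r) * iq p (N + 1 + r)) * key

noncomputable def jprod (u v : PS) (M : ℕ) : PS :=
  ∏ k ∈ Finset.range M, ((1 + u ^ (k+1) * v ^ k) * (1 + u ^ k * v ^ (k+1)))

/-- finite Jacobi triple product -/
theorem jtp_finite {u v p : PS} (hp : X ∣ p) (h : u * v = p) (M : ℕ) :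
    qp p (2 * M) * fs (fun r => jc u v r * bk p M r) = jprod u v M := by
  induction M with
  | zero =>
    have h0 : ∀ r : ℤ, r ≠ 0 → jc u v r * bk p 0 r = 0 := by
      intro r hr
      rw [bk_zero_of (by simp; omega), mul_zero]
    rw [fs_int (bk_LF 0 _)]
    rw [show (fun n : ℕ => jc u v (n+1) * bk p 0 (n+1) + jc u v (-(n+1)) * bk p 0 (-(n+1))) = fun n => 0 from ?_]
    · have : fs (fun n : ℕ => (0:PS)) = 0 := by ext d; simp [coeff_fs]
      rw [this]
      simp [qp, jprod, bk, iq_zero, jc, tri]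
    · funext n
      rw [h0 _ (by omega), h0 _ (by omega), add_zero]
  | succ N ih =>
    have hq : qp p (2 * (N + 1)) = qp p (2 * N) * ((1 - p ^ (2 * N + 1)) * (1 - p ^ (2 * N + 2))) := by
      rw [qp, qp, show 2 * (N+1) = 2 * N + 1 + 1 by ring, Finset.prod_range_succ, Finset.prod_range_succ]
      ring
    have hj : jprod u v (N+1) = jprod u v N * (1 + p ^ (2 * N + 1) + u ^ (N+1) * v ^ N + u ^ N * v ^ (N+1)) := by
      rw [jprod, Finset.prod_range_succ, ← jprod, ← h, mul_pow]
      ring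
    suffices H : ((1 - p ^ (2 * N + 1)) * (1 - p ^ (2 * N + 2))) * fs (fun r => jc u v r * bk p (N+1) r) =
        fs (fun r => jc u v r * bk p N r) * (1 + p ^ (2 * N + 1) + u ^ (N+1) * v ^ N + u ^ N * v ^ (N+1)) by
      rw [hq, hj, ← ih]
      linear_combination qp p (2 * N) * H
    rw [← fs_mul_left (bk_LF _ _), ← fs_mul_right (bk_LF _ _)]
    have L1 : LF (fun r => jc u v r * bk p N r * (1 + p ^ (2 * N + 1))) := (bk_LF N _).mul_right _
    have L2 : LF (fun r => jc u v (r+1) * (pw p (N - r) * bk p N r)) := by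
      simpa [mul_assoc] using bk_LF (p := p) N (fun r => jc u v (r+1) * pw p (N - r))
    have L3 : LF (fun r => jc u v (r-1) * (pw p (N + r) * bk p N r)) := by
      simpa [mul_assoc] using bk_LF (p := p) N (fun r => jc u v (r-1) * pw p (N + r))
    have s1 : fs (fun r => jc u v r * bk p N r * (1 + p ^ (2 * N + 1) + u ^ (N+1) * v ^ N + u ^ N * v ^ (N+1)))
      = fs (fun r => jc u v r * bk p N r * (1 + p ^ (2 * N + 1)))
        + fs (fun r => jc u v (r+1) * (pw p (N - r) * bk p N r))
        + fs (fun r => jc u v (r-1) * (pw p (N + r) * bk p N r)) := by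
      rw [← fs_add L1 L2, ← fs_add (L1.add L2) L3]
      refine fs_congr fun r => ?_
      linear_combination jc_up h N r + jc_down h N r
    have e2 : fs (fun r => jc u v (r+1) * (pw p (N - r) * bk p N r)) =
        fs (fun r => jc u v r * (pw p (N - (r - 1)) * bk p N (r-1))) := by
      rw [← fs_equiv (Equiv.subRight (1:ℤ))]
      simp
    have e3 : fs (fun r => jc u v (r-1) * (pw p (N + r) * bk p N r)) =
        fs (fun r => jc u v r * (pw p (N + (r + 1)) * bk p N (r+1))) := by
      rw [← fs_equiv (Equiv.addRight (1:ℤ))]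
      simp
    have L2' : LF (fun r => jc u v r * (pw p (N - (r - 1)) * bk p N (r-1))) := by
      have := L2.comp (Equiv.subRight (1:ℤ)).injective
      simpa using this
    have L3' : LF (fun r => jc u v r * (pw p (N + (r + 1)) * bk p N (r+1))) := by
      have := L3.comp (Equiv.addRight (1:ℤ)).injective
      simpa using this
    rw [s1, e2, e3, ← fs_add L1 L2', ← fs_add (L1.add L2') L3']
    refine fs_congr fun r => ?_
    linear_combination -jc u v r * bk_rec hp N r

theorem jprod_adm {u v p : PS} (hp : X ∣ p) (h : u * v = p) :
    Adm (fun k => (1 + u ^ (k+1) * v ^ k) * (1 + u ^ k * v ^ (k+1))) := by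
  have := (adm_pow hp u).mul (adm_pow hp v)
  have e : (fun k => (1 + u ^ (k+1) * v ^ k) * (1 + u ^ k * v ^ (k+1))) =
    (fun i => (1 + u * p ^ i) * (1 + v * p ^ i)) := by
    funext k; rw [← h]; ring
  rw [e]; exact this

theorem bk_dvd {p : PS} (hp : X ∣ p) {N M : ℕ} {r : ℤ} (h1 : |r| + N ≤ M) :
    X ^ N ∣ bk p M r - (Ei p)⁻¹ * (Ei p)⁻¹ := by
  have := abs_le.1 (le_refl |r|)
  exact dvd_mul_sub (iq_dvd hp (by omega)) (iq_dvd hp (by omega))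

theorem jtp {u v p : PS} (hp : X ∣ p) (h : u * v = p) :
    fs (jc u v) = Ei p * (ip (fun i => 1 + u * p ^ i) * ip (fun i => 1 + v * p ^ i)) := by
  rw [← ip_mul (adm_pow hp u) (adm_pow hp v)]
  have e : (fun k => (1 + u ^ (k+1) * v ^ k) * (1 + u ^ k * v ^ (k+1))) =
    (fun i => (1 + u * p ^ i) * (1 + v * p ^ i)) := by
    funext k; rw [← h]; ring
  rw [← e]
  have hE := Ei_mul_inv hp
  suffices H : Ei p * (fs (jc u v) * ((Ei p)⁻¹ * (Ei p)⁻¹)) = ip (fun k => (1 + u ^ (k+1) * v ^ k) * (1 + u ^ k * v ^ (k+1))) by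
    rw [← H]
    linear_combination -fs (jc u v) * (1 + Ei p * (Ei p)⁻¹) * hE
  refine ip_unique (jprod_adm hp h) fun N => ⟨2 * N + 2, by omega, ?_⟩
  rw [← jprod, ← jtp_finite hp h]
  apply dvd_mul_sub
  · have := ip_dvd (adm_one_sub hp) (show N ≤ 2 * (2 * N + 2) by omega)
    exact this
  · rw [← fs_mul_right (jc_LF hp h), ← fs_sub ((jc_LF hp h).mul_right _) (bk_LF _ _)]
    refine dvd_fs fun r => ?_
    rw [← mul_sub]
    by_cases hr : |r| ≤ N + 1
    · rw [← dvd_neg, ← mul_neg, neg_sub]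
      exact (bk_dvd hp (by push_cast; omega)).mul_left _
    · exact ((pow_dvd_pow _ (by omega)).trans (jc_dvd hp h r)).mul_right _


noncomputable def sg (r : ℤ) : PS := (((Int.negOnePow r : ℤˣ) : ℤ) : PS)

theorem sg_add (a b : ℤ) : sg (a + b) = sg a * sg b := by
  simp [sg, Int.negOnePow_add]
theorem sg_zero : sg 0 = 1 := by simp [sg]
theorem sg_one : sg 1 = -1 := by simp [sg]
theorem sg_neg (a : ℤ) : sg (-a) = sg a := by simp [sg, Int.negOnePow_neg]
theorem sg_sub (a b : ℤ) : sg (a - b) = sg a * sg b := by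
  rw [sub_eq_add_neg, sg_add, sg_neg]
theorem sg_mul_self (a : ℤ) : sg a * sg a = 1 := by
  rw [← sg_sub, sub_self, sg_zero]
theorem sg_succ (a : ℤ) : sg (a + 1) = - sg a := by rw [sg_add, sg_one]; ring
theorem sg_nat (n : ℕ) : sg n = (-1) ^ n := by
  induction n with
  | zero => simp [sg_zero]
  | succ n ih => push_cast; rw [sg_succ, ih]; ring
theorem sg_even {a : ℤ} (h : Even a) : sg a = 1 := by simp [sg, Int.negOnePow_even _ h]
theorem sg_odd {a : ℤ} (h : Odd a) : sg a = -1 := by simp [sg, Int.negOnePow_odd _ h]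

theorem tri_neg (r : ℤ) : tri (-1 - r) = tri r := by
  have h1 := tri_spec r
  have h2 := tri_spec (-1 - r)
  zify; linarith

theorem jc_neg (a b : PS) (r : ℤ) : jc (-a) (-b) r = sg r * jc a b r := by
  have : sg r = (-1) ^ tri r * (-1) ^ tri (r-1) := by
    rw [← pow_add, ← sg_nat]
    have h1 := tri_spec r
    have h2 := tri_spec (r - 1)
    have : ((tri r + tri (r-1) : ℕ) : ℤ) = r + r * (r - 1) := by push_cast; linarith
    rw [this, sg_add, sg_even (a := r * (r - 1)), mul_one]
    have := Int.even_mul_succ_self (r-1)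
    rw [mul_comm]; simpa using this
  rw [jc, jc, this, neg_pow a, neg_pow b]; ring

theorem zero_sum {p : PS} (hp : X ∣ p) (n : ℕ) :
    fs (fun r => (sg r * p ^ tri (r-1)) * bk p (n+1) r) = 0 := by
  have h := jtp_finite (u := -1) (v := -p) hp (by ring) (n+1)
  have hj : jprod (-1) (-p) (n+1) = 0 := by
    rw [jprod, Finset.prod_range_succ']; simp
  rw [hj] at h
  have h2 := (mul_eq_zero.1 h).resolve_left (ne_zero_of_cc (by rw [qp_cc hp]; simp))
  rw [← h2]
  refine fs_congr fun r => ?_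
  rw [jc_neg, jc]; simp

theorem zero_sum_fold {p : PS} (hp : X ∣ p) (n : ℕ) :
    bk p (n+1) 0 + fs (fun m : ℕ => sg (m+1) * (p ^ tri m + p ^ tri (m+1)) * bk p (n+1) (m+1)) = 0 := by
  rw [← zero_sum hp n, fs_int (bk_LF _ _)]
  congr 1
  · simp [sg_zero, tri]
  · refine fs_congr fun m => ?_
    rw [bk_neg, sg_neg, ← tri_neg (-(m+1)-1)]
    rw [show -1 - (-((m:ℤ)+1) - 1) = m + 1 by ring, show (m:ℤ) + 1 - 1 = m by ring]
    ring

noncomputable def quad (p t : PS) (k : ℕ) : PS := 1 - t * p ^ k + p ^ (2 * k)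
noncomputable def be (p t : PS) (n : ℕ) : PS := (∏ k ∈ Finset.range n, quad p t (k+1))⁻¹
noncomputable def al (p t : PS) (m : ℕ) : PS :=
  sg (m+1) * p ^ tri (m+1) * (2 - t) * (1 + p ^ (m+1)) * (quad p t (m+1))⁻¹
noncomputable def Bi (p t : PS) : PS := (ip (fun k => quad p t (k+1)))⁻¹

theorem quad_cc {p t : PS} (hp : X ∣ p) (k : ℕ) : constantCoeff (quad p t (k+1)) = 1 := by
  simp [quad, cc_of_X hp]

theorem quad_adm {p t : PS} (hp : X ∣ p) : Adm (fun k => quad p t (k+1)) := adm_quad hp t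

theorem quad_inv {p t : PS} (hp : X ∣ p) (k : ℕ) : quad p t (k+1) * (quad p t (k+1))⁻¹ = 1 :=
  PowerSeries.mul_inv_cancel _ (by rw [quad_cc hp]; simp)

theorem bprod_cc {p t : PS} (hp : X ∣ p) (n : ℕ) :
    constantCoeff (∏ k ∈ Finset.range n, quad p t (k+1)) = 1 := by
  rw [map_prod]; exact Finset.prod_eq_one fun k _ => quad_cc hp k

theorem be_mul {p t : PS} (hp : X ∣ p) (n : ℕ) : (∏ k ∈ Finset.range n, quad p t (k+1)) * be p t n = 1 :=
  PowerSeries.mul_inv_cancel _ (by rw [bprod_cc hp]; simp)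

theorem be_succ {p t : PS} (hp : X ∣ p) (n : ℕ) : quad p t (n+1) * be p t (n+1) = be p t n := by
  apply eq_inv_of_mul (by rw [bprod_cc hp]; simp)
  rw [← mul_assoc, ← Finset.prod_range_succ, be_mul hp]

theorem bkn_LF {p : PS} (n : ℕ) (c : ℕ → PS) : LF (fun m : ℕ => c m * bk p n (m+1)) := by
  refine LF.of_finite (Set.Iic n) (Set.finite_Iic n) fun m hm => ?_
  rw [bk_zero_of, mul_zero]
  simp only [Set.mem_Iic, not_le] at hm
  omega

theorem bk_zero_zero {p : PS} : bk p 0 0 = 1 := by simp [bk, iq_zero]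

theorem bk_step {p : PS} (hp : X ∣ p) (n : ℕ) (r : ℤ) :
    bk p n r = (1 - pw p (n + 1 - r)) * (1 - pw p (n+1+r)) * bk p (n+1) r := by
  have ha : iq p ((n:ℤ) - r) = (1 - pw p (n + 1 - r)) * iq p (n + 1 - r) := by
    rw [← iq_pred hp]; congr 1; ring
  have hb : iq p ((n:ℤ) + r) = (1 - pw p (n + 1 + r)) * iq p (n + 1 + r) := by
    rw [← iq_pred hp]; congr 1; ring
  rw [bk, bk, ha, hb]; push_cast; ring

theorem bailey {p t : PS} (hp : X ∣ p) (n : ℕ) :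
    be p t n = bk p n 0 + fs (fun m => al p t m * bk p n (m+1)) := by
  induction n with
  | zero =>
    rw [show (fun m : ℕ => al p t m * bk p 0 (m+1)) = fun m => 0 from ?_, fs_zero]
    · simp [be, bk_zero_zero]
    · funext m; rw [bk_zero_of (by simp), mul_zero]
  | succ n ih =>
    apply mul_left_cancel₀ (ne_zero_of_cc (a := quad p t (n+1)) (by rw [quad_cc hp]; simp))
    rw [be_succ hp, ih, mul_add, ← fs_mul_left (bkn_LF _ _)]
    have hz := zero_sum_fold hp n
    set c : PS := p ^ (n+1) * (2 - t) with hc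
    have h0 : quad p t (n+1) * bk p (n+1) 0 = bk p n 0 + c * bk p (n+1) 0 := by
      rw [bk_step hp n 0, hc, quad]
      have : pw p ((n:ℤ) + 1) = p ^ (n+1) := by rw [pw]; congr 1
      simp only [sub_zero, add_zero, this]
      ring
    have L1 := bkn_LF (p := p) n (al p t)
    have L2 := bkn_LF (p := p) (n+1) (fun m => sg (m+1) * (p ^ tri m + p ^ tri (m+1)))
    have h1 : fs (fun m : ℕ => quad p t (n+1) * (al p t m * bk p (n+1) (m+1)))
        = fs (fun m => al p t m * bk p n (m+1)) +
          c * fs (fun m : ℕ => sg (m+1) * (p ^ tri m + p ^ tri (m+1)) * bk p (n+1) (m+1)) := by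
      rw [← fs_mul_left L2, ← fs_add L1 (L2.mul_left _)]
      refine fs_congr fun m => ?_
      by_cases hm : n < m
      · rw [bk_zero_of (n := n+1) (by omega), bk_zero_of (n := n) (by omega)]; simp
      rw [bk_step hp n]
      have hab : p ^ (2 * (n + 1)) = pw p (n + 1 - (m+1)) * pw p (n + 1 + (m+1)) := by
        rw [← pw_add (by omega) (by omega), pw]; congr 1; omega
      have e1 : pw p (n + 1 - (m+1)) * p ^ (2 * (m+1)) = pw p (n + 1 + (m+1)) := by
        rw [pw, pw, ← pow_add]; congr 1; omega
      have e2 : pw p (n + 1 - (m+1)) * p ^ (m+1) = p ^ (n+1) := by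
        rw [pw, ← pow_add]; congr 1; omega
      have key : quad p t (n+1) - (1 - pw p (n + 1 - (m+1))) * (1 - pw p (n+1+(m+1))) =
          pw p (n + 1 - (m+1)) * quad p t (m+1) := by
        rw [quad, quad]
        linear_combination hab - e1 + t * e2
      have e3 : tri ((m:ℤ)+1) = tri m + (m+1) := by
        have h1 := tri_spec m
        have h2 := tri_spec (m+1)
        zify; linarith
      have e4 : al p t m * (quad p t (m+1)) = sg (m+1) * p ^ tri (m+1) * (2 - t) * (1 + p ^ (m+1)) := by
        rw [al]
        linear_combination (sg (m+1) * p ^ tri (m+1) * (2 - t) * (1 + p ^ (m+1))) * quad_inv (t := t) hp m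
      rw [e3] at e4 ⊢
      rw [pow_add] at e4 ⊢
      rw [hc]
      linear_combination (al p t m * bk p (n+1) (m+1)) * key + (pw p (n + 1 - (m+1)) * bk p (n+1) (m+1)) * e4
        + (sg (m+1) * p ^ tri m * (2 - t) * (1 + p ^ (m+1)) * bk p (n+1) (m+1)) * e2
    rw [h0, h1]
    linear_combination -c * hz

/-! ### Durfee -/
noncomputable def durf (p : PS) (s : ℕ) (j : ℕ) : PS := p ^ (j ^ 2 + s * j) * (iq p j * iq p (j + s))

theorem finite_le (d : ℕ) : {i : ℕ | i ≤ d}.Finite := Set.finite_Iic d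

theorem LF.of_p {p : PS} (hp : X ∣ p) (e : ℕ → ℕ) (he : ∀ j, j ≤ e j) (f : ℕ → PS) :
    LF (fun j => p ^ (e j) * f j) := by
  refine LF.of_dvd (fun j => j) (fun j => ?_) finite_le
  exact ((pow_dvd_pow _ (he j)).trans (pow_dvd_pow_of_dvd hp _)).mul_right _

theorem durf_LF {p : PS} (hp : X ∣ p) (s : ℕ) : LF (durf p s) :=
  LF.of_p hp _ (fun j => by nlinarith [sq_nonneg j, Nat.le_self_pow (n := 2) (by norm_num) j]) _

theorem durf_rec {p : PS} (hp : X ∣ p) (s : ℕ) :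
    fs (durf p s) - fs (durf p (s+1)) = - p ^ (s+1) * (fs (durf p (s+1)) - fs (durf p (s+2))) := by
  have L : LF (fun j : ℕ => p ^ (j^2 + s * j) * (iq p (j - 1) * iq p (j + s + 1))) :=
    LF.of_p hp _ (fun j => by nlinarith [Nat.le_self_pow (n := 2) (by norm_num) j]) _
  have h : fs (fun j : ℕ => p ^ (j^2 + s * j) * (iq p (j - 1) * iq p (j + s + 1)))
      = p ^ (s+1) * fs (durf p (s+2)) := by
    rw [fs_nat L, iq_neg (by simp), ← fs_mul_left (durf_LF hp _)]
    simp only [zero_mul, mul_zero, zero_add]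
    refine fs_congr fun j => ?_
    rw [durf, ← mul_assoc (p ^ (s+1)), ← pow_add]
    push_cast
    congr 2
    · ring
    · congr 1; ring
    · congr 1; ring
  have h2 : fs (durf p s) - fs (durf p (s+1)) = fs (fun j : ℕ => p ^ (j^2 + s * j) * (iq p (j - 1) * iq p (j + s + 1)))
     - p ^ (s+1) * fs (durf p (s+1)) := by
    rw [← fs_mul_left (durf_LF hp _), ← fs_sub (durf_LF hp _) (durf_LF hp _), ← fs_sub L ((durf_LF hp _).mul_left _)]
    refine fs_congr fun j => ?_
    simp only [durf]
    have e1 := iq_pred hp (j : ℤ)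
    have e2 := iq_pred hp ((j : ℤ) + s + 1)
    rw [add_sub_cancel_right] at e2
    rw [e1, e2]
    have e3 : pw p (j : ℤ) = p ^ j := by simp [pw]
    have e4 : pw p ((j : ℤ) + s + 1) = p ^ (j + s + 1) := by rw [pw]; congr 1
    rw [e3, e4]
    push_cast
    rw [← add_assoc]
    ring
  rw [h2, h]; ring

theorem durf_const {p : PS} (hp : X ∣ p) (s : ℕ) : fs (durf p s) = fs (durf p (s+1)) := by
  refine eq_of_dvd fun N => ?_
  induction N generalizing s with
  | zero => simp
  | succ N ih =>
    rw [durf_rec hp, pow_succ']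
    refine mul_dvd_mul ?_ (ih (s+1))
    rw [dvd_neg]
    exact hp.trans (dvd_pow_self _ (by omega))

theorem durfee {p : PS} (hp : X ∣ p) (s : ℕ) : fs (durf p s) = (Ei p)⁻¹ := by
  have h : ∀ N, fs (durf p s) = fs (durf p (s + N)) := by
    intro N
    induction N with
    | zero => rfl
    | succ N ih => rw [ih, durf_const hp]; rfl
  refine eq_of_dvd fun N => ?_
  rw [h N, fs_nat (durf_LF hp _)]
  have : durf p (s+N) 0 = iq p ((s + N : ℕ) : ℤ) := by simp [durf, iq_zero]
  rw [this]
  have h1 := iq_dvd hp (N := N) (k := ((s + N : ℕ) : ℤ)) (by push_cast; omega)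
  have h2 : X ^ N ∣ fs (fun j => durf p (s+N) (j+1)) := by
    refine dvd_fs fun j => ?_
    refine Dvd.dvd.mul_right ?_ _
    refine (pow_dvd_pow _ ?_).trans (pow_dvd_pow_of_dvd hp _)
    nlinarith
  have := dvd_add h1 h2
  convert this using 1
  ring

theorem durfee_bk {p : PS} (hp : X ∣ p) (r : ℕ) :
    fs (fun m : ℕ => p ^ (m^2) * bk p m r) = p ^ (r^2) * (Ei p)⁻¹ := by
  have L : ∀ k, LF (fun m : ℕ => p ^ ((m+k)^2) * bk p (m+k) r) := fun k =>
    LF.of_p hp (fun m => (m+k)^2) (fun j => by nlinarith [Nat.le_self_pow (n := 2) (by norm_num) j, Nat.zero_le (j * k)]) _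
  have h : ∀ k ≤ r, fs (fun m : ℕ => p ^ (m^2) * bk p m r) = fs (fun m : ℕ => p ^ ((m+k)^2) * bk p (m+k) r) := by
    intro k
    induction k with
    | zero => intro; rfl
    | succ k ih =>
      intro hk
      rw [ih (by omega), fs_nat (L k), bk_zero_of (by push_cast; omega), mul_zero, zero_add]
      refine fs_congr fun m => ?_
      rw [show m + 1 + k = m + (k+1) by ring]
  rw [h r le_rfl, ← durfee hp (2 * r), ← fs_mul_left (durf_LF hp _)]
  refine fs_congr fun m => ?_
  rw [durf, bk, ← mul_assoc (p ^ r ^ 2), ← pow_add]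
  push_cast
  congr 2
  · ring
  · congr 1; ring
  · congr 1; ring

theorem LF.of_pp {p : PS} {f : ℕ × ℕ → PS} (h1 : ∀ i, X ^ i.1 ∣ f i) (h2 : ∀ i, X ^ i.2 ∣ f i) : LF f := by
  refine LF.of_dvd (fun i => max i.1 i.2) (fun i => ?_) (fun d => ?_)
  · rcases max_cases i.1 i.2 with h | h
    · rw [h.1]; exact h1 i
    · rw [h.1]; exact h2 i
  · refine ((Set.finite_Iic d).prod (Set.finite_Iic d)).subset ?_
    intro i hi
    simp only [Set.mem_setOf_eq, max_le_iff] at hi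
    exact ⟨hi.1, hi.2⟩

theorem al_dvd {p t : PS} (hp : X ∣ p) (m : ℕ) : X ^ (m+1) ∣ al p t m := by
  have h : X ^ (m+1) ∣ p ^ tri (m+1) :=
    (pow_dvd_pow _ (by have := tri_ge (m+1); omega)).trans (pow_dvd_pow_of_dvd hp _)
  rw [al]
  exact (((h.mul_left _).mul_right _).mul_right _).mul_right _

theorem al_LF {p t : PS} (hp : X ∣ p) : LF (al p t) :=
  LF.of_dvd (fun m => m) (fun m => (pow_dvd_pow _ (by omega)).trans (al_dvd hp m)) finite_le

theorem bailey_sum {p t : PS} (hp : X ∣ p) :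
    Ei p * fs (fun m : ℕ => p ^ (m^2) * be p t m) = 1 + fs (fun r : ℕ => al p t r * p ^ ((r+1)^2)) := by
  have LL : LF (fun i : ℕ × ℕ => p ^ (i.1^2) * (al p t i.2 * bk p i.1 (i.2+1))) := by
    refine LF.of_pp (p := p) (fun i => ?_) (fun i => ?_)
    · exact ((pow_dvd_pow _ (by nlinarith)).trans (pow_dvd_pow_of_dvd hp _)).mul_right _
    · exact (((pow_dvd_pow _ (by omega)).trans (al_dvd hp _)).mul_right _).mul_left _
  have L0 : LF (fun m : ℕ => p ^ (m^2) * bk p m 0) := LF.of_p hp (fun m => m^2) (fun j => by nlinarith) _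
  have h1 : fs (fun m : ℕ => p ^ (m^2) * be p t m) =
      fs (fun m : ℕ => p ^ (m^2) * bk p m 0) +
      fs (fun r : ℕ => fs (fun m : ℕ => p ^ (m^2) * (al p t r * bk p m (r+1)))) := by
    rw [← fs_comm (f := fun m r : ℕ => p ^ (m^2) * (al p t r * bk p m (r+1))) LL, ← fs_add L0 LL.fst]
    refine fs_congr fun m => ?_
    rw [bailey hp, mul_add, ← fs_mul_left (bkn_LF _ _)]
  have h0 := durfee_bk hp 0
  simp only [Nat.cast_zero] at h0
  have hE := Ei_mul_inv hp
  have h2 : fs (fun r : ℕ => fs (fun m : ℕ => p ^ (m^2) * (al p t r * bk p m (r+1)))) =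
    fs (fun r : ℕ => al p t r * p ^ ((r+1)^2)) * (Ei p)⁻¹ := by
    rw [← fs_mul_right ((al_LF hp).mul_right _)]
    refine fs_congr fun r => ?_
    have := durfee_bk hp (r+1)
    push_cast at this
    rw [mul_assoc, ← this, ← fs_mul_left]
    · refine fs_congr fun m => ?_
      ring
    · exact LF.of_p hp (fun m => m^2) (fun j => by nlinarith) _
  rw [h1, h2, h0]
  simp only [zero_pow two_ne_zero, pow_zero, one_mul]
  linear_combination (1 + fs (fun r : ℕ => al p t r * p ^ ((r+1)^2))) * hE

theorem Bi_dvd {p t : PS} (hp : X ∣ p) {N n : ℕ} (h : N ≤ n) : X ^ N ∣ Bi p t - be p t n := by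
  rw [Bi, be]
  refine inv_dvd ?_ ?_ (ip_dvd (quad_adm hp) h)
  · rw [ip_cc (quad_adm hp), quad_cc hp]; simp
  · rw [bprod_cc hp]; simp

theorem Bi_mul {p t : PS} (hp : X ∣ p) : ip (fun k => quad p t (k+1)) * Bi p t = 1 :=
  PowerSeries.mul_inv_cancel _ (by rw [ip_cc (quad_adm hp), quad_cc hp]; simp)

theorem bailey_lim {p t : PS} (hp : X ∣ p) : Ei p ^ 2 * Bi p t = 1 + fs (al p t) := by
  have hE := Ei_mul_inv hp
  suffices H : Bi p t = ((Ei p)⁻¹ * (Ei p)⁻¹) * (1 + fs (al p t)) by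
    rw [H]
    linear_combination (1 + fs (al p t)) * (1 + Ei p * (Ei p)⁻¹) * hE
  refine eq_of_dvd fun N => ?_
  have h1 := Bi_dvd (t := t) hp (show N ≤ 2 * N + 2 by omega)
  rw [bailey hp] at h1
  have h2 : X ^ N ∣ bk p (2 * N + 2) 0 - (Ei p)⁻¹ * (Ei p)⁻¹ := bk_dvd hp (by simp; omega)
  have h3 : X ^ N ∣ fs (fun m => al p t m * bk p (2 * N + 2) (m+1)) - ((Ei p)⁻¹ * (Ei p)⁻¹) * fs (al p t) := by
    rw [← fs_mul_left (al_LF hp), ← fs_sub (bkn_LF _ _) ((al_LF hp).mul_left _)]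
    refine dvd_fs fun m => ?_
    rw [mul_comm ((Ei p)⁻¹ * (Ei p)⁻¹), ← mul_sub]
    by_cases hr : m ≤ N + 1
    · exact (bk_dvd hp (by rw [abs_of_nonneg (by positivity)]; push_cast; omega)).mul_left _
    · exact ((pow_dvd_pow _ (by omega)).trans (al_dvd hp m)).mul_right _
  have := dvd_add (dvd_add h1 h2) h3
  convert this using 1
  ring


/-! ### the functions 1/(1+q^k) -/
noncomputable def v (k : ℤ) : PS :=
  if 0 ≤ k then (1 + X ^ k.toNat)⁻¹ else X ^ (-k).toNat * (1 + X ^ (-k).toNat)⁻¹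

abbrev KK := FractionRing PS
noncomputable def io : PS →+* KK := algebraMap PS KK
noncomputable def xx : KK := io X

theorem io_inj {a b : PS} (h : io a = io b) : a = b := IsFractionRing.injective PS KK h
theorem xx_ne : xx ≠ 0 := by
  intro h
  have : io X = io 0 := by rw [map_zero]; exact h
  exact X_ne_zero (io_inj this)
theorem io_pow (n : ℕ) : io (X ^ n) = xx ^ (n : ℤ) := by rw [map_pow, zpow_natCast]; rfl

theorem one_add_X_cc (n : ℕ) : constantCoeff (1 + X ^ n : PS) ≠ 0 := by
  rcases Nat.eq_zero_or_pos n with h | h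
  · subst h; simp
  · have : n ≠ 0 := by omega
    simp [this]

theorem one_add_xx_nat (n : ℕ) : (1 + xx ^ n : KK) ≠ 0 := by
  intro h
  have : io (1 + X ^ n) = io 0 := by rw [map_add, map_one, map_pow, map_zero]; exact h
  exact ne_zero_of_cc (one_add_X_cc n) (io_inj this)

theorem one_add_xx (k : ℤ) : (1 + xx ^ k : KK) ≠ 0 := by
  rcases le_or_gt 0 k with h | h
  · obtain ⟨n, rfl⟩ := Int.eq_ofNat_of_zero_le h
    rw [zpow_natCast]; exact one_add_xx_nat n
  · obtain ⟨n, hn⟩ := Int.eq_ofNat_of_zero_le (show 0 ≤ -k by omega)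
    have h1 := one_add_xx_nat n
    have hx := xx_ne
    obtain rfl : k = -n := by omega
    rw [zpow_neg, zpow_natCast]
    intro h2
    apply h1
    field_simp at h2
    linear_combination h2

theorem io_inv (n : ℕ) : io ((1 + X ^ n)⁻¹) = (1 + xx ^ n)⁻¹ := by
  have h := PowerSeries.mul_inv_cancel _ (one_add_X_cc n)
  have h2 := congrArg io h
  rw [map_mul, map_add, map_one, map_pow] at h2
  exact eq_inv_of_mul_eq_one_right h2

theorem fl1 {y : KK} (hy : y ≠ 0) (h : 1 + y ≠ 0) : (1 + y⁻¹)⁻¹ = y * (1 + y)⁻¹ := by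
  have : 1 + y⁻¹ = (1 + y) / y := by field_simp; ring
  rw [this, inv_div]; rfl

theorem fl2 {y : KK} (h : 1 + y ≠ 0) : (1 + y)⁻¹ + y * (1 + y)⁻¹ = 1 := by
  rw [← one_add_mul, mul_inv_cancel₀ h]

theorem io_v (k : ℤ) : io (v k) = (1 + xx ^ k)⁻¹ := by
  rcases le_or_gt 0 k with h | h
  · rw [v, if_pos h, io_inv, ← zpow_natCast, Int.toNat_of_nonneg h]
  · rw [v, if_neg (by omega), map_mul, io_inv, io_pow, ← zpow_natCast, Int.toNat_of_nonneg (by omega)]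
    have hx := zpow_ne_zero (-k) xx_ne
    rw [← fl1 hx (one_add_xx (-k)), zpow_neg, inv_inv]

theorem io_sg (k : ℤ) : io (sg k) = (((Int.negOnePow k : ℤˣ) : ℤ) : KK) := by
  simp [sg]

theorem v_add_neg (k : ℤ) : v k + v (-k) = 1 := by
  apply io_inj
  rw [map_add, map_one, io_v, io_v, zpow_neg]
  rw [fl1 (zpow_ne_zero k xx_ne) (one_add_xx k), fl2 (one_add_xx k)]

theorem v_neg_nat (k : ℕ) : v (-(k:ℤ)) = X ^ k * v k := by
  apply io_inj
  rw [map_mul, io_v, io_v, io_pow, zpow_neg]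
  rw [fl1 (zpow_ne_zero k xx_ne) (one_add_xx k)]

theorem v_nat (k : ℕ) : v k = (1 + X ^ k)⁻¹ := by simp [v]
theorem v_nat_mul (k : ℕ) : (1 + X ^ k) * v k = 1 := by
  rw [v_nat]; exact PowerSeries.mul_inv_cancel _ (one_add_X_cc k)

theorem v_zero : 2 * v 0 = 1 := by
  have := v_add_neg 0
  simp only [neg_zero] at this
  linear_combination this

theorem fs_parity {f : ℤ → PS} (hf : LF f) :
    fs f = fs (fun k => f (2 * k)) + fs (fun k => f (2 * k + 1)) := by
  let e : ℤ ⊕ ℤ ≃ ℤ := Equiv.ofBijective (Sum.elim (fun k => 2 * k) (fun k => 2 * k + 1)) (by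
    constructor
    · rintro (a | a) (b | b) h <;> simp at h ⊢ <;> omega
    · intro b
      rcases Int.even_or_odd' b with ⟨k, hk | hk⟩
      · exact ⟨Sum.inl k, hk.symm⟩
      · exact ⟨Sum.inr k, hk.symm⟩)
  rw [← fs_equiv e f, fs_sum (f := fun o => f (e o)) (hf.comp e.injective)]
  rfl

theorem LFz {f : ℤ → PS} (e : ℤ → ℕ) (h : ∀ i, X ^ (e i) ∣ f i) (c : ℤ) (he : ∀ i, |i| ≤ e i + c) : LF f := by
  refine LF.of_dvd e h fun d => ?_
  refine (Set.finite_Icc (-(d + c)) (d + c)).subset ?_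
  intro i hi
  have h1 := he i
  simp only [Set.mem_setOf_eq] at hi
  have : |i| ≤ d + c := by omega
  exact abs_le.1 this

theorem LFzz {f : ℤ × ℤ → PS} (e : ℤ × ℤ → ℕ) (h : ∀ i, X ^ (e i) ∣ f i) (c : ℤ)
    (he1 : ∀ i, |i.1| ≤ e i + c) (he2 : ∀ i, |i.2| ≤ e i + c) : LF f := by
  refine LF.of_dvd e h fun d => ?_
  refine ((Set.finite_Icc (-(d + c)) (d + c)).prod (Set.finite_Icc (-(d + c)) (d + c))).subset ?_
  intro i hi
  have h1 := he1 i
  have h2 := he2 i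
  simp only [Set.mem_setOf_eq] at hi
  have h3 : |i.1| ≤ d + c := by omega
  have h4 : |i.2| ≤ d + c := by omega
  exact ⟨abs_le.1 h3, abs_le.1 h4⟩

/-! ### Appell type sums -/
def sqn (n : ℤ) : ℕ := (n ^ 2).toNat
theorem sqn_spec (n : ℤ) : (sqn n : ℤ) = n ^ 2 := Int.toNat_of_nonneg (sq_nonneg n)

noncomputable def Ap (a b k : ℕ) (n : ℤ) : PS := sg n * X ^ (a * tri n + b * sqn n) * v (k * n)

theorem Ap_LF {a b k : ℕ} (ha : 1 ≤ a) : LF (Ap a b k) := by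
  refine LFz (fun n => tri n) (fun n => ?_) 1 tri_pos_ge
  rw [Ap]
  refine Dvd.dvd.mul_right (Dvd.dvd.mul_left (pow_dvd_pow _ ?_) _) _
  nlinarith [Nat.zero_le (b * sqn n), Nat.mul_le_mul_right (tri n) ha]

theorem Ap_fold {a b k : ℕ} (ha : 1 ≤ a) (hk : a ≤ k) :
    2 * fs (Ap a b k) = 1 + fs (fun m : ℕ => 2 * (sg (m+1) * X ^ (a * tri (m+1) + b * (m+1)^2) *
      (1 + X ^ ((k - a) * (m+1))) * v ((k * (m+1) : ℕ)))) := by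
  have L := Ap_LF (b := b) (k := k) ha
  have L2 : LF (fun m : ℕ => Ap a b k (m+1) + Ap a b k (-(m+1))) := by
    refine LF.add ?_ ?_
    · exact L.comp (g := fun m : ℕ => (m:ℤ)+1) (by intro x y h; simpa using h)
    · exact L.comp (g := fun m : ℕ => -((m:ℤ)+1)) (by intro x y h; simpa using h)
  rw [fs_int L, mul_add, ← fs_mul_left L2]
  congr 1
  · simp only [Ap, mul_zero, sg_zero]
    have : a * tri 0 + b * sqn 0 = 0 := by simp [tri, sqn]
    rw [this]
    linear_combination v_zero
  · refine fs_congr fun m => ?_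
    have e1 : sqn ((m:ℤ)+1) = (m+1)^2 := by zify; rw [sqn_spec]
    have e2 : sqn (-((m:ℤ)+1)) = (m+1)^2 := by zify; rw [sqn_spec]; ring
    have e3 : tri (m+1) = tri (-((m:ℤ)+1)) + (m+1) := by
      have h1 := tri_spec (m+1)
      have h2 := tri_spec (-((m:ℤ)+1))
      zify; linarith
    have e4 : (k:ℤ) * (-((m:ℤ)+1)) = -((k * (m+1) : ℕ) : ℤ) := by push_cast; ring
    have e5 : (k:ℤ) * (((m:ℤ)+1)) = ((k * (m+1) : ℕ) : ℤ) := by push_cast; ring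
    obtain ⟨c, rfl⟩ := Nat.exists_eq_add_of_le hk
    rw [Ap, Ap, e1, e2, e4, e5, v_neg_nat, e3, sg_neg, Nat.add_sub_cancel_left]
    ring

theorem tri_cast (m : ℕ) : tri ((m:ℤ)+1) = tri ((m:ℤ)+1) := rfl

theorem hX : (X : PS) ∣ X := dvd_rfl
theorem hXp {k : ℕ} (h : 1 ≤ k) : (X : PS) ∣ X ^ k := dvd_pow_self _ (by omega)

noncomputable def Rt (t : PS) : PS := fs (fun m : ℕ => X ^ (m^2) * be X t m)

theorem R_neg2 : Ei X * Rt (-2) = 2 * fs (Ap 1 1 1) := by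
  rw [Rt, bailey_sum hX, Ap_fold le_rfl le_rfl]
  congr 1
  refine fs_congr fun m => ?_
  have h1 := quad_inv (p := X) (t := -2) hX m
  have h2 := v_nat_mul (m+1)
  have h3 : quad X (-2) (m+1) = (1 + X ^ (m+1)) ^ 2 := by rw [quad]; ring
  have h4 : (1 + X ^ (m+1)) * (quad X (-2) (m+1))⁻¹ = v ((m+1 : ℕ)) := by
    apply mul_left_cancel₀ (ne_zero_of_cc (one_add_X_cc (m+1)))
    linear_combination h1 - h2 - (quad X (-2) (m+1))⁻¹ * h3
  simp only [one_mul, al, Nat.sub_self, zero_mul, pow_zero]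
  rw [pow_add]
  linear_combination (4 * sg (m+1) * X ^ tri (m+1) * X ^ ((m+1)^2)) * h4

theorem R_0 : Ei X * Rt 0 = 2 * fs (Ap 1 1 2) := by
  rw [Rt, bailey_sum hX, Ap_fold le_rfl (by norm_num)]
  congr 1
  refine fs_congr fun m => ?_
  have h3 : quad X 0 (m+1) = (1 + X ^ (2 * (m+1))) := by rw [quad]; ring
  rw [al, h3, v_nat]
  simp only [one_mul]
  rw [pow_add]
  ring

theorem R_s {s : PS} (hs : s ^ 2 = 2) : Ei X * (Rt s + Rt (-s)) = 4 * fs (Ap 1 1 4) := by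
  have L : ∀ t, LF (fun m : ℕ => al X t m * X ^ ((m+1)^2)) := fun t => (al_LF hX).mul_right _
  have h := Ap_fold (a := 1) (b := 1) (k := 4) le_rfl (by norm_num)
  rw [mul_add, Rt, Rt, bailey_sum hX, bailey_sum hX, show (4:PS) = 2 * 2 by norm_num, mul_assoc, h, mul_add]
  have : (1 + fs (fun m : ℕ => al X s m * X ^ ((m+1)^2))) + (1 + fs (fun m : ℕ => al X (-s) m * X ^ ((m+1)^2)))
    = 2 * 1 + fs (fun m : ℕ => al X s m * X ^ ((m+1)^2) + al X (-s) m * X ^ ((m+1)^2)) := by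
    rw [fs_add (L _) (L _)]; ring
  rw [this, ← fs_mul_left]
  · congr 1
    refine fs_congr fun m => ?_
    have h1 := quad_inv (p := X) (t := s) hX m
    have h1' := quad_inv (p := X) (t := -s) hX m
    have h2 := v_nat_mul (4 * (m+1))
    have h3 : quad X s (m+1) * quad X (-s) (m+1) = (1 + X ^ (4 * (m+1))) := by
      rw [quad, quad]
      linear_combination (-X ^ (2 * (m+1))) * hs
    simp only [one_mul, al, show 4 - 1 = 3 from rfl]
    rw [pow_add]
    have h4 : (2 - s) * (1 + X ^ (m+1)) * (quad X s (m+1))⁻¹ + (2 + s) * (1 + X ^ (m+1)) * (quad X (-s) (m+1))⁻¹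
      = 4 * (1 + X ^ (3 * (m+1))) * v ((4 * (m+1) : ℕ)) := by
      apply mul_left_cancel₀ (ne_zero_of_cc (one_add_X_cc (4 * (m+1))))
      have e : (1 + X ^ (4 * (m+1))) * ((2 - s) * (1 + X ^ (m+1)) * (quad X s (m+1))⁻¹ + (2 + s) * (1 + X ^ (m+1)) * (quad X (-s) (m+1))⁻¹)
         = (2 - s) * (1 + X ^ (m+1)) * quad X (-s) (m+1) + (2 + s) * (1 + X ^ (m+1)) * quad X s (m+1) := by
        rw [← h3]
        linear_combination ((2 - s) * (1 + X ^ (m+1)) * quad X (-s) (m+1)) * h1 + ((2 + s) * (1 + X ^ (m+1)) * quad X s (m+1)) * h1'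
      rw [e, quad, quad]
      linear_combination (-2 * X ^ (m+1) * (1 + X^(m+1))) * hs - 4 * (1 + X ^ (3 * (m+1))) * h2
    linear_combination (sg (m+1) * X ^ tri (m+1) * X ^ ((m+1)^2)) * h4
  · refine LF.of_dvd (fun m => m) (fun m => ?_) finite_le
    have : X ^ m ∣ (X : PS) ^ (1 * tri (m+1) + 1 * (m+1)^2) := by
      apply pow_dvd_pow; nlinarith
    exact (((this.mul_left _).mul_right _).mul_right _).mul_left _

/-- level one sums -/
theorem A0_eq : 2 * fs (Ap 1 0 1) = Ei X ^ 2 * Bi X (-2) := by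
  rw [bailey_lim hX, Ap_fold le_rfl le_rfl]
  congr 1
  refine fs_congr fun m => ?_
  have h1 := quad_inv (p := X) (t := -2) hX m
  have h2 := v_nat_mul (m+1)
  have h3 : quad X (-2) (m+1) = (1 + X ^ (m+1)) ^ 2 := by rw [quad]; ring
  have h4 : (1 + X ^ (m+1)) * (quad X (-2) (m+1))⁻¹ = v ((m+1 : ℕ)) := by
    apply mul_left_cancel₀ (ne_zero_of_cc (one_add_X_cc (m+1)))
    linear_combination h1 - h2 - (quad X (-2) (m+1))⁻¹ * h3
  simp only [one_mul, al, Nat.sub_self, zero_mul, pow_zero, add_zero]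
  linear_combination -(4 * sg (m+1) * X ^ tri (m+1)) * h4

theorem a0_eq : 2 * fs (Ap 1 0 2) = Ei X ^ 2 * Bi X 0 := by
  rw [bailey_lim hX, Ap_fold le_rfl (by norm_num)]
  congr 1
  refine fs_congr fun m => ?_
  have h3 : quad X 0 (m+1) = (1 + X ^ (2 * (m+1))) := by rw [quad]; ring
  rw [al, h3, v_nat]
  simp only [one_mul, zero_mul, add_zero]
  ring

theorem A02_eq : 2 * fs (Ap 2 0 2) = Ei (X^2) ^ 2 * Bi (X^2) (-2) := by
  rw [bailey_lim (hXp (by norm_num)), Ap_fold (by norm_num) le_rfl]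
  congr 1
  refine fs_congr fun m => ?_
  have h1 := quad_inv (p := X^2) (t := -2) (hXp (by norm_num)) m
  have h2 := v_nat_mul (2 * (m+1))
  have h3 : quad (X^2) (-2) (m+1) = (1 + X ^ (2 * (m+1))) ^ 2 := by rw [quad]; ring
  have h4 : (1 + X ^ (2 * (m+1))) * (quad (X^2) (-2) (m+1))⁻¹ = v ((2 * (m+1) : ℕ)) := by
    apply mul_left_cancel₀ (ne_zero_of_cc (one_add_X_cc (2 * (m+1))))
    linear_combination h1 - h2 - (quad (X^2) (-2) (m+1))⁻¹ * h3
  simp only [one_mul, al, Nat.sub_self, zero_mul, pow_zero, add_zero]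
  rw [← pow_mul, ← pow_mul]
  linear_combination -(4 * sg (m+1) * X ^ (2 * tri (m+1))) * h4


/-! ### rescaling -/
theorem rs_cc (a : ℂ) (f : PS) : constantCoeff (rescale a f) = constantCoeff f := by
  rw [← coeff_zero_eq_constantCoeff_apply, coeff_rescale]; simp

theorem rs_inv (a : ℂ) {f : PS} (hf : constantCoeff f ≠ 0) : rescale a f⁻¹ = (rescale a f)⁻¹ := by
  apply eq_inv_of_mul (by rw [rs_cc]; exact hf)
  rw [← map_mul, PowerSeries.mul_inv_cancel _ hf, map_one]

theorem rs_LF (a : ℂ) {ι : Type*} {f : ι → PS} (hf : LF f) : LF (fun i => rescale a (f i)) := by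
  intro d
  refine (hf d).subset ?_
  intro i hi
  simp only [Function.mem_support, coeff_rescale] at hi ⊢
  exact right_ne_zero_of_mul hi

theorem rs_fs (a : ℂ) {ι : Type*} {f : ι → PS} (hf : LF f) : rescale a (fs f) = fs (fun i => rescale a (f i)) := by
  ext d
  simp only [coeff_rescale, coeff_fs]
  exact mul_finsum _ _

theorem rs_ip (a : ℂ) (f : ℕ → PS) : rescale a (ip f) = ip (fun i => rescale a (f i)) := by
  ext d
  simp only [coeff_rescale, ip, coeff_mk, ← map_prod]

theorem rs_sg (a : ℂ) (k : ℤ) : rescale a (sg k) = sg k := by simp [sg]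

theorem rs_Xpow (a : ℂ) (n : ℕ) : rescale a (X ^ n : PS) = C (a ^ n) * X ^ n := by
  rw [map_pow, rescale_X, mul_pow, map_pow]

theorem rs_Xpow_of (a : ℂ) {n : ℕ} (h : a ^ n = 1) : rescale a (X ^ n : PS) = X ^ n := by
  rw [rs_Xpow, h]; simp

theorem neg_one_pow_two_mul (n : ℕ) : (-1 : ℂ) ^ (2 * n) = 1 := by simp
theorem I_pow_four_mul (n : ℕ) : (Complex.I) ^ (4 * n) = 1 := by rw [pow_mul, Complex.I_pow_four, one_pow]

theorem rs_v (k : ℤ) : rescale (-1 : ℂ) (v (2 * k)) = v (2 * k) := by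
  rw [v]
  split_ifs with h
  · rw [rs_inv _ (one_add_X_cc _), map_add, map_one, rs_Xpow_of]
    rw [show (2 * k).toNat = 2 * k.toNat by omega, neg_one_pow_two_mul]
  · have : rescale (-1 : ℂ) (X ^ (-(2 * k)).toNat : PS) = X ^ (-(2 * k)).toNat := by
      rw [rs_Xpow_of]
      rw [show (-(2 * k)).toNat = 2 * (-k).toNat by omega, neg_one_pow_two_mul]
    rw [map_mul, rs_inv _ (one_add_X_cc _), map_add, map_one, this]

/-! ### product identities -/
noncomputable def psi : PS := fs (fun n : ℤ => X ^ tri n)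
noncomputable def Th : PS := fs (fun d : ℤ => sg d * X ^ (2 * sqn d))
noncomputable def Pp (p : PS) : PS := ip (fun i => 1 + p ^ (i+1))

theorem adm_one_add {p : PS} (hp : X ∣ p) : Adm (fun i => 1 + p ^ (i+1)) := by
  have := (adm_pow hp 1).shift
  simpa using this

theorem Ei_sq {p : PS} (hp : X ∣ p) : Ei (p^2) = Ei p * Pp p := by
  rw [Ei, Ei, Pp, ← ip_mul (adm_one_sub hp) (adm_one_add hp)]
  congr 1; funext i; ring

theorem tri_zero : tri 0 = 0 := by simp [tri]

theorem G1 : Ei X * psi = 2 * Ei (X^2) ^ 2 := by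
  have h := jtp (u := X) (v := 1) hX (by ring)
  have h1 : fs (jc X 1) = psi := fs_congr fun r => by simp [jc]
  have h2 : ip (fun i => 1 + (1:PS) * X ^ i) = 2 * Pp X := by
    rw [ip_shift (adm_pow hX 1), Pp]
    simp only [one_mul, pow_zero]
    norm_num
  have h3 : ip (fun i => 1 + (X:PS) * X ^ i) = Pp X := by
    rw [Pp]; congr 1; funext i; ring
  rw [h1, h2, h3] at h
  rw [h, Ei_sq hX]; ring

theorem G2 : Th * Ei (X^4) = Ei (X^2) ^ 2 := by
  have h4 : (X:PS) ∣ X^4 := hXp (by norm_num)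
  have h2 : (X:PS) ∣ X^2 := hXp (by norm_num)
  have h := jtp (u := -X^2) (v := -X^2) h4 (by ring)
  have h1 : fs (jc (-X^2) (-X^2)) = Th := by
    refine fs_congr fun r => ?_
    rw [jc_neg, jc, ← pow_add, ← pow_mul]
    congr 2
    have a1 := tri_spec r
    have a2 := tri_spec (r-1)
    have a3 := sqn_spec r
    zify; rw [a3]; linarith
  rw [h1] at h
  have e : Ei (X^2) = ip (fun i => 1 + (-X^2) * (X^4)^i) * Ei (X^4) := by
    rw [Ei, ip_even_odd (adm_one_sub h2), Ei]
    congr 2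
    · funext i; ring
    · funext i; ring
  rw [h, e]; ring

noncomputable def En : PS := rescale (-1 : ℂ) (Ei X)

theorem Ei_En : Ei X * En * Pp (X^2) = Ei (X^2) ^ 2 := by
  have h4 : (X:PS) ∣ X^4 := hXp (by norm_num)
  have h2 : (X:PS) ∣ X^2 := hXp (by norm_num)
  have hr : rescale (-1 : ℂ) (X : PS) = -X := by rw [rescale_X]; simp
  have hn : En = ip (fun i => 1 - (-X)^(i+1)) := by
    rw [En, Ei, rs_ip]
    congr 1; funext i
    rw [map_sub, map_one, map_pow, hr]
  have hnX : (X:PS) ∣ -X := by simp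
  have a1 : Ei X = ip (fun i => 1 + (-X) * (X^2)^i) * Ei (X^2) := by
    rw [Ei, ip_even_odd (adm_one_sub hX), Ei]
    congr 2
    · funext i; ring
    · funext i; ring
  have a2 : En = ip (fun i => 1 + X * (X^2)^i) * Ei (X^2) := by
    rw [hn, ip_even_odd (adm_one_sub hnX), Ei]
    congr 2
    · funext i
      rw [pow_succ, pow_mul]; ring
    · funext i
      rw [show 2 * i + 1 + 1 = 2 * (i+1) by ring, pow_mul]; ring
  have a3 : ip (fun i => 1 + (-X) * (X^2)^i) * ip (fun i => 1 + (X:PS) * (X^2)^i) = ip (fun i => 1 + (-X^2) * (X^4)^i) := by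
    rw [← ip_mul (adm_pow h2 _) (adm_pow h2 _)]
    congr 1; funext i; ring
  have a4 : Ei (X^2) = ip (fun i => 1 + (-X^2) * (X^4)^i) * Ei (X^4) := by
    rw [Ei, ip_even_odd (adm_one_sub h2), Ei]
    congr 2
    · funext i; ring
    · funext i; ring
  have a5 : Ei (X^4) = Ei (X^2) * Pp (X^2) := by
    rw [← Ei_sq h2]; congr 1; ring
  have a6 : ip (fun i => 1 + (-X^2) * (X^4)^i) * Pp (X^2) = (1:PS) := by
    apply mul_left_cancel₀ (ne_zero_of_cc (a := Ei (X^2)) (by rw [Ei_cc h2]; simp))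
    rw [mul_one]
    nth_rewrite 2 [a4]
    rw [a5]; ring
  rw [a1, a2]
  linear_combination (Ei (X^2)^2 * Pp (X^2)) * a3 + Ei (X^2)^2 * a6

theorem Bi_0 : Pp (X^2) * Bi X 0 = 1 := by
  rw [← Bi_mul (p := X) (t := 0) hX]
  congr 1
  rw [Pp]; congr 1; funext i; rw [quad]; ring

theorem Bi_2 : Pp (X^2) ^ 2 * Bi (X^2) (-2) = 1 := by
  have h2 : (X:PS) ∣ X^2 := hXp (by norm_num)
  rw [← Bi_mul (p := X^2) (t := -2) h2]
  congr 1
  rw [Pp, pow_two, ← ip_mul (adm_one_add h2) (adm_one_add h2)]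
  congr 1; funext i; rw [quad]; ring

theorem two_ne : (2:PS) ≠ 0 := ne_zero_of_cc (by rw [map_ofNat]; norm_num)

theorem a0_A02 : fs (Ap 1 0 2) * En = fs (Ap 2 0 2) * Ei X := by
  have h1 := a0_eq
  have h2 := A02_eq
  have h3 := Bi_0
  have h4 := Bi_2
  have h5 := Ei_En
  have hP : Pp (X^2) ^ 2 ≠ 0 := by
    intro h; rw [h, zero_mul] at h4; exact zero_ne_one h4
  have h2' : (2:PS) ≠ 0 := two_ne
  apply mul_left_cancel₀ hP
  apply mul_left_cancel₀ h2'
  linear_combination (Pp (X^2) ^ 2 * En) * h1 - (Pp (X^2)^2 * Ei X) * h2 + (Pp (X^2) * En * Ei X ^2) * h3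
    - (Ei (X^2) ^2 * Ei X) * h4 + Ei X * h5

theorem psi_LF : LF (fun n : ℤ => (X:PS) ^ tri n) :=
  LFz (fun n => tri n) (fun n => dvd_rfl) 1 tri_pos_ge

theorem psi_half (n : ℤ) : psi = 2 * fs (fun k : ℤ => X ^ tri (2 * k - n)) := by
  have h := fs_parity psi_LF
  have h2 : fs (fun k : ℤ => (X:PS) ^ tri (2 * k + 1)) = fs (fun k : ℤ => (X:PS) ^ tri (2 * k)) := by
    rw [← fs_refl (-1) (fun k : ℤ => (X:PS) ^ tri (2 * k))]
    refine fs_congr fun k => ?_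
    rw [← tri_neg]; congr 2; ring
  rcases Int.even_or_odd' n with ⟨j, rfl | rfl⟩
  · have : fs (fun k : ℤ => (X:PS) ^ tri (2 * k - 2 * j)) = fs (fun k : ℤ => (X:PS) ^ tri (2 * k)) := by
      rw [← fs_shift (-j) (fun k : ℤ => (X:PS) ^ tri (2 * k))]
      refine fs_congr fun k => ?_
      congr 2; ring
    rw [this, psi, h, h2]; ring
  · have : fs (fun k : ℤ => (X:PS) ^ tri (2 * k - (2 * j + 1))) = fs (fun k : ℤ => (X:PS) ^ tri (2 * k + 1)) := by
      rw [← fs_shift (-j - 1) (fun k : ℤ => (X:PS) ^ tri (2 * k + 1))]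
      refine fs_congr fun k => ?_
      congr 2; ring
    rw [this, psi, h, ← h2]; ring


/-! ### F2 -/

noncomputable def Dk (k : ℕ) (j : ℤ) (d : ℤ) : PS := sg d * X ^ (2 * sqn d) * v (k * (d + j))

theorem sqn_ge (n : ℤ) : |n| ≤ sqn n := by
  rw [sqn_spec]
  rcases abs_cases n with h | h <;> nlinarith

theorem Dk_LF (k : ℕ) (j : ℤ) : LF (Dk k j) := by
  refine LFz (fun n => 2 * sqn n) (fun n => ?_) 0 (fun n => ?_)
  · exact ((dvd_refl _).mul_left _).mul_right _
  · have := sqn_ge n; push_cast; omega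

theorem Th_LF : LF (fun d : ℤ => sg d * X ^ (2 * sqn d)) := by
  refine LFz (fun n => 2 * sqn n) (fun n => ?_) 0 (fun n => ?_)
  · exact ((dvd_refl _).mul_left _)
  · have := sqn_ge n; push_cast; omega

theorem Dk_neg (k : ℕ) (j : ℤ) : fs (Dk k (-j)) = Th - fs (Dk k j) := by
  have : fs (Dk k (-j)) = fs (fun d => Dk k (-j) (0 - d)) := (fs_refl 0 _).symm
  rw [this, Th, ← fs_sub Th_LF (Dk_LF k j)]
  refine fs_congr fun d => ?_
  rw [Dk, Dk, zero_sub, sg_neg]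
  have e : sqn (-d) = sqn d := by rw [sqn, sqn, neg_sq]
  have e2 : (k:ℤ) * (-d + -j) = - (k * (d + j)) := by ring
  rw [e, e2]
  linear_combination (sg d * X ^ (2 * sqn d)) * v_add_neg (k * (d+j))

theorem Dk_zero (k : ℕ) : 2 * fs (Dk k 0) = Th := by
  have := Dk_neg k 0
  rw [neg_zero] at this
  linear_combination this

theorem Dk_shift (k : ℕ) (j : ℤ) : fs (Dk k (j+1)) = fs (fun d => - (sg d * X ^ (2 * sqn (d-1)) * v (k * (d + j)))) := by
  rw [← fs_shift (-1) (Dk k (j+1))]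
  refine fs_congr fun d => ?_
  rw [Dk, sg_add, sg_neg, sg_one, ← sub_eq_add_neg, show d - 1 + (j+1) = d + j by ring]
  ring

theorem Th_shift : fs (fun d => sg d * X ^ (2 * sqn (d-1))) = - Th := by
  have h := fs_shift (-1) (fun d : ℤ => sg d * (X:PS) ^ (2 * sqn d))
  rw [Th, ← h, ← fs_neg]
  refine fs_congr fun d => ?_
  rw [sg_add, sg_neg, sg_one, ← sub_eq_add_neg]; ring

theorem Th_shift_LF : LF (fun d => sg d * X ^ (2 * sqn (d-1))) := by
  have := (Th_LF.shift (-1)).neg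
  convert this using 2 with d
  rw [sg_add, sg_neg, sg_one, ← sub_eq_add_neg]; ring

theorem D_rec (j : ℕ) : fs (Dk 4 (j+1)) = X ^ (4 * j + 2) * fs (Dk 4 j) + Th := by
  have hT := Th_shift
  have L := Dk_LF 4 j
  have : fs (fun d => - (sg d * X ^ (2 * sqn (d-1)) * v (4 * (d + j)))) =
      fs (fun d => X ^ (4 * j + 2) * Dk 4 j d) - fs (fun d => sg d * X ^ (2 * sqn (d-1))) := by
    rw [← fs_sub (L.mul_left _) Th_shift_LF]
    refine fs_congr fun d => ?_
    have key : (X ^ (2 * sqn (d-1)) + X ^ (4 * j + 2) * X ^ (2 * sqn d)) * v (4 * (d + j)) = X ^ (2 * sqn (d-1)) := by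
      apply io_inj
      rw [map_mul, map_add, map_mul, io_pow, io_pow, io_pow, io_v, ← zpow_add₀ xx_ne]
      have e : ((4 * j + 2 : ℕ) : ℤ) + ((2 * sqn d : ℕ):ℤ) = ((2 * sqn (d-1) : ℕ) : ℤ) + 4 * (d + j) := by
        push_cast; rw [sqn_spec, sqn_spec]; ring
      rw [e, zpow_add₀ xx_ne, ← mul_one_add, mul_assoc, mul_inv_cancel₀ (one_add_xx _), mul_one]
    rw [Dk]
    push_cast
    linear_combination (-sg d) * key
  have h2 := Dk_shift 4 j
  push_cast at h2
  rw [h2, this, hT, fs_mul_left L]; ring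

theorem zero2 : fs (fun d => sg d * X ^ (2 * sqn (d-1) + 2 * (d - 1)).toNat) = 0 := by
  have h : fs (fun d => sg d * X ^ (2 * sqn (d-1) + 2 * (d - 1)).toNat) =
     - fs (fun d => sg d * X ^ (2 * sqn (d-1) + 2 * (d - 1)).toNat) := by
    conv_lhs => rw [← fs_refl 1 _]
    rw [← fs_neg]
    refine fs_congr fun d => ?_
    rw [sg_sub, sg_one]
    have : (2 * (sqn (1 - d - 1) : ℤ) + 2 * (1 - d - 1)) = (2 * (sqn (d-1):ℤ) + 2 * (d - 1)) := by
      rw [sqn_spec, sqn_spec]; ring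
    rw [this]; ring
  have h2 : 2 * fs (fun d => sg d * X ^ (2 * sqn (d-1) + 2 * (d - 1)).toNat) = 0 := by linear_combination h
  exact (mul_eq_zero.1 h2).resolve_left two_ne

theorem zero2_LF : LF (fun d : ℤ => sg d * X ^ (2 * (sqn (d-1) : ℤ) + 2 * (d - 1)).toNat) := by
  refine LFz (fun d => (2 * (sqn (d-1):ℤ) + 2 * (d - 1)).toNat) (fun n => ?_) 4 (fun n => ?_)
  · exact ((dvd_refl _).mul_left _)
  · have := sqn_spec (n-1)
    have h2 : 0 ≤ 2 * (sqn (n-1):ℤ) + 2 * (n - 1) := by rw [this]; nlinarith [Int.le_self_sq (1-n)]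
    rw [Int.toNat_of_nonneg h2, this]
    rcases abs_cases n with h | h <;> nlinarith [sq_nonneg (n-1), sq_nonneg (n)]

theorem F_rec (j : ℕ) : fs (Dk 2 (j+1)) = Th - X ^ (4 * j + 2) * fs (Dk 2 j) := by
  have hT := Th_shift
  have hz := zero2
  have L := Dk_LF 2 j
  have : fs (fun d => - (sg d * X ^ (2 * sqn (d-1)) * v (2 * (d + j)))) =
      X ^ (2 * j + 2) * fs (fun d => sg d * X ^ (2 * sqn (d-1) + 2 * (d - 1)).toNat)
      - fs (fun d => X ^ (4 * j + 2) * Dk 2 j d) - fs (fun d => sg d * X ^ (2 * sqn (d-1))) := by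
    rw [← fs_mul_left zero2_LF, ← fs_sub (zero2_LF.mul_left _) (L.mul_left _), ← fs_sub ((zero2_LF.mul_left _).sub (L.mul_left _)) Th_shift_LF]
    refine fs_congr fun d => ?_
    have key : (X ^ (2 * sqn (d-1)) - X ^ (4 * j + 2) * X ^ (2 * sqn d)) * v (2 * (d + j)) =
        X ^ (2 * sqn (d-1)) - X ^ (2 * j + 2) * X ^ (2 * (sqn (d-1) : ℤ) + 2 * (d - 1)).toNat := by
      apply io_inj
      have h2 : 0 ≤ 2 * (sqn (d-1):ℤ) + 2 * (d - 1) := by rw [sqn_spec]; nlinarith [Int.le_self_sq (1-d)]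
      rw [map_mul, map_sub, map_sub, map_mul, map_mul, io_pow, io_pow, io_pow, io_pow, io_pow, io_v,
        ← zpow_add₀ xx_ne, ← zpow_add₀ xx_ne, Int.toNat_of_nonneg h2]
      have e : ((4 * j + 2 : ℕ) : ℤ) + ((2 * sqn d : ℕ):ℤ) = ((2 * sqn (d-1) : ℕ) : ℤ) + 2 * (d + j) + 2 * (d + j) := by
        push_cast; rw [sqn_spec, sqn_spec]; ring
      have e2 : ((2 * j + 2 : ℕ) : ℤ) + (2 * (sqn (d-1) : ℤ) + 2 * (d - 1)) = ((2 * sqn (d-1) : ℕ) : ℤ) + 2 * (d + j) := by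
        push_cast; ring
      rw [e, e2, zpow_add₀ xx_ne, zpow_add₀ xx_ne]
      have h1 := one_add_xx (2 * (d + j))
      rw [← div_eq_mul_inv, div_eq_iff h1]
      ring
    rw [Dk]
    push_cast at key ⊢
    linear_combination (-sg d) * key
  have h2 := Dk_shift 2 j
  push_cast at h2
  rw [h2, this, hT, hz, fs_mul_left L]; ring

noncomputable def dn : ℕ → PS
  | 0 => C (1/2)
  | (k+1) => X ^ (4 * k + 2) * dn k + 1
noncomputable def fn : ℕ → PS
  | 0 => C (1/2)
  | (k+1) => 1 - X ^ (4 * k + 2) * fn k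

theorem rsI_X (k : ℕ) : rescale Complex.I (X ^ (4 * k + 2) : PS) = - X ^ (4 * k + 2) := by
  rw [rs_Xpow, pow_add, I_pow_four_mul, Complex.I_sq]; simp

theorem rs_C (a b : ℂ) : rescale a (C b : PS) = C b := by
  ext d; rw [coeff_rescale, coeff_C]; split_ifs with h <;> simp [h]

theorem rs_dn (k : ℕ) : rescale Complex.I (dn k) = fn k ∧ rescale Complex.I (fn k) = dn k := by
  induction k with
  | zero => exact ⟨rs_C _ _, rs_C _ _⟩
  | succ k ih =>
    constructor
    · rw [dn, fn, map_add, map_mul, rsI_X, map_one, ih.1]; ring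
    · rw [dn, fn, map_sub, map_mul, rsI_X, map_one, ih.2]; ring

theorem half_two : 2 * (C (1/2) : PS) = 1 := by
  rw [show (2:PS) = C 2 from (map_ofNat C 2).symm, ← map_mul]; norm_num

theorem Dk_dn (k : ℕ) : fs (Dk 4 k) = Th * dn k ∧ fs (Dk 2 k) = Th * fn k := by
  induction k with
  | zero =>
    have h := half_two
    have h4 := Dk_zero 4
    have h2 := Dk_zero 2
    constructor
    · rw [dn]; push_cast
      linear_combination -fs (Dk 4 0) * h + C (1/2) * h4
    · rw [fn]; push_cast
      linear_combination -fs (Dk 2 0) * h + C (1/2) * h2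
  | succ k ih =>
    push_cast
    rw [D_rec, F_rec, ih.1, ih.2, dn, fn]
    constructor <;> ring

theorem Dk_gen (j : ℤ) : ∃ d : PS, fs (Dk 4 j) + fs (Dk 2 j) = Th * d ∧ rescale Complex.I d = d := by
  obtain ⟨k, rfl | rfl⟩ := Int.eq_nat_or_neg j
  · refine ⟨dn k + fn k, ?_, ?_⟩
    · rw [(Dk_dn k).1, (Dk_dn k).2]; ring
    · rw [map_add, (rs_dn k).1, (rs_dn k).2]; ring
  · refine ⟨2 - (dn k + fn k), ?_, ?_⟩
    · rw [Dk_neg, Dk_neg, (Dk_dn k).1, (Dk_dn k).2]; ring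
    · rw [map_sub, map_add, (rs_dn k).1, (rs_dn k).2, map_ofNat]; ring

/-- the even part sum -/
def e6 (j : ℤ) : ℕ := (6 * j^2 + 2 * j).toNat
theorem e6_spec (j : ℤ) : (e6 j : ℤ) = 6 * j^2 + 2 * j := by
  rw [e6, Int.toNat_of_nonneg]; nlinarith [Int.le_self_sq (-j)]

theorem e6_four (j : ℤ) : ∃ m, e6 j = 4 * m := by
  obtain ⟨m, hm⟩ : 2 ∣ j * (3 * j + 1) := by
    rcases Int.even_or_odd' j with ⟨k, rfl | rfl⟩
    · exact ⟨k * (3 * (2 * k) + 1), by ring⟩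
    · exact ⟨(2 * k + 1) * (3 * k + 2), by ring⟩
  refine ⟨m.toNat, ?_⟩
  have := e6_spec j
  have h2 : (e6 j : ℤ) = 4 * m := by rw [this]; linarith
  omega

def ex (n k : ℤ) : ℕ := tri (2 * k - n) + tri n + sqn n
theorem ex_spec (n k : ℤ) : (ex n k : ℤ) = 2 * n^2 - 2 * n * k + k * (2 * k + 1) := by
  have h1 := tri_spec (2 * k - n)
  have h2 := tri_spec n
  have h3 := sqn_spec n
  rw [ex]; push_cast; rw [h3]; linarith

theorem ex_LF (c : ℕ) : LF (fun p : ℤ × ℤ => sg p.1 * X ^ (ex p.1 p.2) * v (c * p.1)) := by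
  have h1 : ∀ n k : ℤ, |n| ≤ ex n k := by
    intro n k
    have := sqn_ge n
    rw [ex]; push_cast; omega
  refine LFzz (fun p => ex p.1 p.2) (fun n => ((dvd_refl _).mul_left _).mul_right _) 1 (fun p => ?_) (fun p => ?_)
  · have := h1 p.1 p.2; omega
  · have h3 := tri_pos_ge (2 * p.2 - p.1)
    have h4 := sqn_ge p.1
    have h5 := abs_sub_abs_le_abs_sub (2 * p.2) p.1
    rw [abs_mul] at h5
    have : |(2:ℤ)| = 2 := rfl
    rw [this] at h5
    have h6 := abs_nonneg p.2
    rw [ex]; push_cast; omega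

theorem psi_L (c : ℕ) : psi * fs (Ap 1 1 c) = 2 * fs (fun k => fs (fun n => sg n * X ^ (ex n k) * v (c * n))) := by
  have LL := ex_LF c
  rw [← fs_comm (f := fun n k => sg n * X ^ (ex n k) * v (c * n)) LL, ← fs_mul_left (Ap_LF le_rfl), ← fs_mul_left LL.fst]
  refine fs_congr fun n => ?_
  have L1 : LF (fun k : ℤ => (X:PS) ^ tri (2 * k - n)) := by
    have := psi_LF.comp (g := fun k : ℤ => 2 * k - n) (by intro a b h; simp at h; exact h)
    exact this
  rw [psi_half n, mul_assoc, ← fs_mul_right L1]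
  congr 1
  refine fs_congr fun k => ?_
  simp only [Ap, ex]
  ring

theorem F2_split (c : ℕ) : ∃ O : PS, psi * fs (Ap 1 1 (2 * c)) =
    2 * (fs (fun j => sg j * X ^ (e6 j) * fs (Dk (2 * c) j)) + O) ∧ rescale (-1 : ℂ) O = - O := by
  have LL := ex_LF (2 * c)
  have Lk := LL.swap.fst
  simp only at Lk
  refine ⟨fs (fun k => fs (fun n => sg n * X ^ (ex n (2 * k + 1)) * v ((2 * c : ℕ) * n))), ?_, ?_⟩
  · rw [psi_L, fs_parity Lk]
    congr 2
    refine fs_congr fun j => ?_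
    rw [← fs_mul_left (Dk_LF _ _), ← fs_shift j]
    refine fs_congr fun d => ?_
    rw [Dk, sg_add]
    have : ex (d + j) (2 * j) = e6 j + 2 * sqn d := by
      zify; rw [ex_spec, e6_spec, sqn_spec]; ring
    rw [this]; ring
  · have L3 : LF (fun k => fs (fun n => sg n * X ^ (ex n (2 * k + 1)) * v ((2 * c : ℕ) * n))) :=
      Lk.comp (g := fun k : ℤ => 2 * k + 1) (by intro a b h; simp at h; exact h)
    rw [rs_fs _ L3, ← fs_neg]
    refine fs_congr fun k => ?_
    have L4 : LF (fun n => sg n * X ^ (ex n (2 * k + 1)) * v ((2 * c : ℕ) * n)) := LL.swap.sec (2 * k + 1)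
    rw [rs_fs _ L4, ← fs_neg]
    refine fs_congr fun n => ?_
    have : (-1 : ℂ) ^ ex n (2 * k + 1) = -1 := by
      apply Odd.neg_one_pow
      have := ex_spec n (2 * k + 1)
      rw [← Int.odd_coe_nat, this]
      exact ⟨n^2 - n * (2 * k + 1) + (2 * k + 1) * (2 * k + 1) + k, by ring⟩
    rw [map_mul, map_mul, rs_sg, rs_Xpow, this]
    have e : ((2 * c : ℕ) : ℤ) * n = 2 * (c * n) := by push_cast; ring
    rw [e, rs_v]
    simp

theorem coeff_zero_of_rs {W : PS} {a : ℂ} {d : ℕ} (h : rescale a W = W) (ha : a ^ d ≠ 1) : coeff d W = 0 := by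
  have := congrArg (coeff d) h
  rw [coeff_rescale] at this
  have h2 : (a ^ d - 1) * coeff d W = 0 := by linear_combination this
  exact (mul_eq_zero.1 h2).resolve_left (sub_ne_zero.2 ha)

theorem rs_Ei (a : ℂ) {k : ℕ} (h : a ^ k = 1) : rescale a (Ei (X^k)) = Ei (X^k) := by
  rw [Ei, rs_ip]
  congr 1; funext i
  rw [map_sub, map_one, map_pow, rs_Xpow_of a h]

theorem F2 {s : PS} (hs : s^2 = 2) (n : ℕ) : coeff (4 * n + 2) (Rt s + Rt (-s) + 2 * Rt 0) = 0 := by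
  set W := Rt s + Rt (-s) + 2 * Rt 0 with hW
  have h4 : (X:PS) ∣ X^4 := hXp (by norm_num)
  have h2 : (X:PS) ∣ X^2 := hXp (by norm_num)
  have hEW : Ei X * W = 4 * (fs (Ap 1 1 4) + fs (Ap 1 1 2)) := by
    linear_combination R_s hs + 2 * R_0
  obtain ⟨O4, h4e, h4o⟩ := F2_split 2
  obtain ⟨O2, h2e, h2o⟩ := F2_split 1
  norm_num at h4e h2e
  choose d hd hdI using Dk_gen
  set Z := fs (fun j => sg j * X ^ (e6 j) * d j) with hZ
  have LZ : LF (fun j => sg j * X ^ (e6 j) * d j) := by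
    refine LFz e6 (fun j => ((dvd_refl _).mul_left _).mul_right _) 0 (fun j => ?_)
    rw [e6_spec]
    rcases abs_cases j with h | h <;> nlinarith
  have LD : ∀ c, LF (fun j => sg j * X ^ (e6 j) * fs (Dk c j)) := by
    intro c
    refine LFz e6 (fun j => ((dvd_refl _).mul_left _).mul_right _) 0 (fun j => ?_)
    rw [e6_spec]
    rcases abs_cases j with h | h <;> nlinarith
  have hZ2 : fs (fun j => sg j * X ^ (e6 j) * fs (Dk 4 j)) + fs (fun j => sg j * X ^ (e6 j) * fs (Dk 2 j)) = Th * Z := by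
    rw [hZ, ← fs_mul_left LZ, ← fs_add (LD 4) (LD 2)]
    refine fs_congr fun j => ?_
    linear_combination (sg j * X ^ (e6 j)) * hd j
  have hZI : rescale Complex.I Z = Z := by
    rw [hZ, rs_fs _ LZ]
    refine fs_congr fun j => ?_
    obtain ⟨m, hm⟩ := e6_four j
    rw [map_mul, map_mul, rs_sg, hdI, rs_Xpow_of]
    rw [hm, I_pow_four_mul]
  have hThE : rescale (-1:ℂ) Th = Th := by
    rw [Th, rs_fs _ Th_LF]
    refine fs_congr fun j => ?_
    rw [map_mul, rs_sg, rs_Xpow_of _ (neg_one_pow_two_mul _)]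
  have hZE : rescale (-1:ℂ) Z = Z := by
    have : (-1:ℂ) = Complex.I * Complex.I := by rw [Complex.I_mul_I]
    rw [this, ← rescale_rescale, hZI, hZI]
  have hE4 : rescale (-1:ℂ) (Ei (X^4)) = Ei (X^4) := rs_Ei _ (by norm_num)
  have hE4I : rescale Complex.I (Ei (X^4)) = Ei (X^4) := rs_Ei _ Complex.I_pow_four
  have hTh : Th ≠ 0 := by
    intro h
    have := G2
    rw [h, zero_mul] at this
    exact ne_zero_of_cc (a := Ei (X^2)) (by rw [Ei_cc h2]; simp) (pow_eq_zero_iff (two_ne_zero) |>.1 this.symm)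
  have hY : Th * (Ei (X^4) * W - 4 * Z) = 4 * (O4 + O2) := by
    apply mul_left_cancel₀ two_ne
    linear_combination (2 * W) * G2 - W * G1 + psi * hEW + 4 * h4e + 4 * h2e + 8 * hZ2
  set Y := Ei (X^4) * W - 4 * Z with hYd
  have hYo : rescale (-1:ℂ) Y = - Y := by
    apply mul_left_cancel₀ hTh
    have := congrArg (rescale (-1:ℂ)) hY
    rw [map_mul, hThE, map_mul, map_add, h4o, h2o, map_ofNat] at this
    linear_combination this + hY
  set We := W + rescale (-1:ℂ) W with hWe
  have h8 : Ei (X^4) * We = 8 * Z := by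
    rw [hYd, map_sub, map_mul, map_mul, hE4, hZE, map_ofNat] at hYo
    linear_combination hYo
  have hWI : rescale Complex.I We = We := by
    apply mul_left_cancel₀ (ne_zero_of_cc (a := Ei (X^4)) (by rw [Ei_cc h4]; simp))
    have := congrArg (rescale Complex.I) h8
    rw [map_mul, hE4I, map_mul, hZI, map_ofNat] at this
    rw [this, h8]
  have hc := coeff_zero_of_rs (d := 4 * n + 2) hWI (by
    rw [pow_add, I_pow_four_mul, Complex.I_sq]; norm_num)
  rw [hWe, map_add, coeff_rescale, show 4 * n + 2 = 2 * (2 * n + 1) by ring, neg_one_pow_two_mul, one_mul, ← two_mul] at hc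
  rw [show 4 * n + 2 = 2 * (2 * n + 1) by ring]
  simpa using hc


/-! ### F3 -/
theorem alt_zero (c : ℕ) : fs (fun n : ℤ => sg n * X ^ (c * tri n)) = 0 := by
  have h : fs (fun n : ℤ => sg n * X ^ (c * tri n)) = - fs (fun n : ℤ => sg n * X ^ (c * tri n)) := by
    conv_lhs => rw [← fs_refl (-1) _]
    rw [← fs_neg]
    refine fs_congr fun d => ?_
    rw [tri_neg, sg_sub, sg_neg, sg_one]; ring
  have h2 : 2 * fs (fun n : ℤ => sg n * X ^ (c * tri n)) = 0 := by linear_combination h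
  exact (mul_eq_zero.1 h2).resolve_left two_ne

theorem alt_LF {c : ℕ} (hc : 1 ≤ c) : LF (fun n : ℤ => sg n * X ^ (c * tri n)) := by
  refine LFz (fun n => tri n) (fun n => ?_) 1 tri_pos_ge
  exact Dvd.dvd.mul_left (pow_dvd_pow _ (by nlinarith)) _

noncomputable def Jc (c : ℕ) (m n : ℤ) : PS := sg n * X ^ (c * tri n) * v (2 * (n - m))

theorem Jc_LF {c : ℕ} (hc : 1 ≤ c) (m : ℤ) : LF (Jc c m) := (alt_LF hc).mul_right _

theorem Jc_refl {c : ℕ} (hc : 1 ≤ c) (m : ℤ) : fs (Jc c (-1 - m)) = fs (Jc c m) := by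
  have h1 : fs (Jc c (-1 - m)) = fs (fun n => Jc c m n - sg n * X ^ (c * tri n)) := by
    rw [← fs_refl (-1) (Jc c (-1-m))]
    refine fs_congr fun d => ?_
    rw [Jc, Jc, tri_neg, sg_sub, sg_neg, sg_one]
    have := v_add_neg (2 * (d - m))
    rw [show 2 * (-1 - d - (-1 - m)) = -(2 * (d - m)) by ring]
    linear_combination (-sg d * X ^ (c * tri d)) * this
  rw [h1, fs_sub (Jc_LF hc m) (alt_LF hc), alt_zero, sub_zero]

theorem flv {y : KK} (h : 1 + y ≠ 0) : y * (1 + y)⁻¹ = 1 - (1+y)⁻¹ := by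
  linear_combination fl2 h

theorem J1_step (m : ℤ) (hm : -1 ≤ m) : fs (Jc 1 (m+2)) = - (X ^ (2 * m + 3).toNat * fs (Jc 1 m)) := by
  have h1 : fs (Jc 1 (m+2)) = fs (fun n => X ^ (2 * m + 3).toNat * (sg n * X ^ (1 * tri n)) - X ^ (2 * m + 3).toNat * Jc 1 m n) := by
    rw [← fs_shift 2 (Jc 1 (m+2))]
    refine fs_congr fun n => ?_
    rw [Jc, Jc, sg_add, show sg 2 = 1 from by simp [sg], show n + 2 - (m+2) = n - m by ring]
    have key : X ^ (1 * tri (n+2)) * v (2 * (n - m)) = X ^ (2 * m + 3).toNat * X ^ (1 * tri n) * (1 - v (2 * (n-m))) := by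
      apply io_inj
      rw [map_mul, map_mul, map_mul, map_sub, map_one, io_pow, io_pow, io_pow, io_v, ← flv (one_add_xx _), ← zpow_add₀ xx_ne, ← mul_assoc, ← zpow_add₀ xx_ne]
      congr 2
      have a1 := tri_spec n
      have a2 := tri_spec (n+2)
      rw [Int.toNat_of_nonneg (by omega)]
      push_cast; linarith
    linear_combination sg n * key
  rw [h1, fs_sub ((alt_LF le_rfl).mul_left _) ((Jc_LF le_rfl m).mul_left _), fs_mul_left (alt_LF le_rfl), alt_zero, fs_mul_left (Jc_LF le_rfl m)]
  ring

theorem J2_step (m : ℤ) (hm : -1 ≤ m) : fs (Jc 2 (m+1)) = X ^ (2 * m + 2).toNat * fs (Jc 2 m) := by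
  have h1 : fs (Jc 2 (m+1)) = fs (fun n => X ^ (2 * m + 2).toNat * Jc 2 m n - X ^ (2 * m + 2).toNat * (sg n * X ^ (2 * tri n))) := by
    rw [← fs_shift 1 (Jc 2 (m+1))]
    refine fs_congr fun n => ?_
    rw [Jc, Jc, sg_add, sg_one, show n + 1 - (m+1) = n - m by ring]
    have key : X ^ (2 * tri (n+1)) * v (2 * (n - m)) = X ^ (2 * m + 2).toNat * X ^ (2 * tri n) * (1 - v (2 * (n-m))) := by
      apply io_inj
      rw [map_mul, map_mul, map_mul, map_sub, map_one, io_pow, io_pow, io_pow, io_v, ← flv (one_add_xx _), ← zpow_add₀ xx_ne, ← mul_assoc, ← zpow_add₀ xx_ne]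
      congr 2
      have a1 := tri_spec n
      have a2 := tri_spec (n+1)
      rw [Int.toNat_of_nonneg (by omega)]
      push_cast; linarith
    linear_combination -sg n * key
  rw [h1, fs_sub ((Jc_LF (by norm_num) m).mul_left _) ((alt_LF (by norm_num)).mul_left _), fs_mul_left (alt_LF (by norm_num)), alt_zero, fs_mul_left (Jc_LF (by norm_num) m)]
  ring

theorem Jc_zero (c : ℕ) : Jc c 0 = Ap c 0 2 := by
  funext n; rw [Jc, Ap]; simp

theorem J2_nat (k : ℕ) : fs (Jc 2 k) = X ^ (2 * tri k) * fs (Ap 2 0 2) := by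
  induction k with
  | zero => push_cast; rw [Jc_zero, tri_zero]; simp
  | succ k ih =>
    push_cast
    rw [J2_step _ (by omega), ih, ← mul_assoc, ← pow_add]
    congr 2
    have a1 := tri_spec k
    have a2 := tri_spec (k+1)
    zify; rw [Int.toNat_of_nonneg (by omega)]
    linarith

theorem J2_all (m : ℤ) : fs (Jc 2 m) = X ^ (2 * tri m) * fs (Ap 2 0 2) := by
  rcases le_or_gt 0 m with h | h
  · obtain ⟨k, rfl⟩ := Int.eq_ofNat_of_zero_le h
    exact J2_nat k
  · obtain ⟨k, hk⟩ := Int.eq_ofNat_of_zero_le (show 0 ≤ -1 - m by omega)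
    rw [← Jc_refl (by norm_num), ← tri_neg, hk]
    exact J2_nat k

theorem J1_nat (k : ℕ) : fs (Jc 1 k) = (-X) ^ (tri k) * fs (Ap 1 0 2) ∧ fs (Jc 1 (k+1)) = (-X) ^ (tri (k+1)) * fs (Ap 1 0 2) := by
  induction k with
  | zero =>
    push_cast
    constructor
    · rw [Jc_zero, tri_zero]; simp
    · have h := J1_step (-1) le_rfl
      have h2 := Jc_refl (c := 1) le_rfl 0
      norm_num at h h2
      rw [h, h2, Jc_zero, show tri 1 = 1 from by simp [tri]]
      ring
  | succ k ih =>
    refine ⟨by push_cast; exact ih.2, ?_⟩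
    push_cast
    rw [add_assoc, show (1:ℤ)+1 = 2 from rfl, J1_step _ (by omega), ih.1]
    have : tri ((k:ℤ)+2) = (2 * (k:ℤ) + 3).toNat + tri k := by
      have a1 := tri_spec k
      have a2 := tri_spec (k+2)
      zify; rw [Int.toNat_of_nonneg (by omega)]
      linarith
    rw [this, pow_add]
    have h2 : (-X : PS) ^ (2 * (k:ℤ) + 3).toNat = - X ^ (2 * (k:ℤ) + 3).toNat := by
      apply Odd.neg_pow; exact ⟨k+1, by omega⟩
    rw [h2]; ring

theorem J1_all (m : ℤ) : fs (Jc 1 m) = (-X) ^ (tri m) * fs (Ap 1 0 2) := by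
  rcases le_or_gt 0 m with h | h
  · obtain ⟨k, rfl⟩ := Int.eq_ofNat_of_zero_le h
    exact (J1_nat k).1
  · obtain ⟨k, hk⟩ := Int.eq_ofNat_of_zero_le (show 0 ≤ -1 - m by omega)
    rw [← Jc_refl le_rfl, ← tri_neg, hk]
    exact (J1_nat k).1

theorem tri_sub (n : ℤ) : (tri (n-1) : ℤ) = tri n - n := by
  have a1 := tri_spec n
  have a2 := tri_spec (n-1)
  linarith

theorem Y_eq : fs (fun n : ℤ => sg n * X ^ tri (n-1) * v n) = - fs (Ap 1 0 1) := by
  have h1 : fs (fun n : ℤ => sg n * X ^ tri (n-1) * v n) = fs (fun n => sg n * X ^ (1 * tri n) - Ap 1 0 1 n) := by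
    rw [← fs_refl 0 (fun n : ℤ => sg n * X ^ tri (n-1) * v n)]
    refine fs_congr fun n => ?_
    have : tri (0 - n - 1) = tri n := by rw [← tri_neg]; congr 1; ring
    rw [this, Ap, zero_sub, sg_neg]
    simp only [Nat.cast_one, one_mul, zero_mul, add_zero]
    linear_combination (sg n * X ^ tri n) * v_add_neg n
  rw [h1, fs_sub (alt_LF le_rfl) (Ap_LF le_rfl), alt_zero, zero_sub]

theorem inner_eq (m : ℤ) : fs (fun n : ℤ => sg n * (X ^ tri (n-1) - X ^ tri n) * v (2 * (n - m))) =
    - (((-X) ^ (tri (m-1)) + (-X) ^ (tri m)) * fs (Ap 1 0 2)) := by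
  have h1 : fs (fun n : ℤ => sg n * X ^ tri (n-1) * v (2 * (n-m))) = - fs (Jc 1 (m-1)) := by
    rw [← fs_shift 1 (fun n : ℤ => sg n * X ^ tri (n-1) * v (2 * (n-m))), ← fs_neg]
    refine fs_congr fun n => ?_
    rw [Jc, sg_add, sg_one, show n + 1 - 1 = n by ring, show n + 1 - m = n - (m-1) by ring]
    ring
  have L1 : LF (fun n : ℤ => sg n * X ^ tri (n-1) * v (2 * (n-m))) := by
    have h := ((psi_LF.shift (-1)).mul_left (fun n => sg n)).mul_right (fun n => v (2 * (n-m)))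
    exact h
  have h2 : fs (fun n : ℤ => sg n * (X ^ tri (n-1) - X ^ tri n) * v (2 * (n - m))) =
     fs (fun n : ℤ => sg n * X ^ tri (n-1) * v (2 * (n-m))) - fs (Jc 1 m) := by
    rw [← fs_sub L1 (Jc_LF le_rfl m)]
    refine fs_congr fun n => ?_
    rw [Jc]; ring
  rw [h2, h1, J1_all, J1_all]; ring

theorem term_eq (n m : ℤ) : X ^ tri (n-1) * v n * v (2 * m) =
   X ^ tri (n-1) * v (2 * (m-n)) * v n + (X ^ tri (n-1) - X ^ tri n) * v (2 * (n-m)) * v (2 * m) := by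
  apply io_inj
  have e : tri n = tri (n-1) + n := by have := tri_sub n; linarith
  simp only [map_mul, map_add, map_sub, io_pow, io_v]
  rw [e, zpow_add₀ xx_ne]
  have h1 := one_add_xx n
  have h2 := one_add_xx (2 * m)
  have h3 := one_add_xx (2 * (n - m))
  have h4 := one_add_xx (2 * (m - n))
  have e1 : xx ^ (2 * m) = (xx ^ m) * (xx ^ m) := by rw [two_mul, zpow_add₀ xx_ne]
  have e2 : xx ^ (2 * (n - m)) = (xx ^ n / xx ^ m) * (xx ^ n / xx ^ m) := by
    rw [two_mul, zpow_add₀ xx_ne, zpow_sub₀ xx_ne]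
  have e3 : xx ^ (2 * (m - n)) = (xx ^ m / xx ^ n) * (xx ^ m / xx ^ n) := by
    rw [two_mul, zpow_add₀ xx_ne, zpow_sub₀ xx_ne]
  rw [e1] at h2 ⊢
  rw [e2] at h3 ⊢
  rw [e3] at h4 ⊢
  have ha := zpow_ne_zero n xx_ne
  have hb := zpow_ne_zero m xx_ne
  generalize xx ^ n = a at *
  generalize xx ^ m = b at *
  generalize xx ^ (tri (n-1) : ℤ) = t at *
  have h5 : a * a + b * b ≠ 0 := by
    intro h; apply h3; field_simp; linear_combination h
  have f3 : (1 + a / b * (a / b))⁻¹ = b * b * (a * a + b * b)⁻¹ := by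
    have : 1 + a / b * (a / b) = (a * a + b * b) / (b * b) := by field_simp; ring
    rw [this, inv_div]; rfl
  have f4 : (1 + b / a * (b / a))⁻¹ = a * a * (a * a + b * b)⁻¹ := by
    have : 1 + b / a * (b / a) = (a * a + b * b) / (a * a) := by field_simp
    rw [this, inv_div]; rfl
  rw [f3, f4]
  have g1 := mul_inv_cancel₀ h1
  have g2 := mul_inv_cancel₀ h2
  have g5 := mul_inv_cancel₀ h5
  generalize (1 + a)⁻¹ = A at *
  generalize (1 + b * b)⁻¹ = B at *
  generalize (a * a + b * b)⁻¹ = D at *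
  linear_combination (-t * A * B) * g5 + (t * A * D * a * a) * g2 + (t * b * b * D * B * (1 - a)) * g1

theorem W_LF (g : ℤ × ℤ → PS) (hg : ∀ p, X ^ tri (p.1 - 1) ∣ g p) :
    LF (fun p : ℤ × ℤ => sg p.1 * sg p.2 * X ^ (2 * tri p.2) * g p) := by
  refine LFzz (fun p => 2 * tri p.2 + tri (p.1-1)) (fun p => ?_) 2 (fun p => ?_) (fun p => ?_)
  · rw [pow_add]
    exact mul_dvd_mul ((dvd_refl _).mul_left _) (hg p)
  · have := tri_pos_ge (p.1 - 1)
    have h2 := abs_sub_abs_le_abs_sub p.1 1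
    rw [abs_one] at h2
    push_cast; omega
  · have := tri_pos_ge p.2
    push_cast; omega

theorem S2_term (m : ℤ) : sg m * X ^ (2 * tri m) * v (2 * m) * (-X) ^ tri (m-1) = rescale (-1:ℂ) (Ap 1 1 2 m) := by
  rw [Ap]
  push_cast
  rw [map_mul, map_mul, rs_v, rs_sg, rs_Xpow]
  have e : ((-1:ℂ)) ^ (1 * tri m + 1 * sqn m) = (-1) ^ tri (m-1) := by
    have a1 := tri_sub m
    have a2 := sqn_spec m
    have h : Even ((1 * tri m + 1 * sqn m) + tri (m-1)) := by
      rw [← Int.even_coe_nat]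
      push_cast
      have : (1 * (tri m:ℤ) + 1 * sqn m) + tri (m-1) = 2 * tri (m-1) + m * (m+1) := by rw [a2]; linarith
      rw [this]
      exact (even_two_mul _).add (Int.even_mul_succ_self m)
    have h2 : ((-1:ℂ)) ^ ((1 * tri m + 1 * sqn m) + tri (m-1)) = 1 := h.neg_one_pow
    rw [pow_add] at h2
    rcases neg_one_pow_eq_or ℂ (tri (m-1)) with h3 | h3 <;> rw [h3] at h2 ⊢
    · linear_combination h2
    · linear_combination -h2
  have e2 : 1 * tri m + 1 * sqn m = 2 * tri m + tri (m-1) := by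
    zify; rw [sqn_spec]
    have a1 := tri_sub m
    have a2 := tri_spec m
    linarith
  rw [e, e2, neg_pow X (tri (m-1)), pow_add]
  simp only [map_pow, map_neg, map_one]
  ring

theorem S2_term' (m : ℤ) : sg (0 - m) * X ^ (2 * tri (0-m)) * v (2 * (0-m)) * (-X) ^ tri (0-m) =
   sg m * X ^ (2 * tri m) * v (2 * m) * (-X) ^ tri (m-1) := by
  have e : tri (0 - m) = tri (m-1) := by rw [← tri_neg]; congr 1; ring
  rw [e, zero_sub, sg_neg]
  have key : X ^ (2 * tri (m-1)) * v (2 * -m) = X ^ (2 * tri m) * v (2 * m) := by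
    apply io_inj
    rw [map_mul, map_mul, io_pow, io_pow, io_v, io_v, show 2 * -m = -(2*m) by ring, zpow_neg, fl1 (zpow_ne_zero _ xx_ne) (one_add_xx _), ← mul_assoc, ← zpow_add₀ xx_ne]
    congr 2
    have := tri_sub m
    push_cast; linarith
  linear_combination (sg m * (-X) ^ tri (m-1)) * key

theorem S2_LF (e : ℤ → ℕ) : LF (fun m : ℤ => sg m * X ^ (2 * tri m) * v (2 * m) * (-X) ^ (e m)) :=
  ((alt_LF (c := 2) (by norm_num)).mul_right _).mul_right _

theorem S2_eq : fs (fun m : ℤ => sg m * X ^ (2 * tri m) * v (2 * m) * ((-X) ^ tri (m-1) + (-X) ^ tri m)) =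
    En * rescale (-1:ℂ) (Rt 0) := by
  have h0 := congrArg (rescale (-1:ℂ)) R_0
  rw [map_mul, map_mul, map_ofNat, rs_fs _ (Ap_LF le_rfl)] at h0
  rw [En, h0]
  have h1 : fs (fun m : ℤ => sg m * X ^ (2 * tri m) * v (2 * m) * (-X) ^ tri m) = fs (fun m => rescale (-1:ℂ) (Ap 1 1 2 m)) := by
    rw [← fs_refl 0 (fun m : ℤ => sg m * X ^ (2 * tri m) * v (2 * m) * (-X) ^ tri m)]
    refine fs_congr fun m => ?_
    rw [S2_term', S2_term]
  have h2 : fs (fun m : ℤ => sg m * X ^ (2 * tri m) * v (2 * m) * (-X) ^ tri (m-1)) = fs (fun m => rescale (-1:ℂ) (Ap 1 1 2 m)) :=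
    fs_congr S2_term
  have h3 := fs_add (S2_LF (fun m => tri (m-1))) (S2_LF (fun m => tri m))
  simp only [← mul_add] at h3
  rw [h3, h1, h2]; ring

theorem F3a : - (fs (Ap 1 0 1) * fs (Ap 2 0 2)) = fs (Ap 2 0 2) * fs (Ap 1 1 1) - fs (Ap 1 0 2) * (En * rescale (-1:ℂ) (Rt 0)) := by
  have d1 : ∀ n : ℤ, (X:PS) ^ tri (n-1) ∣ X ^ tri (n-1) := fun n => dvd_rfl
  have L0 := W_LF (fun p => X ^ tri (p.1-1) * v p.1 * v (2 * p.2)) (fun p => ((d1 _).mul_right _).mul_right _)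
  have L1 := W_LF (fun p => X ^ tri (p.1-1) * v (2 * (p.2-p.1)) * v p.1) (fun p => ((d1 _).mul_right _).mul_right _)
  have LA : LF (fun n : ℤ => sg n * X ^ tri (n-1) * v n) := 
    ((psi_LF.shift (-1)).mul_left (fun n => sg n)).mul_right (fun n => v n)
  have hL : fs (fun p : ℤ × ℤ => sg p.1 * sg p.2 * X ^ (2 * tri p.2) * (X ^ tri (p.1-1) * v p.1 * v (2 * p.2))) =
      - (fs (Ap 1 0 1) * fs (Ap 2 0 2)) := by
    rw [← neg_mul, ← Y_eq, fs_mul LA (Ap_LF (by norm_num))]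
    refine fs_congr fun p => ?_
    rw [Ap]
    push_cast
    rw [zero_mul, add_zero]
    ring
  have h1 : fs (fun p : ℤ × ℤ => sg p.1 * sg p.2 * X ^ (2 * tri p.2) * (X ^ tri (p.1-1) * v (2 * (p.2-p.1)) * v p.1)) =
      fs (Ap 2 0 2) * fs (Ap 1 1 1) := by
    rw [fs_prod L1, ← fs_mul_left (Ap_LF le_rfl)]
    refine fs_congr fun n => ?_
    have : fs (fun m => sg n * sg m * X ^ (2 * tri m) * (X ^ tri (n-1) * v (2 * (m-n)) * v n)) =
      sg n * X ^ tri (n-1) * v n * fs (Jc 2 n) := by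
      rw [← fs_mul_left (Jc_LF (by norm_num) n)]
      refine fs_congr fun m => ?_
      rw [Jc]; ring
    simp only
    rw [this, J2_all, Ap]
    have e2 : 1 * tri n + 1 * sqn n = 2 * tri n + tri (n-1) := by
      zify; rw [sqn_spec]
      have a1 := tri_sub n
      have a2 := tri_spec n
      linarith
    rw [e2, pow_add]; push_cast; rw [one_mul]; ring
  have L2 := W_LF (fun p => (X ^ tri (p.1-1) - X ^ tri p.1) * v (2 * (p.1-p.2)) * v (2 * p.2))
  have hd : fs (fun p : ℤ × ℤ => sg p.1 * sg p.2 * X ^ (2 * tri p.2) * (X ^ tri (p.1-1) * v p.1 * v (2 * p.2))) =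
    fs (fun p : ℤ × ℤ => sg p.1 * sg p.2 * X ^ (2 * tri p.2) * (X ^ tri (p.1-1) * v (2 * (p.2-p.1)) * v p.1)) +
    fs (fun p : ℤ × ℤ => sg p.1 * sg p.2 * X ^ (2 * tri p.2) * ((X ^ tri (p.1-1) - X ^ tri p.1) * v (2 * (p.1-p.2)) * v (2 * p.2))) := by
    have L3 : LF (fun p : ℤ × ℤ => sg p.1 * sg p.2 * X ^ (2 * tri p.2) * ((X ^ tri (p.1-1) - X ^ tri p.1) * v (2 * (p.1-p.2)) * v (2 * p.2))) := by
      have := L0.sub L1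
      convert this using 2 with p
      linear_combination (-(sg p.1 * sg p.2 * X ^ (2 * tri p.2))) * term_eq p.1 p.2
    rw [← fs_add L1 L3]
    refine fs_congr fun p => ?_
    linear_combination ((sg p.1 * sg p.2 * X ^ (2 * tri p.2))) * term_eq p.1 p.2
  have L3 : LF (fun p : ℤ × ℤ => sg p.1 * sg p.2 * X ^ (2 * tri p.2) * ((X ^ tri (p.1-1) - X ^ tri p.1) * v (2 * (p.1-p.2)) * v (2 * p.2))) := by
    have := L0.sub L1
    convert this using 2 with p
    linear_combination (-(sg p.1 * sg p.2 * X ^ (2 * tri p.2))) * term_eq p.1 p.2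
  have h2 : fs (fun p : ℤ × ℤ => sg p.1 * sg p.2 * X ^ (2 * tri p.2) * ((X ^ tri (p.1-1) - X ^ tri p.1) * v (2 * (p.1-p.2)) * v (2 * p.2))) =
     - (fs (Ap 1 0 2) * (En * rescale (-1:ℂ) (Rt 0))) := by
    rw [fs_prod L3, fs_comm L3, ← S2_eq, ← fs_mul_left ((alt_LF (c := 2) (by norm_num)).mul_right _ |>.mul_right _), ← fs_neg]
    refine fs_congr fun m => ?_
    have L4 : LF (fun n : ℤ => sg n * (X ^ tri (n-1) - X ^ tri n) * v (2 * (n - m))) := by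
      have h := (((psi_LF.shift (-1)).sub psi_LF).mul_left (fun n => sg n)).mul_right (fun n => v (2 * (n-m)))
      exact h
    have : fs (fun n => sg n * sg m * X ^ (2 * tri m) * ((X ^ tri (n-1) - X ^ tri n) * v (2 * (n-m)) * v (2 * m))) =
      sg m * X ^ (2 * tri m) * v (2 * m) * fs (fun n : ℤ => sg n * (X ^ tri (n-1) - X ^ tri n) * v (2 * (n - m))) := by
      rw [← fs_mul_left L4]
      refine fs_congr fun n => ?_
      ring
    simp only
    rw [this, inner_eq]
    ring
  rw [← hL, hd, h1, h2]; ring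

theorem F3b : 2 * rescale (-1:ℂ) (Rt 0) = Rt (-2) + Ei X * Bi X (-2) := by
  have h := F3a
  have h1 := a0_A02
  have h2 := A0_eq
  have h3 := R_neg2
  have hE : Ei X ≠ 0 := ne_zero_of_cc (by rw [Ei_cc hX]; simp)
  have hA : fs (Ap 2 0 2) ≠ 0 := by
    intro h0
    have := A02_eq
    have h2 : (X:PS) ∣ X^2 := hXp (by norm_num)
    have hb := Bi_mul (p := X^2) (t := -2) h2
    rw [h0, mul_zero] at this
    rcases mul_eq_zero.1 this.symm with h4 | h4
    · exact ne_zero_of_cc (a := Ei (X^2)) (by rw [Ei_cc h2]; simp) (pow_eq_zero_iff (two_ne_zero) |>.1 h4)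
    · rw [h4, mul_zero] at hb; exact zero_ne_one hb
  apply mul_left_cancel₀ hE
  apply mul_left_cancel₀ hA
  linear_combination 2 * h + (-2 * rescale (-1:ℂ) (Rt 0)) * h1 + fs (Ap 2 0 2) * h2 - fs (Ap 2 0 2) * h3

theorem F3 {n : ℕ} (hn : Even n) : coeff n (Ei X * Bi X (-2)) = 2 * coeff n (Rt 0) - coeff n (Rt (-2)) := by
  have h := congrArg (coeff n) F3b
  rw [map_add, show (2:PS) = C 2 from (map_ofNat C 2).symm, coeff_C_mul, coeff_rescale, hn.neg_one_pow] at h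
  rw [show (C (2:ℂ)) = (2:PS) from map_ofNat C 2] at h
  linear_combination -h


/-! ### generating functions of partitions -/
noncomputable def PG (w : Multiset ℕ → ℂ) : PS := PowerSeries.mk fun n => ∑ p : n.Partition, w p.parts

theorem coeff_PG (w : Multiset ℕ → ℂ) (n : ℕ) : coeff n (PG w) = ∑ p : n.Partition, w p.parts := by
  rw [PG, coeff_mk]

theorem PG_congr {w w' : Multiset ℕ → ℂ} (h : ∀ s : Multiset ℕ, (∀ i ∈ s, 0 < i) → w s = w' s) : PG w = PG w' := by
  ext n
  rw [coeff_PG, coeff_PG]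
  exact Finset.sum_congr rfl fun p _ => h _ (fun i hi => p.parts_pos hi)

theorem PG_zero : PG (fun _ => 0) = 0 := by
  ext n; simp [coeff_PG]

theorem PG_smul (c : ℂ) (w : Multiset ℕ → ℂ) : PG (fun s => c * w s) = C c * PG w := by
  ext n
  rw [coeff_C_mul, coeff_PG, coeff_PG, Finset.mul_sum]

theorem PG_part (w : Multiset ℕ → ℂ) {a : ℕ} (ha : 1 ≤ a) :
    PG w = PG (fun s => if a ∈ s then 0 else w s) + X ^ a * PG (fun s => w (a ::ₘ s)) := by
  ext n
  rw [map_add, coeff_PG, coeff_PG, coeff_X_pow_mul']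
  have h1 : ∑ p : n.Partition, w p.parts = ∑ p : n.Partition, (if a ∈ p.parts then 0 else w p.parts) +
      ∑ p : n.Partition, (if a ∈ p.parts then w p.parts else 0) := by
    rw [← Finset.sum_add_distrib]
    refine Finset.sum_congr rfl fun p _ => ?_
    split_ifs <;> simp
  rw [h1]
  congr 1
  split_ifs with h
  · rw [coeff_PG, ← Finset.sum_filter]
    have e := (Nat.Partition.partitionWithPartEquiv ha h).symm.sum_comp (fun p => w (p.1.parts))
    simp only [Nat.Partition.partitionWithPartEquiv_symm_apply_parts] at e
    rw [e]
    exact Finset.sum_subtype _ (by simp) _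
  · refine Finset.sum_eq_zero fun p _ => ?_
    rw [if_neg]
    intro hp
    exact h (Nat.Partition.le_of_mem_parts hp)

noncomputable def mw (c : ℕ → ℂ) (s : Multiset ℕ) : ℂ := (s.map c).prod

theorem mw_zero (c : ℕ → ℂ) : mw c 0 = 1 := by simp [mw]
theorem mw_cons (c : ℕ → ℂ) (a : ℕ) (s : Multiset ℕ) : mw c (a ::ₘ s) = c a * mw c s := by simp [mw]
theorem mw_eq_zero {c : ℕ → ℂ} {s : Multiset ℕ} {a : ℕ} (h : a ∈ s) (hc : c a = 0) : mw c s = 0 := by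
  rw [mw, Multiset.prod_eq_zero_iff]
  exact Multiset.mem_map.2 ⟨a, h, hc⟩
theorem mw_congr {c c' : ℕ → ℂ} {s : Multiset ℕ} (h : ∀ i ∈ s, c i = c' i) : mw c s = mw c' s := by
  rw [mw, mw, Multiset.map_congr rfl h]

theorem mw_step (c : ℕ → ℂ) {a : ℕ} (ha : 1 ≤ a) :
    (1 - C (c a) * X ^ a) * PG (mw c) = PG (mw (fun i => if i = a then 0 else c i)) := by
  have h := PG_part (mw c) ha
  have h2 : PG (fun s => mw c (a ::ₘ s)) = C (c a) * PG (mw c) := by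
    rw [← PG_smul]
    exact PG_congr fun s _ => mw_cons c a s
  have h3 : PG (fun s => if a ∈ s then 0 else mw c s) = PG (mw (fun i => if i = a then 0 else c i)) := by
    refine PG_congr fun s _ => ?_
    split_ifs with h
    · exact (mw_eq_zero h (by simp)).symm
    · refine mw_congr fun i hi => ?_
      rw [if_neg]; rintro rfl; exact h hi
  rw [h2, h3] at h
  linear_combination h

theorem PG_cc (c : ℕ → ℂ) : coeff 0 (PG (mw c)) = 1 := by
  rw [coeff_PG]
  have : ∀ p : Nat.Partition 0, mw c p.parts = 1 := by
    intro p; rw [Nat.Partition.partition_zero_parts, mw_zero]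
  rw [Finset.sum_congr rfl (fun p _ => this p)]; simp

theorem PG_dvd (c : ℕ → ℂ) (N : ℕ) (h : ∀ i, 1 ≤ i → i < N → c i = 0) : X ^ N ∣ PG (mw c) - 1 := by
  rw [X_pow_dvd_iff]
  intro m hm
  rw [map_sub]
  rcases Nat.eq_zero_or_pos m with h0 | h0
  · subst h0; rw [PG_cc]; simp
  · rw [coeff_one, if_neg (by omega), sub_zero, coeff_PG]
    refine Finset.sum_eq_zero fun p _ => ?_
    have hne : p.parts ≠ 0 := by
      intro h
      have := p.parts_sum
      rw [h] at this; simp at this; omega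
    obtain ⟨i, hi⟩ := Multiset.exists_mem_of_ne_zero hne
    exact mw_eq_zero hi (h i (p.parts_pos hi) (lt_of_le_of_lt (Nat.Partition.le_of_mem_parts hi) hm))

theorem mw_adm (c : ℕ → ℂ) : Adm (fun i => 1 - C (c (i+1)) * X ^ (i+1)) := by
  intro i
  have : (1 - C (c (i+1)) * X ^ (i+1) : PS) - 1 = X ^ i * (-C (c (i+1)) * X) := by ring
  rw [this]
  exact dvd_mul_right _ _

theorem mw_prod (c : ℕ → ℂ) (N : ℕ) : (∏ i ∈ Finset.range N, (1 - C (c (i+1)) * X ^ (i+1))) * PG (mw c) =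
    PG (mw (fun i => if i ≤ N then 0 else c i)) := by
  induction N with
  | zero =>
    rw [Finset.prod_range_zero, one_mul]
    refine PG_congr fun s hs => mw_congr fun i hi => ?_
    rw [if_neg]; have := hs i hi; omega
  | succ N ih =>
    have h := mw_step (fun i => if i ≤ N then 0 else c i) (a := N+1) (by omega)
    rw [if_neg (by omega)] at h
    rw [Finset.prod_range_succ, mul_right_comm, ih, mul_comm, h]
    congr 2
    funext i
    split_ifs <;> first | rfl | omega

theorem PG_mw (c : ℕ → ℂ) : ip (fun i => 1 - C (c (i+1)) * X ^ (i+1)) * PG (mw c) = 1 := by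
  refine eq_of_dvd fun N => ?_
  have h1 := (ip_dvd (mw_adm c) (le_refl N)).mul_right (PG (mw c))
  rw [sub_mul, mw_prod] at h1
  have h2 := PG_dvd (fun i => if i ≤ N then 0 else c i) N (fun i _ hi => by simp only [if_pos hi.le])
  have := dvd_add h1 h2
  simpa using this

theorem PG_fiber_LF (φ : Multiset ℕ → ℕ) (w : Multiset ℕ → ℂ) : LF (fun N => PG (fun s => if φ s = N then w s else 0)) := by
  intro d
  refine (Set.finite_range (fun p : d.Partition => φ p.parts)).subset ?_
  intro N hN
  simp only [Function.mem_support, coeff_PG] at hN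
  obtain ⟨p, _, hp⟩ := Finset.exists_ne_zero_of_sum_ne_zero hN
  refine ⟨p, ?_⟩
  by_contra h
  exact hp (if_neg h)

theorem PG_fiber (φ : Multiset ℕ → ℕ) (w : Multiset ℕ → ℂ) : PG w = fs (fun N => PG (fun s => if φ s = N then w s else 0)) := by
  ext d
  rw [coeff_fs]
  simp only [coeff_PG]
  rw [finsum_sum_comm]
  · refine Finset.sum_congr rfl fun p _ => ?_
    rw [finsum_eq_single _ (φ p.parts)]
    · simp
    · intro N hN; rw [if_neg (Ne.symm hN)]
  · intro p _
    refine (Set.finite_singleton (φ p.parts)).subset ?_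
    intro N hN
    simp only [Function.mem_support] at hN
    by_contra h
    exact hN (if_neg (fun h2 => h h2.symm))

/-- partitions with largest part N -/
theorem PG_sup (w : Multiset ℕ → ℂ) (N : ℕ) :
    PG (fun s => if s.sup = N + 1 then w s else 0) = X ^ (N+1) * PG (fun s => if s.sup ≤ N + 1 then w ((N+1) ::ₘ s) else 0) := by
  rw [PG_part _ (show 1 ≤ N + 1 by omega)]
  have : PG (fun s => if N + 1 ∈ s then 0 else if s.sup = N + 1 then w s else 0) = 0 := by
    rw [← PG_zero]
    refine PG_congr fun s hs => ?_
    split_ifs with h1 h2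
    · rfl
    · exfalso
      have h3 : s.sup ≤ N := by
        rw [Multiset.sup_le]
        intro b hb
        have h4 := Multiset.le_sup hb
        have : b ≠ N + 1 := by rintro rfl; exact h1 hb
        omega
      omega
    · rfl
  rw [this, zero_add]
  congr 2
  funext s
  rw [Multiset.sup_cons]
  congr 1
  simp

theorem PG_sup_zero (w : Multiset ℕ → ℂ) (h : w 0 = 1) : PG (fun s => if s.sup = 0 then w s else 0) = 1 := by
  ext n
  rw [coeff_PG, coeff_one]
  split_ifs with h0
  · subst h0
    have : ∀ p : Nat.Partition 0, (if p.parts.sup = 0 then w p.parts else 0) = 1 := by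
      intro p; rw [Nat.Partition.partition_zero_parts]; simp [h]
    rw [Finset.sum_congr rfl (fun p _ => this p)]; simp
  · refine Finset.sum_eq_zero fun p _ => ?_
    rw [if_neg]
    intro hs
    have hne : p.parts ≠ 0 := by
      intro h
      have := p.parts_sum
      rw [h] at this; simp at this; omega
    obtain ⟨i, hi⟩ := Multiset.exists_mem_of_ne_zero hne
    have h1 := Multiset.le_sup hi
    have := p.parts_pos hi
    omega

theorem mw_restrict (c : ℕ → ℂ) (N : ℕ) (s : Multiset ℕ) : (if s.sup ≤ N then mw c s else 0) = mw (fun i => if i ≤ N then c i else 0) s := by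
  split_ifs with h
  · refine mw_congr fun i hi => ?_
    rw [if_pos]
    exact (Multiset.le_sup hi).trans h
  · rw [Multiset.sup_le] at h
    push Not at h
    obtain ⟨b, hb, hN⟩ := h
    exact (mw_eq_zero hb (if_neg (by omega))).symm

theorem PG_restrict (c : ℕ → ℂ) (N : ℕ) : (∏ i ∈ Finset.range N, (1 - C (c (i+1)) * X ^ (i+1))) * PG (mw (fun i => if i ≤ N then c i else 0)) = 1 := by
  have h := mw_prod (fun i => if i ≤ N then c i else 0) N
  have h2 : ∏ i ∈ Finset.range N, (1 - C ((fun i => if i ≤ N then c i else 0) (i+1)) * (X:PS) ^ (i+1)) = 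
     ∏ i ∈ Finset.range N, (1 - C (c (i+1)) * X ^ (i+1)) := by
    refine Finset.prod_congr rfl fun i hi => ?_
    rw [Finset.mem_range] at hi
    simp only [if_pos (show i + 1 ≤ N by omega)]
  rw [h2] at h
  rw [h]
  have h3 : (mw fun i => if i ≤ N then 0 else (fun i => if i ≤ N then c i else 0) i) = mw (fun _ => 0) := by
    congr 1; funext i; simp only; split_ifs <;> rfl
  rw [h3]
  refine eq_of_dvd fun M => ?_
  exact PG_dvd _ M (fun _ _ _ => rfl)


theorem fs_partial {f : ℕ → PS} (hf : LF f) (M : ℕ) : fs f = ∑ m ∈ Finset.range M, f m + fs (fun m => f (m + M)) := by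
  induction M with
  | zero => simp
  | succ M ih =>
    have L : LF (fun m => f (m + M)) := hf.comp (g := fun m => m + M) (by intro a b h; simpa using h)
    rw [ih, fs_nat L, Finset.sum_range_succ, zero_add, add_assoc]
    congr 3
    funext m
    congr 1; ring

/-! ### rank generating function -/
theorem one_sub_cc (Y : PS) (k : ℕ) : constantCoeff (1 - Y * X ^ (k+1) : PS) ≠ 0 := by simp

theorem one_sub_inv (Y : PS) (k : ℕ) : (1 - Y * X ^ (k+1)) * (1 - Y * X ^ (k+1))⁻¹ = (1:PS) :=
  PowerSeries.mul_inv_cancel _ (one_sub_cc Y k)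

noncomputable def Qj (Y : PS) (j N : ℕ) : PS := ∏ i ∈ Finset.range N, (1 - Y * X ^ (j + i + 1))⁻¹

theorem Qj_zero (Y : PS) (j : ℕ) : Qj Y j 0 = 1 := by simp [Qj]
theorem Qj_succ (Y : PS) (j N : ℕ) : Qj Y j (N+1) = Qj Y j N * (1 - Y * X ^ (j + N + 1))⁻¹ := by
  rw [Qj, Qj, Finset.prod_range_succ]
theorem Qj_succ' (Y : PS) (j N : ℕ) : Qj Y j (N+1) = (1 - Y * X ^ (j + 1))⁻¹ * Qj Y (j+1) N := by
  rw [Qj, Qj, Finset.prod_range_succ', mul_comm]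
  congr 1
  refine Finset.prod_congr rfl fun i _ => ?_
  rw [show j + (i+1) + 1 = j + 1 + i + 1 by ring]

noncomputable def Phi (Z Y : PS) (j : ℕ) : PS := fs (fun N => (Z * X ^ (j+1)) ^ N * Qj Y (j+1) N)

theorem ZX_dvd (Z : PS) (j : ℕ) : X ∣ Z * X ^ (j+1) := (dvd_pow_self _ (by omega)).mul_left _

theorem Phi_LF (Z Y : PS) (j : ℕ) : LF (fun N => (Z * X ^ (j+1)) ^ N * Qj Y (j+1) N) :=
  LF.of_p (ZX_dvd Z j) (fun N => N) (fun N => le_rfl) _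

theorem Phi_rec {Z Y : PS} (h : Z * Y = 1) (j : ℕ) :
    (1 - Z * X ^ (j+1)) * Phi Z Y j = 1 + X ^ (2 * j + 3) * ((1 - Y * X ^ (j+2))⁻¹ * Phi Z Y (j+1)) := by
  have L := Phi_LF Z Y j
  have L2 := Phi_LF Z Y (j+1)
  have Ls : LF (fun N => (Z * X ^ (j+1)) ^ (N+1) * Qj Y (j+1) (N+1)) := L.comp (g := fun N => N+1) (by intro a b h; simpa using h)
  have h1 := fs_nat L
  rw [← Phi] at h1
  rw [pow_zero, one_mul, Qj_zero] at h1
  have h2 : fs (fun N => (Z * X ^ (j+1)) ^ (N+1) * Qj Y (j+1) (N+1)) - Z * X ^ (j+1) * Phi Z Y j =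
     X ^ (2 * j + 3) * ((1 - Y * X ^ (j+2))⁻¹ * Phi Z Y (j+1)) := by
    rw [Phi, Phi, ← fs_mul_left L, ← fs_sub Ls (L.mul_left _), ← fs_mul_left L2, ← fs_mul_left (L2.mul_left _)]
    refine fs_congr fun N => ?_
    have a1 := Qj_succ Y (j+1) N
    have a2 := Qj_succ' Y (j+1) N
    have a3 := one_sub_inv Y (j + 1 + N)
    have a4 : Qj Y (j+1) N = (1 - Y * X ^ (j+1+N+1)) * Qj Y (j+1) (N+1) := by
      rw [a1]; linear_combination -Qj Y (j+1) N * a3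
    rw [show j + 1 + 1 = j + 2 by ring] at a2 ⊢
    have e : (Z * X ^ (j+1)) ^ (N+1) * Qj Y (j+1) (N+1) - Z * X ^ (j+1) * ((Z * X ^ (j+1)) ^ N * Qj Y (j+1) N) =
      (Z * X ^ (j+1)) ^ (N+1) * (Y * X ^ (j+1+N+1)) * Qj Y (j+1) (N+1) := by
      rw [a4]; ring
    rw [e, a2]
    have e2 : (Z * X ^ (j+1)) ^ (N+1) * (Y * X ^ (j+1+N+1)) = X ^ (2 * j + 3) * (Z * X ^ (j+2)) ^ N := by
      have : (Z * X ^ (j+1)) ^ (N+1) * (Y * X ^ (j+1+N+1)) = (Z * Y) * (X ^ (2 * j + 3) * (Z * X ^ (j+2)) ^ N) := by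
        rw [pow_succ, mul_pow, mul_pow]
        ring
      rw [this, h, one_mul]
    rw [e2]; ring
  linear_combination h1 + h2

noncomputable def Psi (Z Y : PS) (j : ℕ) : PS := (1 - Y * X ^ (j+1))⁻¹ * Phi Z Y j

theorem Psi_rec {Z Y : PS} (h : Z * Y = 1) (j : ℕ) :
    quad X (Z + Y) (j+1) * Psi Z Y j = 1 + X ^ (2 * j + 3) * Psi Z Y (j+1) := by
  rw [Psi, Psi]
  have h1 := Phi_rec h j
  have h2 := one_sub_inv Y j
  have e : quad X (Z + Y) (j+1) = (1 - Z * X ^ (j+1)) * (1 - Y * X ^ (j+1)) := by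
    rw [quad]
    linear_combination -X ^ (2 * (j+1)) * h
  rw [e]
  linear_combination h1 + ((1 - Z * X ^ (j+1)) * Phi Z Y j) * h2

theorem rank_partial {Z Y : PS} (h : Z * Y = 1) (M : ℕ) :
    1 + X * Psi Z Y 0 = ∑ m ∈ Finset.range (M+1), X ^ (m^2) * be X (Z+Y) m + X ^ ((M+1)^2) * (be X (Z+Y) M * Psi Z Y M) := by
  induction M with
  | zero => simp [be]
  | succ M ih =>
    rw [ih, Finset.sum_range_succ _ (M+1)]
    have h1 := Psi_rec h M
    have h2 := be_succ (p := X) (t := Z + Y) hX M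
    have : be X (Z+Y) M * Psi Z Y M = be X (Z+Y) (M+1) * (1 + X ^ (2 * M + 3) * Psi Z Y (M+1)) := by
      rw [← h1, ← h2]; ring
    rw [this, show (M+1+1)^2 = (M+1)^2 + (2 * M + 3) by ring, pow_add]
    ring

theorem rank_Rt {Z Y : PS} (h : Z * Y = 1) : 1 + X * Psi Z Y 0 = Rt (Z + Y) := by
  refine eq_of_dvd fun N => ?_
  have L : LF (fun m : ℕ => X ^ (m^2) * be X (Z+Y) m) := LF.of_p hX (fun m => m^2) (fun m => by nlinarith) _
  rw [rank_partial h N, Rt, fs_partial L (N+1)]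
  have h1 : X ^ N ∣ X ^ ((N+1)^2) * (be X (Z+Y) N * Psi Z Y N) := (pow_dvd_pow _ (by nlinarith)).mul_right _
  have h2 : X ^ N ∣ fs (fun m => X ^ ((m + (N+1))^2) * be X (Z+Y) (m + (N+1))) :=
    dvd_fs fun m => (pow_dvd_pow _ (by have := Nat.le_self_pow two_ne_zero (m+(N+1)); omega)).mul_right _
  have := dvd_sub h1 h2
  convert this using 1
  ring

theorem rank_gf {z y : ℂ} (h : z * y = 1) : PG (fun s => z ^ s.sup * mw (fun _ => y) s) = Rt (C z + C y) := by
  have hC : (C z : PS) * C y = 1 := by rw [← map_mul, h, map_one]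
  rw [← rank_Rt hC, PG_fiber (fun s => s.sup), fs_nat (PG_fiber_LF _ _), PG_sup_zero _ (by simp [mw_zero])]
  congr 1
  rw [Psi, Phi, ← fs_mul_left (Phi_LF _ _ _), ← fs_mul_left ((Phi_LF _ _ _).mul_left _)]
  refine fs_congr fun N => ?_
  have h1 : PG (fun s => if s.sup = N + 1 then z ^ s.sup * mw (fun _ => y) s else 0) =
     C (z ^ (N+1)) * PG (fun s => if s.sup = N + 1 then mw (fun _ => y) s else 0) := by
    rw [← PG_smul]
    refine PG_congr fun s _ => ?_
    split_ifs with h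
    · rw [h]
    · simp
  rw [h1, PG_sup]
  have h2 : PG (fun s => if s.sup ≤ N + 1 then mw (fun _ => y) ((N+1) ::ₘ s) else 0) =
     C y * PG (mw (fun i => if i ≤ N + 1 then y else 0)) := by
    rw [← PG_smul]
    refine PG_congr fun s _ => ?_
    rw [← mw_restrict (fun _ => y)]
    split_ifs with h
    · rw [mw_cons]
    · simp
  have h3 : PG (mw (fun i => if i ≤ N + 1 then y else 0)) = Qj (C y) 0 (N+1) := by
    have h4 := PG_restrict (fun _ => y) (N+1)
    have h5 : (∏ i ∈ Finset.range (N+1), (1 - C y * X ^ (i+1))) * Qj (C y) 0 (N+1) = 1 := by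
      rw [Qj, ← Finset.prod_mul_distrib]
      refine Finset.prod_eq_one fun i _ => ?_
      rw [zero_add]; exact one_sub_inv _ _
    have h6 : (∏ i ∈ Finset.range (N+1), (1 - C y * (X:PS) ^ (i+1))) ≠ 0 := by
      intro h; rw [h, zero_mul] at h5; exact zero_ne_one h5
    apply mul_left_cancel₀ h6
    rw [h4, h5]
  rw [h2, h3, Qj_succ', pow_succ, map_mul, map_pow]
  have e : (C z ^ N * C z * (X ^ (N+1) * (C y * ((1 - C y * X ^ (0+1))⁻¹ * Qj (C y) (0+1) N))) : PS) =
    (C z * C y) * (X * ((1 - C y * X ^ (0+1))⁻¹ * ((C z * X ^ (0+1))^N * Qj (C y) (0+1) N))) := by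
    rw [zero_add]; ring
  rw [e, hC, one_mul]


/-! ### crank generating function -/
theorem telescope {f f' g : ℕ → PS} {L : PS} (hf : Adm f) (hf' : Adm f') (h : ∀ j, f j * g j = f' j * g (j+1))
    (hg : ∀ j, X ^ j ∣ g j - L) : ip f * g 0 = ip f' * L := by
  have hp : ∀ N, (∏ i ∈ Finset.range N, f i) * g 0 = (∏ i ∈ Finset.range N, f' i) * g N := by
    intro N
    induction N with
    | zero => simp
    | succ N ih =>
      rw [Finset.prod_range_succ, Finset.prod_range_succ]
      linear_combination f N * ih + (∏ i ∈ Finset.range N, f' i) * h N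
  refine eq_of_dvd fun N => ?_
  have h1 := (ip_dvd hf (le_refl N)).mul_right (g 0)
  have h2 := (ip_dvd hf' (le_refl N)).mul_right L
  have h3 := (hg N).mul_left (∏ i ∈ Finset.range N, f' i)
  have h4 := dvd_sub (dvd_add h1 h3) h2
  have e : ip f * g 0 - ip f' * L = (ip f - ∏ i ∈ Finset.range N, f i) * g 0 + (∏ i ∈ Finset.range N, f' i) * (g N - L)
     - (ip f' - ∏ i ∈ Finset.range N, f' i) * L := by
    linear_combination hp N
  rw [e]; exact h4

noncomputable def uN (N : ℕ) : PS := PG (mw (fun i => if i ≤ N then 1 else 0))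

theorem uN_succ (N : ℕ) : (1 - X ^ (N+1)) * uN (N+1) = uN N := by
  have h := mw_step (fun i => if i ≤ N + 1 then (1:ℂ) else 0) (a := N+1) (by omega)
  rw [if_pos le_rfl, map_one, one_mul] at h
  rw [uN, h, uN]
  congr 2; funext i
  split_ifs <;> first | rfl | omega

theorem uN_zero : uN 0 = 1 := by
  refine eq_of_dvd fun M => ?_
  exact PG_dvd _ M (fun i hi _ => if_neg (by omega))

noncomputable def Vk (z : ℂ) (k : ℕ) : PS := PG (mw (fun i => if k < i then z else 1))

theorem Vk_succ (z : ℂ) (k : ℕ) : (1 - X ^ (k+1)) * Vk z (k+1) = (1 - C z * X ^ (k+1)) * Vk z k := by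
  have h := mw_step (fun i => if k + 1 < i then z else 1) (a := k+1) (by omega)
  have h2 := mw_step (fun i => if k < i then z else 1) (a := k+1) (by omega)
  rw [if_neg (by omega), map_one, one_mul] at h
  rw [if_pos (by omega)] at h2
  rw [Vk, h, Vk, h2]
  congr 2; funext i
  split_ifs <;> first | rfl | omega

theorem Vk_zero (z : ℂ) : ip (fun i => 1 - C z * X ^ (i+1)) * Vk z 0 = 1 := by
  have h := PG_mw (fun _ => z)
  have h2 : Vk z 0 = PG (mw (fun _ => z)) := by
    refine PG_congr fun s hs => mw_congr fun i hi => ?_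
    rw [if_pos (hs i hi)]
  rw [h2]; exact h

theorem adm_C (c : PS) : Adm (fun i => 1 - c * X ^ (i+1)) := by
  intro i
  have : (1 - c * X ^ (i+1) : PS) - 1 = X ^ i * (-c * X) := by ring
  rw [this]
  exact dvd_mul_right _ _

noncomputable def gs (y : PS) (u : ℕ → PS) (j : ℕ) : PS := fs (fun k => (y * X ^ (j+1)) ^ k * u k)

theorem gs_LF (y : PS) (u : ℕ → PS) (j : ℕ) : LF (fun k => (y * X ^ (j+1)) ^ k * u k) :=
  LF.of_p (ZX_dvd y j) (fun N => N) (fun N => le_rfl) _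

theorem gs_dvd (y : PS) (u : ℕ → PS) (j : ℕ) : X ^ j ∣ gs y u j - u 0 := by
  rw [gs, fs_nat (gs_LF y u j), pow_zero, one_mul, add_sub_cancel_left]
  refine dvd_fs fun k => ?_
  have : (y * X ^ (j+1)) ^ (k+1) * u (k+1) = X ^ j * (X * y * (y * X ^ (j+1)) ^ k * u (k+1)) := by ring
  rw [this]; exact dvd_mul_right _ _

theorem gs_diff (y : PS) (u w : ℕ → PS) (h : ∀ k, (1 - X ^ (k+1)) * u (k+1) = w k) (j : ℕ) :
    gs y u j - gs y u (j+1) = y * X ^ (j+1) * gs y w j := by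
  have L := (gs_LF y u j).sub (gs_LF y u (j+1))
  rw [gs, gs, ← fs_sub (gs_LF y u j) (gs_LF y u (j+1)), fs_nat L, gs, ← fs_mul_left (gs_LF _ _ _)]
  have e0 : (y * X ^ (j+1)) ^ 0 * u 0 - (y * X ^ (j+1+1)) ^ 0 * u 0 = 0 := by simp
  rw [e0, zero_add]
  refine fs_congr fun k => ?_
  rw [← h]
  have : (y * X ^ (j+1+1)) ^ (k+1) = (y * X ^ (j+1)) ^ (k+1) * X ^ (k+1) := by
    rw [← mul_pow]; ring
  rw [this]; ring

theorem euler_V (z : ℂ) : gs (C z) uN 0 = Vk z 0 := by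
  have h : ip (fun i => 1 - C z * X ^ (i+1)) * gs (C z) uN 0 = ip (fun i => 1 - (0:PS) * X ^ (i+1)) * uN 0 := by
    refine telescope (adm_C _) (adm_C _) (fun j => ?_) (fun j => gs_dvd _ _ j)
    have h1 := gs_diff (C z) uN uN uN_succ j
    linear_combination h1
  have h2 : ip (fun i => 1 - (0:PS) * X ^ (i+1)) = 1 := by
    symm
    refine ip_unique (adm_C _) fun N => ⟨N, le_rfl, ?_⟩
    simp
  rw [h2, uN_zero, mul_one] at h
  have h3 := Vk_zero z
  have h4 : ip (fun i => 1 - C z * X ^ (i+1)) ≠ (0:PS) := by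
    intro h0; rw [h0, zero_mul] at h3; exact zero_ne_one h3
  apply mul_left_cancel₀ h4
  rw [h, h3]

theorem qbin {z y : ℂ} (h : z * y = 1) : (1 - X) * gs (C y) (Vk z) 0 = Ei X * Bi X (C z + C y) := by
  have hC : (C z : PS) * C y = 1 := by rw [← map_mul, h, map_one]
  have h1 : ip (fun i => 1 - C y * X ^ (i+1)) * gs (C y) (Vk z) 0 = ip (fun i => 1 - X ^ (i+1+1)) * Vk z 0 := by
    refine telescope (adm_C _) (adm_one_sub hX).shift (fun j => ?_) (fun j => gs_dvd _ _ j)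
    have h1 := gs_diff (C y) (Vk z) (fun k => (1 - C z * X ^ (k+1)) * Vk z k) (Vk_succ z) j
    have h2 : gs (C y) (fun k => (1 - C z * X ^ (k+1)) * Vk z k) j = gs (C y) (Vk z) j - C z * X * gs (C y) (Vk z) (j+1) := by
      rw [gs, gs, gs, ← fs_mul_left (gs_LF _ _ _), ← fs_sub (gs_LF _ _ _) ((gs_LF _ _ _).mul_left _)]
      refine fs_congr fun k => ?_
      have : (C y * X ^ (j+1+1) : PS) ^ k = (C y * X ^ (j+1)) ^ k * X ^ k := by
        rw [← mul_pow]; ring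
      rw [this]; ring
    rw [h2] at h1
    linear_combination h1 + (-X ^ (j+2) * gs (C y) (Vk z) (j+1)) * hC
  have h2 := ip_shift (adm_one_sub (p := X) hX)
  rw [← Ei] at h2
  have h3 := Vk_zero z
  have h4 := Bi_mul (p := X) (t := C z + C y) hX
  have h5 : ip (fun k => quad X (C z + C y) (k+1)) = ip (fun i => 1 - C z * X ^ (i+1)) * ip (fun i => 1 - C y * X ^ (i+1)) := by
    rw [← ip_mul (adm_C _) (adm_C _)]
    congr 1; funext i
    rw [quad]
    linear_combination -X ^ (2 * (i+1)) * hC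
  have h6 : ip (fun k => quad X (C z + C y) (k+1)) ≠ 0 := by
    intro h0; rw [h0, zero_mul] at h4; exact zero_ne_one h4
  apply mul_left_cancel₀ h6
  have e1 : ip (fun k => quad X (C z + C y) (k+1)) * (Ei X * Bi X (C z + C y)) = Ei X := by
    linear_combination Ei X * h4
  rw [e1, h2, h5]
  simp only [zero_add, pow_one]
  linear_combination ((1 - X) * ip (fun i => 1 - C z * X ^ (i+1))) * h1 + ((1 - X) * ip (fun i => 1 - (X:PS) ^ (i+1+1))) * h3

/-- weights with a given number of ones -/
theorem PG_count (w : Multiset ℕ → ℂ) (hw : ∀ s, w (1 ::ₘ s) = w s) (k : ℕ) :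
    PG (fun s => if s.count 1 = k then w s else 0) = X ^ k * PG (fun s => if 1 ∈ s then 0 else w s) := by
  induction k with
  | zero =>
    rw [pow_zero, one_mul]
    refine PG_congr fun s _ => ?_
    by_cases h : 1 ∈ s
    · rw [if_pos h, if_neg]; rw [Multiset.count_eq_zero]; simpa using h
    · rw [if_neg h, if_pos]; rwa [Multiset.count_eq_zero]
  | succ k ih =>
    rw [PG_part _ (le_refl 1)]
    have : PG (fun s => if 1 ∈ s then 0 else if s.count 1 = k + 1 then w s else 0) = 0 := by
      rw [← PG_zero]
      refine PG_congr fun s hs => ?_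
      split_ifs with h1 h2
      · rfl
      · exfalso
        rw [← Multiset.count_eq_zero] at h1; omega
      · rfl
    rw [this, zero_add, pow_one, pow_succ', mul_assoc, ← ih]
    congr 2
    funext s
    rw [hw, Multiset.count_cons_self]
    simp

noncomputable def cw (z y : ℂ) (s : Multiset ℕ) : ℂ :=
  if s.count 1 = 0 then z ^ s.sup else z ^ (s.filter (fun x => s.count 1 < x)).card * y ^ s.count 1

theorem mw_filter (z : ℂ) (k : ℕ) (s : Multiset ℕ) : z ^ (s.filter (fun x => k < x)).card = mw (fun i => if k < i then z else 1) s := by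
  induction s using Multiset.induction_on with
  | empty => simp [mw_zero]
  | cons a s ih =>
    rw [mw_cons, ← ih, Multiset.filter_cons]
    split_ifs with h
    · simp [pow_succ']
    · simp

theorem mw_noone (c : ℕ → ℂ) : PG (fun s => if 1 ∈ s then 0 else mw c s) = PG (mw (fun i => if i = 1 then 0 else c i)) := by
  refine PG_congr fun s _ => ?_
  split_ifs with h
  · exact (mw_eq_zero h (by simp)).symm
  · refine mw_congr fun i hi => ?_
    rw [if_neg]; rintro rfl; exact h hi

theorem crank_pos (z y : ℂ) (k : ℕ) : PG (fun s => if s.count 1 = k + 1 then cw z y s else 0) =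
    (1 - X) * ((C y * X ^ (0+1)) ^ (k+1) * Vk z (k+1)) := by
  have h1 : PG (fun s => if s.count 1 = k + 1 then cw z y s else 0) =
     C (y ^ (k+1)) * PG (fun s => if s.count 1 = k + 1 then mw (fun i => if k + 1 < i then z else 1) s else 0) := by
    rw [← PG_smul]
    refine PG_congr fun s _ => ?_
    split_ifs with h
    · rw [cw, h, if_neg (by omega), mw_filter, mul_comm]
    · simp
  rw [h1, PG_count _ (fun s => by rw [mw_cons, if_neg (by omega), one_mul]), mw_noone]
  have h2 := mw_step (fun i => if k + 1 < i then z else 1) (le_refl 1)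
  rw [if_neg (by omega), map_one, one_mul, pow_one] at h2
  rw [← h2, ← Vk, map_pow, zero_add]
  ring

theorem crank_zero (z y : ℂ) : PG (fun s => if s.count 1 = 0 then cw z y s else 0) =
    (X - C z * X) + (1 - X) * gs (C z) uN 0 := by
  have h1 : PG (fun s => if s.count 1 = 0 then cw z y s else 0) = PG (fun s => if 1 ∈ s then 0 else z ^ s.sup) := by
    refine PG_congr fun s _ => ?_
    by_cases h : 1 ∈ s
    · rw [if_pos h, if_neg]; rw [Multiset.count_eq_zero]; simpa using h
    · have h2 : s.count 1 = 0 := by rwa [Multiset.count_eq_zero]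
      rw [if_neg h, if_pos h2, cw, if_pos h2]
  have L := gs_LF (C z) uN 0
  have L1 : LF (fun k => (C z * X ^ (0+1)) ^ (k+1) * uN (k+1)) := L.comp (g := fun N => N+1) (by intro a b h; simpa using h)
  have L2 : LF (fun k => (C z * X ^ (0+1)) ^ (k+1+1) * uN (k+1+1)) := L1.comp (g := fun N => N+1) (by intro a b h; simpa using h)
  have F := PG_fiber_LF (fun s => s.sup) (fun s => if 1 ∈ s then 0 else z ^ s.sup)
  have F1 := F.comp (g := fun N => N+1) (by intro a b h; simpa using h)
  rw [h1, gs, fs_nat L, fs_nat L1, PG_fiber (fun s => s.sup), fs_nat F, fs_nat F1, PG_sup_zero _ (by simp)]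
  have h2 : PG (fun s => if s.sup = 0 + 1 then (if 1 ∈ s then 0 else z ^ s.sup) else 0) = 0 := by
    rw [PG_sup, ← PG_zero]
    simp only [zero_add, Multiset.mem_cons, true_or, if_true, ite_self]
    rw [PG_zero, mul_zero]
  have h3 : ∀ N, PG (fun s => if s.sup = N + 1 + 1 then (if 1 ∈ s then 0 else z ^ s.sup) else 0) =
     (1 - X) * ((C z * X ^ (0+1)) ^ (N+1+1) * uN (N+1+1)) := by
    intro N
    have a1 : PG (fun s => if s.sup = N + 1 + 1 then (if 1 ∈ s then 0 else z ^ s.sup) else 0) =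
      C (z ^ (N+1+1)) * PG (fun s => if s.sup = N + 1 + 1 then (if 1 ∈ s then 0 else 1) else 0) := by
      rw [← PG_smul]
      refine PG_congr fun s _ => ?_
      split_ifs with h h2
      · simp
      · rw [h]; simp
      · simp
    have a2 : PG (fun s => if s.sup ≤ N + 1 + 1 then (if 1 ∈ (N+1+1) ::ₘ s then 0 else 1) else 0) =
       PG (fun s => if 1 ∈ s then 0 else mw (fun i => if i ≤ N + 1 + 1 then 1 else 0) s) := by
      refine PG_congr fun s _ => ?_
      rw [← mw_restrict (fun _ => 1)]
      have : mw (fun _ => 1) s = 1 := by simp [mw]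
      rw [this]
      have : (1 ∈ (N+1+1) ::ₘ s) ↔ 1 ∈ s := by
        rw [Multiset.mem_cons]
        constructor
        · rintro (h | h)
          · omega
          · exact h
        · exact Or.inr
      simp only [this]
      split_ifs <;> rfl
    have h2 := mw_step (fun i => if i ≤ N + 1 + 1 then 1 else 0) (le_refl 1)
    rw [if_pos (by omega), map_one, one_mul, pow_one] at h2
    rw [a1, PG_sup, a2, mw_noone, ← h2, ← uN, map_pow, zero_add]
    ring
  have h5 : fs (fun n => PG (fun s => if s.sup = n + 1 + 1 then (if 1 ∈ s then 0 else z ^ s.sup) else 0)) =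
     (1 - X) * fs (fun N => (C z * X ^ (0+1)) ^ (N+1+1) * uN (N+1+1)) := by
    rw [← fs_mul_left L2]
    exact fs_congr h3
  rw [h2]
  rw [h5]
  have h6 := uN_succ 0
  rw [uN_zero] at h6 ⊢
  simp only [zero_add, pow_one, pow_zero] at h6 ⊢
  linear_combination -C z * X * h6

theorem crank_gf {z y : ℂ} (h : z * y = 1) : PG (cw z y) = (X - C z * X) + Ei X * Bi X (C z + C y) := by
  have L := gs_LF (C y) (Vk z) 0
  have L1 : LF (fun k => (C y * X ^ (0+1)) ^ (k+1) * Vk z (k+1)) := L.comp (g := fun N => N+1) (by intro a b h; simpa using h)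
  rw [← qbin h, PG_fiber (fun s => s.count 1), fs_nat (PG_fiber_LF _ _), crank_zero, fs_congr (crank_pos z y), fs_mul_left L1, gs, gs, fs_nat L,
    ← gs, euler_V]
  ring


/-! ### F1 -/
theorem zp4 {w : ℂ} (h : w ^ 4 = -1) (k : ℤ) : w ^ (4 * k) = (-1) ^ k := by
  rw [zpow_mul]; congr 1

theorem neg_one_zneg (k : ℤ) : (-1 : ℂ) ^ (-k) = (-1) ^ k := by
  rw [zpow_neg, ← inv_zpow]; norm_num

theorem eps_ex {n : ℤ} (hn : Even (tri n)) : ∃ e : ℂ, ∀ w : ℂ, w ^ 4 = -1 →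
    w ^ n + w ^ (-1 - n) = e * (1 + w⁻¹) := by
  have h := tri_spec n
  obtain ⟨m, hm⟩ := hn
  have h4 : n % 4 = 0 ∨ n % 4 = 3 := by
    have h5 : (n * (n + 1)) % 4 = 0 := by rw [← h, hm]; push_cast; omega
    have h6 : n % 4 = 0 ∨ n % 4 = 1 ∨ n % 4 = 2 ∨ n % 4 = 3 := by omega
    rcases h6 with h6 | h6 | h6 | h6
    · exact Or.inl h6
    · rw [Int.mul_emod, Int.add_emod, h6] at h5; norm_num at h5
    · rw [Int.mul_emod, Int.add_emod, h6] at h5; norm_num at h5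
    · exact Or.inr h6
  rcases h4 with h4 | h4
  · obtain ⟨k, rfl⟩ : ∃ k, n = 4 * k := ⟨n / 4, by omega⟩
    refine ⟨(-1) ^ k, fun w hw => ?_⟩
    have w0 : w ≠ 0 := by rintro rfl; norm_num at hw
    rw [zp4 hw, show -1 - 4 * k = 4 * (-k) + (-1) by ring, zpow_add₀ w0, zp4 hw, neg_one_zneg, zpow_neg_one]
    ring
  · obtain ⟨k, rfl⟩ : ∃ k, n = 4 * k + 3 := ⟨n / 4, by omega⟩
    refine ⟨-(-1) ^ k, fun w hw => ?_⟩
    have w0 : w ≠ 0 := by rintro rfl; norm_num at hw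
    have h3 : w ^ (3:ℤ) = - w⁻¹ := by
      field_simp
      exact hw
    rw [zpow_add₀ w0, zp4 hw, h3, show -1 - (4 * k + 3) = 4 * (-k-1) by ring, zp4 hw,
      show -k - 1 = -(k + 1) by ring, neg_one_zneg, zpow_add₀ (by norm_num), zpow_one]
    ring

theorem jc_w {w : ℂ} (w0 : w ≠ 0) (r : ℤ) : jc (C w * X) (C w⁻¹) r = C (w ^ r) * X ^ tri r := by
  have h1 := tri_spec r
  have h2 := tri_spec (r-1)
  have e : r = (tri r : ℤ) - tri (r-1) := by linarith
  have : w ^ r = w ^ tri r * (w⁻¹) ^ tri (r-1) := by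
    conv_lhs => rw [e]
    rw [zpow_sub₀ w0, zpow_natCast, zpow_natCast, inv_pow]; rfl
  rw [jc, mul_pow, this, map_mul, map_pow, map_pow]; ring

theorem w_LF (c : ℤ → ℂ) : LF (fun r => C (c r) * (X:PS) ^ tri r) :=
  LFz tri (fun n => (dvd_refl _).mul_left _) 1 (fun n => tri_pos_ge n)

theorem EPi {w : ℂ} (h : w ^ 4 = -1) :
    C (2 * (1 + w⁻¹)) * (Ei X * ip (fun k => quad X (-(C w + C w⁻¹)) (k+1))) =
    fs (fun r => C (w ^ r + w ^ (-1 - r)) * X ^ tri r) := by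
  have w0 : w ≠ 0 := by rintro rfl; norm_num at h
  have hc : (C w : PS) * C w⁻¹ = 1 := by rw [← map_mul, mul_inv_cancel₀ w0, map_one]
  have hj := jtp (u := C w * X) (v := C w⁻¹) hX (by linear_combination X * hc)
  have hs : fs (fun r => C (w ^ r + w ^ (-1 - r)) * (X:PS) ^ tri r) =
      2 * fs (jc (C w * X) (C w⁻¹)) := by
    have a1 : fs (jc (C w * X) (C w⁻¹)) = fs (fun r => C (w ^ r) * (X:PS) ^ tri r) :=
      fs_congr (jc_w w0)
    have a2 : fs (jc (C w * X) (C w⁻¹)) = fs (fun r => C (w ^ (-1-r)) * (X:PS) ^ tri r) := by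
      rw [a1, ← fs_refl (-1)]
      exact fs_congr fun r => by rw [tri_neg]
    rw [two_mul]
    nth_rw 1 [a1]
    rw [a2, ← fs_add (w_LF _) (w_LF _)]
    exact fs_congr fun r => by rw [map_add, add_mul]
  rw [hs, hj]
  have A1 : Adm (fun i => 1 + (C w⁻¹) * (X:PS) ^ i) := adm_pow hX _
  have A2 : Adm (fun i => 1 + (C w * X) * (X:PS) ^ i) := adm_pow hX _
  rw [ip_shift A1, mul_left_comm (ip _), ← ip_mul A2 A1.shift]
  have : (fun i => (1 + (C w * X) * (X:PS) ^ i) * (1 + (C w⁻¹) * (X:PS) ^ (i+1))) = (fun k => quad X (-(C w + C w⁻¹)) (k+1)) := by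
    funext i
    rw [quad]
    linear_combination (X ^ (2 * (i+1))) * hc
  rw [this, map_mul, map_add, map_one, map_ofNat]
  ring

theorem EPi' {w : ℂ} (h : w ^ 4 = -1) :
    Ei X * ip (fun k => quad X (-(C w + C w⁻¹)) (k+1)) =
    fs (fun r => C ((w ^ r + w ^ (-1 - r)) / (2 * (1 + w⁻¹))) * X ^ tri r) := by
  have h1 : 2 * (1 + w⁻¹) ≠ 0 := by
    intro h0
    have w0 : w ≠ 0 := by rintro rfl; norm_num at h
    have : w = -1 := by
      field_simp at h0; linear_combination h0 / 2
    rw [this] at h; norm_num at h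
  apply mul_left_cancel₀ (a := (C (2 * (1 + w⁻¹)) : PS))
  · exact ne_zero_of_cc (by simpa using h1)
  · rw [EPi h, ← fs_mul_left (w_LF _)]
    refine fs_congr fun r => ?_
    rw [← mul_assoc, ← map_mul, mul_div_cancel₀ _ h1]

theorem F1 {w : ℂ} (h : w ^ 4 = -1) {n : ℕ} (hn : Even n) :
    coeff n (Ei X * Bi X (C w + C w⁻¹)) = coeff n (Ei X * Bi X (-(C w + C w⁻¹))) := by
  have w0 : w ≠ 0 := by rintro rfl; norm_num at h
  have hc : (C w : PS) * C w⁻¹ = 1 := by rw [← map_mul, mul_inv_cancel₀ w0, map_one]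
  have hm : (-w) ^ 4 = -1 := by rw [← h]; ring
  set s : PS := C w + C w⁻¹ with hs
  have hs2 : s ^ 2 = 2 := by
    have : w ^ 2 + (w⁻¹) ^ 2 = 0 := by field_simp; linear_combination h
    have h2 : (C w : PS) ^ 2 + (C w⁻¹) ^ 2 = 0 := by
      rw [← map_pow, ← map_pow, ← map_add, this, map_zero]
    rw [hs]; linear_combination h2 + 2 * hc
  have e1 := EPi' h
  have e2 := EPi' hm
  rw [← hs] at e1
  have hms : -(C (-w) + C (-w)⁻¹ : PS) = s := by
    rw [hs, inv_neg, map_neg, map_neg]; ring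
  rw [hms] at e2
  set P1 := ip (fun k => quad X (-s) (k+1)) with hP1
  set P2 := ip (fun k => quad X s (k+1)) with hP2
  have hD : rescale (-1 : ℂ) (Ei X * P1 - Ei X * P2) = -(Ei X * P1 - Ei X * P2) := by
    rw [e1, e2, ← fs_sub (w_LF _) (w_LF _)]
    rw [rs_fs _ ((w_LF _).sub (w_LF _)), ← fs_neg]
    refine fs_congr fun r => ?_
    rw [← sub_mul, ← map_sub, map_mul, rs_C, rs_Xpow]
    rcases Nat.even_or_odd (tri r) with ht | ht
    · obtain ⟨e, he⟩ := eps_ex ht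
      have nz : ∀ v : ℂ, v ^ 4 = -1 → 1 + v⁻¹ ≠ 0 := by
        intro v hv h0
        have v0 : v ≠ 0 := by rintro rfl; norm_num at hv
        have : v = -1 := by field_simp at h0; linear_combination h0
        rw [this] at hv; norm_num at hv
      rw [he w h, he (-w) hm]
      have : e * (1 + w⁻¹) / (2 * (1 + w⁻¹)) - e * (1 + (-w)⁻¹) / (2 * (1 + (-w)⁻¹)) = 0 := by
        rw [mul_div_mul_right _ _ (nz w h), mul_div_mul_right _ _ (nz _ hm), sub_self]
      rw [this]; simp
    · rw [ht.neg_one_pow]; simp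
  have hq : P1 * P2 = Pp (X^4) := by
    rw [hP1, hP2, Pp, ← ip_mul (quad_adm hX) (quad_adm hX)]
    congr 1; funext k
    rw [quad, quad]
    linear_combination (-X ^ (2 * (k+1))) * hs2
  have b1 : P2 * Bi X s = 1 := Bi_mul hX
  have b2 : P1 * Bi X (-s) = 1 := Bi_mul hX
  have hPe : rescale (-1 : ℂ) (Pp (X^4)) = Pp (X^4) := by
    rw [Pp, rs_ip]; congr 1; funext i
    rw [map_add, map_one, map_pow, rs_Xpow_of _ (by norm_num)]
  have hP0 : Pp (X^4) ≠ 0 := by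
    intro h0
    rw [h0] at hq
    rcases mul_eq_zero.1 hq with h | h
    · rw [h] at b2; simp at b2
    · rw [h] at b1; simp at b1
  set D := Ei X * Bi X s - Ei X * Bi X (-s) with hDd
  have hDP : Pp (X^4) * D = Ei X * P1 - Ei X * P2 := by
    rw [hDd, ← hq]; linear_combination (Ei X * P1) * b1 - (Ei X * P2) * b2
  have hDo : rescale (-1:ℂ) D = - D := by
    apply mul_left_cancel₀ hP0
    have := congrArg (rescale (-1:ℂ)) hDP
    rw [map_mul, hPe, hD] at this
    linear_combination this + hDP
  have := congrArg (coeff n) hDo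
  rw [coeff_rescale, hn.neg_one_pow, one_mul, map_neg] at this
  have h0 : coeff n D = 0 := by linear_combination this / 2
  rw [hDd, map_sub] at h0
  exact sub_eq_zero.1 h0


/-! ### assembly -/
theorem ind_sum {w : ℂ} (hw : IsPrimitiveRoot w 8) (m : ℤ) (a : ℕ) :
    ∑ j ∈ Finset.range 8, ((w⁻¹) ^ j) ^ a * (w ^ j) ^ m = if m % 8 = (a:ℤ) % 8 then 8 else 0 := by
  have w0 : w ≠ 0 := hw.ne_zero (by norm_num)
  have e : ∀ j : ℕ, ((w⁻¹) ^ j) ^ a * (w ^ j) ^ m = (w ^ (m - a)) ^ j := by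
    intro j
    rw [zpow_sub₀ w0, zpow_natCast, div_pow, ← pow_mul, ← pow_mul, inv_pow, mul_comm j a,
      ← zpow_natCast w j, ← zpow_natCast (w ^ m) j, ← zpow_mul, ← zpow_mul, mul_comm m, div_eq_mul_inv, mul_comm]
  simp only [e]
  split_ifs with h
  · have : w ^ (m - a) = 1 := by
      rw [hw.zpow_eq_one_iff_dvd]; push_cast; omega
    simp [this]
  · have h1 : w ^ (m - a) ≠ 1 := by
      rw [Ne, hw.zpow_eq_one_iff_dvd]; push_cast; omega
    have h8 : (w ^ (m - a)) ^ 8 = 1 := by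
      rw [← zpow_natCast, ← zpow_mul, mul_comm, zpow_mul, zpow_natCast, hw.pow_eq_one, one_zpow]
    have := mul_geom_sum (w ^ (m - a)) 8
    rw [h8, sub_self] at this
    exact (mul_eq_zero.1 this).resolve_left (sub_ne_zero.2 h1)

theorem filt {w : ℂ} (hw : IsPrimitiveRoot w 8) {n : ℕ} (f : n.Partition → ℤ) (a : ℕ) :
    8 * ((Finset.univ.filter (fun p : n.Partition => f p % (8:ℕ) = (a:ℤ) % (8:ℕ))).card : ℂ) =
    ∑ j ∈ Finset.range 8, ((w⁻¹) ^ j) ^ a * ∑ p : n.Partition, (w ^ j) ^ (f p) := by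
  simp only [Finset.mul_sum]
  rw [Finset.sum_comm]
  simp only [ind_sum hw]
  rw [Finset.card_filter]
  push_cast
  rw [Finset.mul_sum]
  refine Finset.sum_congr rfl fun p _ => ?_
  split_ifs <;> simp

theorem mw_const (y : ℂ) (s : Multiset ℕ) : mw (fun _ => y) s = y ^ s.card := by
  simp [mw]

theorem rank_S {z : ℂ} (z0 : z ≠ 0) (n : ℕ) :
    ∑ p : n.Partition, z ^ (partitionRank p) = coeff n (Rt (C z + C z⁻¹)) := by
  rw [← rank_gf (mul_inv_cancel₀ z0), coeff_PG]
  refine Finset.sum_congr rfl fun p _ => ?_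
  rw [partitionRank, mw_const, zpow_sub₀ z0, zpow_natCast, zpow_natCast, inv_pow]; rfl

theorem crank_S {z : ℂ} (z0 : z ≠ 0) {n : ℕ} (hn : 2 ≤ n) :
    ∑ p : n.Partition, z ^ (partitionCrank p) = coeff n (Ei X * Bi X (C z + C z⁻¹)) := by
  have h := congrArg (coeff n) (crank_gf (mul_inv_cancel₀ z0))
  rw [map_add, map_sub, coeff_C_mul, coeff_X, if_neg (by omega), mul_zero, sub_zero, zero_add] at h
  rw [← h, coeff_PG]
  refine Finset.sum_congr rfl fun p _ => ?_
  rw [partitionCrank, cw]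
  split_ifs with h1
  · rw [zpow_natCast]
  · rw [zpow_sub₀ z0, zpow_natCast, zpow_natCast, inv_pow]; rfl

theorem eight {w : ℂ} (hw : w ^ 4 = -1) (S : PS → ℂ) (a : ℕ) (T : ℕ → ℂ)
    (hT : ∀ j, T j = S (C (w ^ j) + C (w ^ j)⁻¹)) :
    ∑ j ∈ Finset.range 8, ((w⁻¹) ^ j) ^ a * T j =
    T 0 + (w⁻¹) ^ a * S (C w + C w⁻¹) + ((w⁻¹) ^ 2) ^ a * S 0 + ((w⁻¹) ^ 3) ^ a * S (-(C w + C w⁻¹))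
     + ((w⁻¹) ^ 4) ^ a * S (-2) + ((w⁻¹) ^ 5) ^ a * S (-(C w + C w⁻¹)) + ((w⁻¹) ^ 6) ^ a * S 0
     + ((w⁻¹) ^ 7) ^ a * S (C w + C w⁻¹) := by
  have w0 : w ≠ 0 := by rintro rfl; norm_num at hw
  have c2 : (-2 : PS) = C (-2) := by rw [map_neg, map_ofNat]
  have t1 : T 1 = S (C w + C w⁻¹) := by rw [hT, pow_one]
  have t2 : T 2 = S 0 := by
    rw [hT, ← map_add]; congr 1; rw [← map_zero C]; congr 1; field_simp; linear_combination hw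
  have t3 : T 3 = S (-(C w + C w⁻¹)) := by
    rw [hT, ← map_add, ← map_add, ← map_neg]; congr 2; field_simp; linear_combination (w^2+1) * hw
  have t4 : T 4 = S (-2) := by
    rw [hT, ← map_add, c2, hw]; congr 2; norm_num
  have t5 : T 5 = S (-(C w + C w⁻¹)) := by
    rw [hT, ← map_add, ← map_add, ← map_neg]; congr 2; field_simp; linear_combination (w^6+1) * hw
  have t6 : T 6 = S 0 := by
    rw [hT, ← map_add]; congr 1; rw [← map_zero C]; congr 1; field_simp; linear_combination (w^8-w^4+1) * hw
  have t7 : T 7 = S (C w + C w⁻¹) := by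
    rw [hT, ← map_add, ← map_add]; congr 2; field_simp; linear_combination (w^10-w^6-w^4+1) * hw
  simp only [Finset.sum_range_succ, Finset.sum_range_zero, t1, t2, t3, t4, t5, t6, t7]
  simp

theorem main16 (n : ℕ) :
    crankCount 1 8 (4 * n + 2) = crankCount 3 8 (4 * n + 2) ∧
    crankCount 3 8 (4 * n + 2) = rankCount 0 8 (4 * n + 2) ∧
    rankCount 0 8 (4 * n + 2) = rankCount 2 8 (4 * n + 2) := by
  obtain ⟨w, hp⟩ : ∃ w : ℂ, IsPrimitiveRoot w 8 := ⟨_, Complex.isPrimitiveRoot_exp 8 (by norm_num)⟩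
  have w0 : w ≠ 0 := hp.ne_zero (by norm_num)
  have hw : w ^ 4 = -1 := by
    have h1 : w ^ 4 ≠ 1 := hp.pow_ne_one_of_pos_of_lt (by norm_num) (by norm_num)
    have h2 : (w ^ 4 - 1) * (w ^ 4 + 1) = 0 := by linear_combination hp.pow_eq_one
    linear_combination (mul_eq_zero.1 h2).resolve_left (sub_ne_zero.2 h1)
  set N := 4 * n + 2 with hN
  have hc : (C w : PS) * C w⁻¹ = 1 := by rw [← map_mul, mul_inv_cancel₀ w0, map_one]
  have hs2 : (C w + C w⁻¹ : PS) ^ 2 = 2 := by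
    have : w ^ 2 + (w⁻¹) ^ 2 = 0 := by field_simp; linear_combination hw
    have h2 : (C w : PS) ^ 2 + (C w⁻¹) ^ 2 = 0 := by
      rw [← map_pow, ← map_pow, ← map_add, this, map_zero]
    linear_combination h2 + 2 * hc
  have hev : Even N := ⟨2 * n + 1, by omega⟩
  have f1 := F1 hw hev
  have f2 := F2 hs2 n
  have f3 := F3 hev
  rw [← hN, map_add, map_add, show (2:PS) = C 2 from (map_ofNat C 2).symm, coeff_C_mul] at f2
  have R := fun a => (filt hp (n := N) partitionRank a).trans (eight hw (fun t => coeff N (Rt t)) a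
    (fun j => ∑ p : N.Partition, (w ^ j) ^ (partitionRank p)) (fun j => rank_S (pow_ne_zero _ w0) N))
  have K := fun a => (filt hp (n := N) partitionCrank a).trans (eight hw (fun t => coeff N (Ei X * Bi X t)) a
    (fun j => ∑ p : N.Partition, (w ^ j) ^ (partitionCrank p)) (fun j => crank_S (pow_ne_zero _ w0) (by omega)))
  have r0 := R 0
  have r2 := R 2
  have k1 := K 1
  have k3 := K 3
  simp only [pow_zero, one_zpow] at r0 r2 k1 k3
  have u4 : (w⁻¹) ^ 4 = -1 := by rw [inv_pow, hw]; norm_num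
  generalize w⁻¹ = u at *
  rw [← f1, f3] at k1 k3
  generalize coeff N (Rt (C w + C u)) = A at *
  generalize coeff N (Rt (-(C w + C u))) = D at *
  generalize coeff N (Rt 0) = B at *
  generalize coeff N (Rt (-2)) = E at *
  generalize coeff N (Ei X * Bi X (C w + C u)) = A' at *
  generalize coeff N (Ei X * Bi X 0) = B' at *
  have u5 : u ^ 5 = -u := by linear_combination u * u4
  have u6 : u ^ 6 = -u ^ 2 := by linear_combination u ^ 2 * u4
  have u7 : u ^ 7 = -u ^ 3 := by linear_combination u ^ 3 * u4
  rw [u4, u5, u6, u7] at r2 k1 k3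
  change 8 * ((rankCount 0 8 N : ℕ) : ℂ) = _ at r0
  change 8 * ((rankCount 2 8 N : ℕ) : ℂ) = _ at r2
  change 8 * ((crankCount 1 8 N : ℕ) : ℂ) = _ at k1
  change 8 * ((crankCount 3 8 N : ℕ) : ℂ) = _ at k3
  set P := ∑ p : N.Partition, (1:ℂ) with hP
  have q0 : 8 * ((rankCount 0 8 N : ℕ) : ℂ) = P + E - 2 * B := by
    linear_combination r0 + 2 * f2
  have q2 : 8 * ((rankCount 2 8 N : ℕ) : ℂ) = P + E - 2 * B := by
    linear_combination r2 + (u ^ 2 * A + 2 * B + u ^ 2 * D) * u4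
  have q1 : 8 * ((crankCount 1 8 N : ℕ) : ℂ) = P + E - 2 * B := by
    linear_combination k1
  have q3 : 8 * ((crankCount 3 8 N : ℕ) : ℂ) = P + E - 2 * B := by
    linear_combination k3
  refine ⟨?_, ?_, ?_⟩
  · have : ((crankCount 1 8 N : ℕ) : ℂ) = (crankCount 3 8 N : ℕ) := by linear_combination (q1 - q3) / 8
    exact_mod_cast this
  · have : ((crankCount 3 8 N : ℕ) : ℂ) = (rankCount 0 8 N : ℕ) := by linear_combination (q3 - q0) / 8
    exact_mod_cast this
  · have : ((rankCount 0 8 N : ℕ) : ℂ) = (rankCount 2 8 N : ℕ) := by linear_combination (q0 - q2) / 8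
    exact_mod_cast this

theorem stmt_16 : ∀ n : ℕ,
    crankCount 1 8 (4 * n + 2) = crankCount 3 8 (4 * n + 2) ∧
    crankCount 3 8 (4 * n + 2) = rankCount 0 8 (4 * n + 2) ∧
    rankCount 0 8 (4 * n + 2) = rankCount 2 8 (4 * n + 2) := by
  exact fun n => main16 n
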